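/- arXiv:1406.3283 — 5 statements merged into one kernel-verified Lean document; each statement's English description precedes it below -/
import Mathlib

section
/- Let t ∈ ℝ and let a, q be integers with q ≥ 1, gcd(a,q) = 1 and |t/(2π) − a/q| ≤ 1/q². Then there is an absolute constant C (independent of t, a, q, N) such that for every integer N ≥ 1, sup_{x∈ℝ} |Σ_{n=1}^{N} e^{-itn² + inx}| ≤ C ( N/√q + √(N log q) + √(q log q) ). -/
open Finset

lemma ws_normsq (c : ℕ → ℂ) (N : ℕ) :
    ‖∑ n ∈ range N, c n‖ ^ 2 ≤
      2 * ∑ h ∈ range N, ‖∑ n ∈ range (N - h), c (n + h) * (starRingEnd ℂ) (c n)‖ := by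
  have key : ∀ N : ℕ, ‖∑ n ∈ range N, c n‖ ^ 2 ≤
      2 * (∑ m ∈ range N, ∑ k ∈ range (m + 1), c m * (starRingEnd ℂ) (c (m - k))).re := by
    intro N
    induction N with
    | zero => simp
    | succ N ih =>
      rw [sum_range_succ, sum_range_succ _ N]
      have h1 : ∑ k ∈ range (N + 1), c N * (starRingEnd ℂ) (c (N - k))
          = c N * (starRingEnd ℂ) (∑ n ∈ range N, c n + c N) := by
        rw [← sum_range_succ, map_sum, mul_sum,
          ← sum_range_reflect (fun k => c N * (starRingEnd ℂ) (c k)) (N + 1)]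
        apply sum_congr rfl
        intro k _
        congr 3
      rw [h1, Complex.add_re]
      have h2 : ∀ s d : ℂ, ‖s + d‖ ^ 2 ≤ ‖s‖ ^ 2 + 2 * (d * (starRingEnd ℂ) (s + d)).re := by
        intro s d
        rw [← Complex.normSq_eq_norm_sq, ← Complex.normSq_eq_norm_sq, Complex.normSq_apply,
          Complex.normSq_apply]
        simp
        nlinarith [sq_nonneg d.re, sq_nonneg d.im]
      have := h2 (∑ n ∈ range N, c n) (c N)
      linarith
  have h := Finset.sum_range_diag_flip N
    (fun h n => c (n + h) * (starRingEnd ℂ) (c n))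
  have h' : ∑ m ∈ range N, ∑ k ∈ range (m + 1), c m * (starRingEnd ℂ) (c (m - k)) =
      ∑ h ∈ range N, ∑ n ∈ range (N - h), c (n + h) * (starRingEnd ℂ) (c n) := by
    rw [← h]
    apply sum_congr rfl
    intro m _
    apply sum_congr rfl
    intro k hk
    have : m - k + k = m := by
      have := mem_range.1 hk
      omega
    rw [this]
  have k1 := key N
  rw [h'] at k1
  have k2 := Complex.re_le_norm (∑ h ∈ range N, ∑ n ∈ range (N - h), c (n + h) * (starRingEnd ℂ) (c n))
  have k3 := norm_sum_le (range N) (fun h => ∑ n ∈ range (N - h), c (n + h) * (starRingEnd ℂ) (c n))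
  linarith

lemma ws_sin (y : ℝ) : 2 * |y - round y| ≤ |Real.sin (Real.pi * y)| := by
  have h1 : |y - round y| ≤ 1 / 2 := abs_sub_round y
  have h2 : |Real.sin (Real.pi * y)| = |Real.sin (Real.pi * (y - round y))| := by
    rw [mul_sub, mul_comm Real.pi (round y : ℝ), Real.sin_sub_int_mul_pi, abs_mul]
    simp
  have hp := Real.pi_pos
  rw [h2]
  have h3 := Real.mul_abs_le_abs_sin (x := Real.pi * (y - round y))
    (by rw [abs_mul, abs_of_pos hp]; nlinarith)
  rw [abs_mul, abs_of_pos hp] at h3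
  calc _ = 2 / Real.pi * (Real.pi * |y - round y|) := by field_simp
    _ ≤ _ := h3

lemma ws_geom (u : ℝ) (K : ℕ) :
    ‖∑ n ∈ range K, Complex.exp (Complex.I * ((2 * Real.pi * u : ℝ) : ℂ)) ^ n‖ * |u - round u| ≤ 1 := by
  set z := Complex.exp (Complex.I * ((2 * Real.pi * u : ℝ) : ℂ)) with hz
  have hz1 : ‖z‖ = 1 := by rw [hz, mul_comm, Complex.norm_exp_ofReal_mul_I]
  have h1 : ‖∑ n ∈ range K, z ^ n‖ * ‖z - 1‖ ≤ 2 := by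
    rw [← norm_mul, geom_sum_mul]
    calc _ ≤ ‖z ^ K‖ + ‖(1:ℂ)‖ := norm_sub_le _ _
      _ = 2 := by rw [norm_pow, hz1]; norm_num
  have h2 : ‖z - 1‖ = 2 * |Real.sin (Real.pi * u)| := by
    rw [hz, Complex.norm_exp_I_mul_ofReal_sub_one, Real.norm_eq_abs, abs_mul]
    norm_num
    congr 2
    ring
  have h3 := ws_sin u
  rw [h2] at h1
  have h4 := mul_le_mul_of_nonneg_left h3 (norm_nonneg (∑ n ∈ range K, z ^ n))
  have h5 := mul_nonneg (norm_nonneg (∑ n ∈ range K, z ^ n)) (abs_nonneg (u - round u))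
  nlinarith

lemma ws_dist (y A B : ℝ) (k : ℤ) (hA : 0 ≤ A) (hB : 0 ≤ B)
    (h1 : A ≤ y - k) (h2 : y - k ≤ 1 - B) (F : ℝ) (hF : 0 ≤ F) (h : F * |y - round y| ≤ 1) :
    F * A ≤ 1 ∨ F * B ≤ 1 := by
  rcases le_total (round y) k with hk | hk
  · left
    have : (round y : ℝ) ≤ k := by exact_mod_cast hk
    refine le_trans (mul_le_mul_of_nonneg_left ?_ hF) h
    exact le_trans (by linarith) (le_abs_self _)
  · rcases eq_or_lt_of_le hk with hk | hk
    · left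
      refine le_trans (mul_le_mul_of_nonneg_left ?_ hF) h
      rw [← hk]
      exact le_trans (by linarith) (le_abs_self _)
    · right
      have : (k : ℝ) + 1 ≤ round y := by exact_mod_cast hk
      refine le_trans (mul_le_mul_of_nonneg_left ?_ hF) h
      exact le_trans (by linarith) (neg_le_abs _)

noncomputable def wsg (N q : ℕ) (r : ℕ) : ℝ := (if r ≤ 1 then (N : ℝ) else 0) + 3 * q / (r + 1)

lemma wsg_nonneg (N q r : ℕ) : 0 ≤ wsg N q r := by
  unfold wsg
  split_ifs <;> positivity

lemma wsg_sum (N q : ℕ) : ∑ r ∈ range q, wsg N q r ≤ 2 * N + 3 * q * (1 + Real.log q) := by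
  unfold wsg
  rw [sum_add_distrib]
  apply add_le_add
  · rw [← sum_filter, sum_const, nsmul_eq_mul]
    have : #{x ∈ range q | x ≤ 1} ≤ 2 := by
      calc _ ≤ #(range 2) := card_le_card (by intro x; simp)
        _ = 2 := by simp
    have : ((#{x ∈ range q | x ≤ 1} : ℕ) : ℝ) ≤ 2 := by exact_mod_cast this
    gcongr
  · have h := harmonic_le_one_add_log q
    have : ((harmonic q : ℚ) : ℝ) = ∑ r ∈ range q, 1 / ((r : ℝ) + 1) := by
      simp [harmonic]
    rw [this] at h
    calc _ = 3 * q * ∑ r ∈ range q, 1 / ((r : ℝ) + 1) := by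
          rw [mul_sum]; apply sum_congr rfl; intros; ring
      _ ≤ _ := by gcongr

lemma ws_point (N q : ℕ) (hq : 0 < q) (y e F : ℝ) (k : ℤ) (r : ℕ) (hr : r < q)
    (hy : y = k + r / q + e) (he1 : -(1 / q) ≤ e) (he2 : e ≤ 2 / q)
    (hF0 : 0 ≤ F) (hFN : F ≤ N) (hF : F * |y - round y| ≤ 1) :
    F ≤ wsg N q r + wsg N q (q - 1 - r) := by
  have hq' : (0 : ℝ) < q := by exact_mod_cast hq
  by_cases h1 : r ≤ 1
  · have : F ≤ wsg N q r := by
      unfold wsg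
      rw [if_pos h1]
      have : (0 : ℝ) ≤ 3 * q / (r + 1) := by positivity
      linarith
    linarith [wsg_nonneg N q (q - 1 - r)]
  by_cases h2 : q - 1 - r ≤ 1
  · have : F ≤ wsg N q (q - 1 - r) := by
      unfold wsg
      rw [if_pos h2]
      have : (0 : ℝ) ≤ 3 * q / (((q - 1 - r : ℕ) : ℝ) + 1) := by positivity
      linarith
    linarith [wsg_nonneg N q r]
  obtain ⟨s, hs⟩ : ∃ s, s = q - 1 - r := ⟨_, rfl⟩
  have hsum : (q : ℝ) = r + s + 1 := by
    have : q = r + s + 1 := by omega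
    exact_mod_cast this
  have hr2 : (2 : ℝ) ≤ r := by exact_mod_cast (by omega : 2 ≤ r)
  have hs2 : (2 : ℝ) ≤ s := by exact_mod_cast (by omega : 2 ≤ s)
  have aux : ∀ v : ℕ, (2 : ℝ) ≤ v → F * ((v - 1) / q) ≤ 1 → F ≤ wsg N q v := by
    intro v hv h
    have : F ≤ 3 * q / (v + 1) := by
      rw [le_div_iff₀ (by linarith)]
      rw [← mul_div_assoc, div_le_one hq'] at h
      nlinarith
    unfold wsg
    split_ifs
    · have : (0 : ℝ) ≤ N := by positivity
      linarith
    · linarith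
  rw [← hs]
  rcases ws_dist y ((r - 1) / q) ((s - 1) / q) k (div_nonneg (by linarith) hq'.le)
    (div_nonneg (by linarith) hq'.le)
    (by rw [hy, sub_div]; linarith)
    (by
      rw [hy]
      have : (1 : ℝ) - (s - 1) / q = r / q + 2 / q := by
        field_simp
        linarith
      linarith) F hF0 hF with h | h
  · linarith [aux r hr2 h, wsg_nonneg N q s]
  · linarith [aux s hs2 h, wsg_nonneg N q r]

lemma ws_block (N q : ℕ) (hq : 0 < q) (a : ℤ) (ha : Int.gcd a q = 1) (θ : ℝ)
    (hθ : |θ - (a : ℝ) / q| ≤ 1 / (q : ℝ) ^ 2) (F : ℕ → ℝ) (hF0 : ∀ m, 0 ≤ F m)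
    (hFN : ∀ m, F m ≤ N) (hF : ∀ m : ℕ, F m * |θ * m - round (θ * m)| ≤ 1) (m₀ : ℕ) :
    ∑ j ∈ range q, F (m₀ + j) ≤ 2 * (2 * N + 3 * q * (1 + Real.log q)) := by
  have hq' : (0 : ℝ) < q := by exact_mod_cast hq
  have hqz : (0 : ℤ) < q := by exact_mod_cast hq
  set b : ℤ := ⌊θ * m₀ * q⌋ with hb
  set σ : ℕ → ℕ := fun j => ((b + a * j) % q).toNat with hσ
  have hσz : ∀ j, ((σ j : ℕ) : ℤ) = (b + a * j) % q := fun j =>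
    Int.toNat_of_nonneg (Int.emod_nonneg _ hqz.ne')
  have hσlt : ∀ j, σ j < q := by
    intro j
    have := Int.emod_lt_of_pos (b + a * j) hqz
    rw [← hσz] at this
    exact_mod_cast this
  have hinj : Set.InjOn σ (range q : Set ℕ) := by
    intro i hi j hj hij
    simp only [coe_range, Set.mem_Iio] at hi hj
    have h1 : (b + a * i) % q = (b + a * j) % q := by rw [← hσz, ← hσz, hij]
    have h2 := Int.ModEq.dvd h1
    have h3 : (q : ℤ) ∣ a * ((j : ℤ) - i) := by
      convert h2 using 1; ring
    have h4 : (q : ℤ) ∣ (j : ℤ) - i :=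
      Int.dvd_of_dvd_mul_right_of_gcd_one h3 (by rw [Int.gcd_comm]; exact ha)
    have h5 := Int.eq_zero_of_abs_lt_dvd h4 (by rw [abs_lt]; constructor <;> omega)
    omega
  set G : ℕ → ℝ := fun r => wsg N q r + wsg N q (q - 1 - r) with hG
  have hpt : ∀ j ∈ range q, F (m₀ + j) ≤ G (σ j) := by
    intro j hj
    have hjq : (j : ℝ) ≤ q := by exact_mod_cast (mem_range.1 hj).le
    have hj0 : (0 : ℝ) ≤ j := by positivity
    have hb1 : (b : ℝ) ≤ θ * m₀ * q := Int.floor_le _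
    have hb2 : θ * m₀ * q < b + 1 := Int.lt_floor_add_one _
    have hdecomp : ((b : ℝ) + a * j) = q * ((b + a * j) / (q : ℤ) : ℤ) + (σ j : ℝ) := by
      have h := Int.mul_ediv_add_emod (b + a * j) q
      rw [← hσz] at h
      exact_mod_cast h.symm
    have hd : |(θ - (a : ℝ) / q) * j| ≤ 1 / q := by
      rw [abs_mul, abs_of_nonneg hj0]
      calc _ ≤ 1 / (q : ℝ) ^ 2 * q := by gcongr
        _ = 1 / q := by field_simp
    have hε1 : 0 ≤ θ * m₀ - b / q := by
      rw [sub_nonneg, div_le_iff₀ hq']; exact hb1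
    have hε2 : θ * m₀ - b / q ≤ 1 / q := by
      rw [sub_le_iff_le_add, ← add_div, le_div_iff₀ hq']; linarith
    have hd' := abs_le.1 hd
    refine ws_point N q hq (θ * ((m₀ + j : ℕ) : ℝ))
      ((θ * m₀ - b / q) + (θ - (a : ℝ) / q) * j) _ ((b + a * j) / (q : ℤ)) (σ j) (hσlt j) ?_
      (by linarith) ?_ (hF0 _) (hFN _) (hF _)
    · have : (((b + a * j) / (q : ℤ) : ℤ) : ℝ) + (σ j : ℝ) / q = (b + a * j) / q := by
        rw [hdecomp]; field_simp
      rw [this]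
      push_cast
      field_simp
      ring
    · have : (2 : ℝ) / q = 1 / q + 1 / q := by ring
      linarith
  calc ∑ j ∈ range q, F (m₀ + j) ≤ ∑ j ∈ range q, G (σ j) := sum_le_sum hpt
    _ = ∑ r ∈ (range q).image σ, G r := (sum_image hinj).symm
    _ ≤ ∑ r ∈ range q, G r := by
        apply sum_le_sum_of_subset_of_nonneg
        · intro r hr
          obtain ⟨j, _, rfl⟩ := mem_image.1 hr
          exact mem_range.2 (hσlt j)
        · intro r _ _
          exact add_nonneg (wsg_nonneg _ _ _) (wsg_nonneg _ _ _)
    _ = 2 * ∑ r ∈ range q, wsg N q r := by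
        rw [hG, sum_add_distrib, sum_range_reflect]; ring
    _ ≤ _ := by linarith [wsg_sum N q]

lemma ws_total (N q : ℕ) (hq : 0 < q) (a : ℤ) (ha : Int.gcd a q = 1) (θ : ℝ)
    (hθ : |θ - (a : ℝ) / q| ≤ 1 / (q : ℝ) ^ 2) (F : ℕ → ℝ) (hF0 : ∀ m, 0 ≤ F m)
    (hFN : ∀ m, F m ≤ N) (hF : ∀ m : ℕ, F m * |θ * m - round (θ * m)| ≤ 1) (M : ℕ) :
    ∑ m ∈ range M, F m ≤ ((M : ℝ) / q + 1) * (2 * (2 * N + 3 * q * (1 + Real.log q))) := by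
  have hblocks : ∀ B : ℕ, ∑ m ∈ range (B * q), F m ≤
      B * (2 * (2 * N + 3 * q * (1 + Real.log q))) := by
    intro B
    induction B with
    | zero => simp
    | succ B ih =>
      rw [add_mul, one_mul, sum_range_add]
      have := ws_block N q hq a ha θ hθ F hF0 hFN hF (B * q)
      push_cast
      linarith
  have hlt : M < (M / q + 1) * q := by
    have := Nat.div_add_mod M q
    have := Nat.mod_lt M hq
    nlinarith
  have hL : 0 ≤ Real.log q := Real.log_natCast_nonneg q
  calc _ ≤ ∑ m ∈ range ((M / q + 1) * q), F m :=
        sum_le_sum_of_subset_of_nonneg (range_mono hlt.le) (fun _ _ _ => hF0 _)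
    _ ≤ _ := hblocks _
    _ ≤ _ := by
      apply mul_le_mul_of_nonneg_right _ (by positivity)
      push_cast
      have := Nat.cast_div_le (α := ℝ) (m := M) (n := q)
      linarith

lemma ws_inner (t x : ℝ) (h n : ℕ) :
    Complex.exp (Complex.I * (((n + h + 1 : ℕ) : ℂ) * (x : ℂ) - (t : ℂ) * ((n + h + 1 : ℕ) : ℂ) ^ 2)) *
      (starRingEnd ℂ) (Complex.exp (Complex.I * (((n + 1 : ℕ) : ℂ) * (x : ℂ)
        - (t : ℂ) * ((n + 1 : ℕ) : ℂ) ^ 2))) =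
    Complex.exp (((h * x - t * (2 * h + h ^ 2) : ℝ) : ℂ) * Complex.I) *
      (Complex.exp (Complex.I * ((2 * Real.pi * (-(t / (2 * Real.pi) * (2 * h : ℕ))) : ℝ) : ℂ))) ^ n := by
  have hp : 2 * Real.pi * (-(t / (2 * Real.pi) * (2 * h : ℕ))) = - (2 * t * h) := by
    have := Real.pi_pos
    push_cast
    field_simp
  rw [hp, ← Complex.exp_conj, ← Complex.exp_nat_mul, ← Complex.exp_add, ← Complex.exp_add]
  congr 1
  simp only [map_mul, map_sub, map_pow, Complex.conj_I, Complex.conj_ofReal, Complex.conj_natCast]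
  push_cast
  ring

lemma ws_dist_neg (y : ℝ) : |(-y) - round (-y)| = |y - round y| := by
  apply le_antisymm
  · calc _ ≤ |(-y) - ((-round y : ℤ) : ℝ)| := round_le _ _
      _ = _ := by push_cast; rw [← abs_neg]; congr 1; ring
  · calc _ ≤ |y - ((-round (-y) : ℤ) : ℝ)| := round_le _ _
      _ = _ := by push_cast; rw [← abs_neg]; congr 1; ring

lemma ws_sq (t x : ℝ) (a : ℤ) (q N : ℕ) (hq : 0 < q) (ha : Int.gcd a q = 1)
    (ht : |t / (2 * Real.pi) - (a : ℝ) / (q : ℝ)| ≤ 1 / (q : ℝ) ^ 2) :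
    ‖∑ n ∈ Finset.Icc 1 N,
      Complex.exp (Complex.I * ((n : ℂ) * (x : ℂ) - (t : ℂ) * (n : ℂ) ^ 2))‖ ^ 2 ≤
      2 * (((2 * N : ℕ) / (q : ℝ) + 1) * (2 * (2 * N + 3 * q * (1 + Real.log q)))) := by
  set z : ℕ → ℂ := fun m =>
    Complex.exp (Complex.I * ((2 * Real.pi * (-(t / (2 * Real.pi) * m)) : ℝ) : ℂ)) with hz
  have hz1 : ∀ m, ‖z m‖ = 1 := by
    intro m; rw [hz]; simp only []; rw [mul_comm, Complex.norm_exp_ofReal_mul_I]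
  set F : ℕ → ℝ := fun m => ‖∑ n ∈ range (N - m / 2), z m ^ n‖ with hFdef
  have h1 := ws_total N q hq a ha (t / (2 * Real.pi)) ht F (fun m => norm_nonneg _)
    (by
      intro m
      calc F m ≤ ∑ n ∈ range (N - m / 2), ‖z m ^ n‖ := norm_sum_le _ _
        _ = ((N - m / 2 : ℕ) : ℝ) := by simp [norm_pow, hz1]
        _ ≤ N := by exact_mod_cast Nat.sub_le _ _)
    (by
      intro m
      have := ws_geom (-(t / (2 * Real.pi) * m)) (N - m / 2)
      rw [ws_dist_neg] at this
      exact this) (2 * N)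
  rw [← Finset.Ico_add_one_right_eq_Icc, Finset.sum_Ico_eq_sum_range]
  have h2 := ws_normsq (fun n => Complex.exp (Complex.I * (((n + 1 : ℕ) : ℂ) * (x : ℂ)
        - (t : ℂ) * ((n + 1 : ℕ) : ℂ) ^ 2))) N
  have h3 : ∑ h ∈ range N, F (2 * h) ≤ ∑ m ∈ range (2 * N), F m := by
    rw [← sum_image (f := F) (g := fun h => 2 * h) (by intro i _ j _ h; simpa using h)]
    apply sum_le_sum_of_subset_of_nonneg
    · intro r hr
      obtain ⟨j, hj, rfl⟩ := mem_image.1 hr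
      have := mem_range.1 hj
      exact mem_range.2 (by omega)
    · intro _ _ _; exact norm_nonneg _
  have h4 : N + 1 - 1 = N := rfl
  rw [h4]
  simp_rw [add_comm 1]
  refine le_trans h2 (mul_le_mul_of_nonneg_left (le_trans (le_of_eq ?_) (le_trans h3 h1)) (by norm_num))
  apply sum_congr rfl
  intro h _
  simp_rw [ws_inner]
  rw [← mul_sum, norm_mul, Complex.norm_exp_ofReal_mul_I, one_mul, hFdef]
  simp [hz]

/-- Weyl sum estimate (Theorem 3.3): if `|t/(2π) - a/q| ≤ 1/q²` with `gcd(a,q)=1`, `q ≥ 1`,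
then `sup_x |Σ_{n=1}^N e^{-itn² + inx}| ≤ C (N/√q + √(N log q) + √(q log q))` with an
absolute constant `C`. -/
theorem weyl_sum_quadratic :
    ∃ C : ℝ, 0 < C ∧ ∀ (t : ℝ) (a q : ℤ), 1 ≤ q → Int.gcd a q = 1 →
      |t / (2 * Real.pi) - (a : ℝ) / (q : ℝ)| ≤ 1 / (q : ℝ) ^ 2 →
      ∀ N : ℕ, 1 ≤ N → ∀ x : ℝ,
        ‖∑ n ∈ Finset.Icc 1 N,
            Complex.exp (Complex.I * ((n : ℂ) * (x : ℂ) - (t : ℂ) * (n : ℂ) ^ 2))‖ ≤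
          C * ((N : ℝ) / Real.sqrt (q : ℝ) + Real.sqrt ((N : ℝ) * Real.log (q : ℝ)) +
            Real.sqrt ((q : ℝ) * Real.log (q : ℝ))) := by
  refine ⟨10, by norm_num, ?_⟩
  intro t a q hq ha ht N hN x
  lift q to ℕ using by omega
  simp only [Int.cast_natCast] at *
  have hq0 : 0 < q := by omega
  by_cases hq1 : q = 1
  · subst hq1
    have : ‖∑ n ∈ Finset.Icc 1 N,
            Complex.exp (Complex.I * ((n : ℂ) * (x : ℂ) - (t : ℂ) * (n : ℂ) ^ 2))‖ ≤ N := by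
      refine le_trans (norm_sum_le _ _) ?_
      have : ∀ n ∈ Finset.Icc 1 N, ‖Complex.exp (Complex.I * ((n : ℂ) * (x : ℂ) - (t : ℂ) * (n : ℂ) ^ 2))‖ ≤ (1:ℝ) := by
        intro n _
        have : Complex.I * ((n : ℂ) * (x : ℂ) - (t : ℂ) * (n : ℂ) ^ 2)
          = ((n * x - t * n ^ 2 : ℝ) : ℂ) * Complex.I := by push_cast; ring
        rw [this, Complex.norm_exp_ofReal_mul_I]
      refine le_trans (sum_le_sum this) ?_
      simp
    have hN0 : (0 : ℝ) ≤ N := by positivity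
    simp only [Nat.cast_one, Real.sqrt_one, Real.log_one, mul_zero, Real.sqrt_zero, div_one]
    linarith
  have h := ws_sq t x a q N hq0 ha ht
  have hq2 : (2 : ℝ) ≤ q := by exact_mod_cast (by omega : 2 ≤ q)
  have hL : 1 / 2 ≤ Real.log q := by
    have := Real.log_le_log (by norm_num) hq2
    linarith [Real.log_two_gt_d9]
  set L := Real.log q with hLdef
  have hN0 : (0 : ℝ) ≤ N := by positivity
  have hA : 0 ≤ (N : ℝ) / Real.sqrt q := by positivity
  have hA2 : ((N : ℝ) / Real.sqrt q) ^ 2 = N ^ 2 / q := by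
    rw [div_pow, Real.sq_sqrt (by linarith)]
  have hB := Real.sqrt_nonneg (N * L)
  have hB2 := Real.sq_sqrt (show 0 ≤ N * L by nlinarith)
  have hC := Real.sqrt_nonneg (q * L)
  have hC2 := Real.sq_sqrt (show 0 ≤ q * L by nlinarith)
  have hNq : 0 ≤ (N : ℝ) ^ 2 / q := by positivity
  refine (pow_le_pow_iff_left₀ (norm_nonneg _) (by positivity) two_ne_zero).1 ?_
  refine le_trans h ?_
  have e1 : 2 * (((2 * N : ℕ) / (q : ℝ) + 1) * (2 * (2 * N + 3 * q * (1 + L)))) =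
      16 * (N ^ 2 / q) + 24 * N * (1 + L) + 8 * N + 12 * q * (1 + L) := by
    push_cast
    field_simp
    ring
  have e2 : (N : ℝ) ≤ 2 * (N * L) := by nlinarith
  have e3 : (q : ℝ) ≤ 2 * (q * L) := by nlinarith
  rw [e1]
  set A := (N : ℝ) / Real.sqrt q
  set B := Real.sqrt (N * L)
  set D := Real.sqrt (q * L)
  have e4 := mul_nonneg hA hB
  have e5 := mul_nonneg hA hC
  have e6 := mul_nonneg hB hC
  nlinarith
end

section
/- There exists an absolute constant γ > 1 such that for almost every t ∈ ℝ (with respect to Lebesgue measure) the following holds: the set Q(t) = { q ∈ ℤ, q ≥ 1 : there exists a ∈ ℤ with |t/(2π) − a/q| ≤ 1/q² } is infinite, and if q₁(t) < q₂(t) < q₃(t) < ⋯ is its increasing enumeration, then lim_{k→∞} q_k(t)^{1/k} = γ. -/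
open Filter MeasureTheory

/-- The set of positive integer denominators `q` for which the Dirichlet condition
`|t/(2π) - a/q| ≤ 1/q²` holds for some integer `a`. -/
def dirichletSet (t : ℝ) : Set ℕ :=
  {q : ℕ | 1 ≤ q ∧ ∃ a : ℤ, |t / (2 * Real.pi) - (a : ℝ) / (q : ℝ)| ≤ 1 / (q : ℝ) ^ 2}

noncomputable def kmu : Measure ℝ := volume.restrict (Set.Ico (0 : ℝ) 1)

instance kmu_prob : IsProbabilityMeasure kmu := ⟨by simp [kmu]⟩

theorem k_unfold {ι : Type*} [Countable ι] (I : ι → Set ℝ) (hI : ∀ i, MeasurableSet (I i))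
    (A : Set ℝ) (hA : ∀ x ∈ A, ∃ i, ∃ n : ℤ, x - n ∈ I i) :
    kmu A ≤ ∑' i, volume (I i) := by
  have key : ∀ i, ∑' n : ℤ, kmu {x | x - (n : ℝ) ∈ I i} ≤ volume (I i) := by
    intro i
    have h1 : ∀ n : ℤ, kmu {x | x - (n : ℝ) ∈ I i}
        = volume (I i ∩ Set.Ico ((-n : ℤ) : ℝ) ((-n : ℤ) + 1)) := by
      intro n
      have hm : MeasurableSet {x : ℝ | x - (n : ℝ) ∈ I i} :=
        (measurable_id.sub_const (n : ℝ)) (hI i)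
      rw [kmu, Measure.restrict_apply hm]
      have : {x : ℝ | x - (n : ℝ) ∈ I i} ∩ Set.Ico 0 1 =
          (fun x => x - (n : ℝ)) ⁻¹' (I i ∩ Set.Ico ((-n : ℤ) : ℝ) ((-n : ℤ) + 1)) := by
        ext x
        simp only [Set.mem_inter_iff, Set.mem_ofPred_eq, Set.mem_Ico, Set.mem_preimage]
        push_cast
        constructor
        · rintro ⟨h, h2, h3⟩; exact ⟨h, by linarith, by linarith⟩
        · rintro ⟨h, h2, h3⟩; exact ⟨h, by linarith, by linarith⟩
      rw [this]
      simp only [sub_eq_add_neg]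
      rw [measure_preimage_add_right]
    simp_rw [h1]
    have h2 := (Equiv.neg ℤ).tsum_eq (fun n : ℤ => volume (I i ∩ Set.Ico (n : ℝ) (n + 1)))
    simp only [Equiv.neg_apply] at h2
    rw [h2]
    rw [← measure_iUnion]
    · exact measure_mono (Set.iUnion_subset fun n => Set.inter_subset_left)
    · intro a b hab
      exact ((Set.pairwise_disjoint_Ico_intCast ℝ) hab).mono Set.inter_subset_right
        Set.inter_subset_right
    · exact fun n => (hI i).inter measurableSet_Ico
  calc kmu A ≤ kmu (⋃ i, ⋃ n : ℤ, {x | x - (n : ℝ) ∈ I i}) := by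
        apply measure_mono
        intro x hx
        obtain ⟨i, n, h⟩ := hA x hx
        exact Set.mem_iUnion.2 ⟨i, Set.mem_iUnion.2 ⟨n, h⟩⟩
    _ ≤ ∑' i, kmu (⋃ n : ℤ, {x | x - (n : ℝ) ∈ I i}) := measure_iUnion_le _
    _ ≤ ∑' i, ∑' n : ℤ, kmu {x | x - (n : ℝ) ∈ I i} :=
        ENNReal.tsum_le_tsum fun i => measure_iUnion_le _
    _ ≤ _ := ENNReal.tsum_le_tsum key

theorem k_ball (q : ℕ) (hq : 1 ≤ q) (ρ : ℝ) (hρ : 0 ≤ ρ) (P : ℤ → Prop) [DecidablePred P]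
    (hP : ∀ a n : ℤ, P a → P (a + q * n)) :
    kmu.real {x | ∃ a : ℤ, P a ∧ |x - a / q| ≤ ρ} ≤
      ((Finset.range q).filter (fun a : ℕ => P (a : ℤ))).card * (2 * ρ) := by
  have hq0 : (q : ℝ) ≠ 0 := by positivity
  have hqz : (0 : ℤ) < q := by exact_mod_cast hq
  have h := k_unfold (ι := ((Finset.range q).filter (fun a : ℕ => P (a : ℤ))))
    (fun a => Metric.closedBall (((a : ℕ) : ℝ) / q) ρ) (fun a => measurableSet_closedBall)
    {x | ∃ a : ℤ, P a ∧ |x - a / q| ≤ ρ} (by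
      rintro x ⟨a, ha, hx⟩
      have h0 := Int.emod_nonneg a hqz.ne'
      have h1 := Int.emod_lt_of_pos a hqz
      have h2 := Int.emod_add_mul_ediv a q
      refine ⟨⟨(a % q).toNat, ?_⟩, a / q, ?_⟩
      · simp only [Finset.mem_filter, Finset.mem_range]
        refine ⟨by omega, ?_⟩
        rw [Int.toNat_of_nonneg h0]
        have := hP a (-(a / q)) ha
        convert this using 1
        linarith
      · rw [Metric.mem_closedBall, Real.dist_eq]
        have h3 : (((a % q).toNat : ℕ) : ℝ) = (a : ℝ) - q * ((a / q : ℤ) : ℝ) := by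
          have : (((a % q).toNat : ℕ) : ℤ) = a - q * (a / q) := by
            rw [Int.toNat_of_nonneg h0]; linarith
          exact_mod_cast this
        simp only [h3]
        convert hx using 2
        field_simp
        ring)
  simp only [Real.volume_closedBall, tsum_fintype, Finset.sum_const, Finset.card_univ,
    Fintype.card_coe, nsmul_eq_mul] at h
  rw [Measure.real]
  refine ENNReal.toReal_le_of_le_ofReal (by positivity) (h.trans (le_of_eq ?_))
  rw [ENNReal.ofReal_mul (p := (Finset.card _ : ℝ)) (by positivity), ENNReal.ofReal_natCast]

theorem k_tsum_int (X : ℝ) (hX : 0 ≤ X) :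
    ∑' k : ℤ, (if k ≠ 0 ∧ |(k : ℝ)| ≤ X then (1 : ENNReal) else 0) ≤ ENNReal.ofReal (2 * X) := by
  have hs : ∀ k : ℤ, k ∉ (Finset.Icc (-(⌊X⌋₊ : ℤ)) ⌊X⌋₊).erase 0 →
      (if k ≠ 0 ∧ |(k : ℝ)| ≤ X then (1 : ENNReal) else 0) = 0 := by
    intro k hk
    rw [if_neg]
    rintro ⟨h0, h1⟩
    apply hk
    have : k.natAbs ≤ ⌊X⌋₊ := by
      apply Nat.le_floor
      rw [Nat.cast_natAbs]; exact_mod_cast h1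
    simp only [Finset.mem_erase, Finset.mem_Icc]
    omega
  rw [tsum_eq_sum hs]
  calc _ ≤ ∑ k ∈ (Finset.Icc (-(⌊X⌋₊ : ℤ)) ⌊X⌋₊).erase 0, (1 : ENNReal) :=
        Finset.sum_le_sum fun k _ => by split_ifs <;> simp
    _ = ((2 * ⌊X⌋₊ : ℕ) : ENNReal) := by
        rw [Finset.sum_const, nsmul_eq_mul, mul_one, Finset.card_erase_of_mem (by simp),
          Int.card_Icc]
        congr 1
        omega
    _ ≤ _ := by
        rw [← ENNReal.ofReal_natCast]
        apply ENNReal.ofReal_le_ofReal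
        push_cast
        have := Nat.floor_le hX
        linarith

theorem k_tsum_g (α β δ : ℝ) (hβ : 0 < β) (hαβ : β ≤ α) (hδ : 0 < δ) :
    ∑' k : ℤ, (if k ≠ 0 then ENNReal.ofReal (min (2 * β) (α + β - δ * |(k : ℝ)|)) else 0)
      ≤ ENNReal.ofReal (4 * α * β / δ) := by
  have h1 : ∀ k : ℤ, (if k ≠ 0 then ENNReal.ofReal (min (2 * β) (α + β - δ * |(k : ℝ)|)) else 0)
      = ∫⁻ y in Set.Ioc 0 (2 * β), (if k ≠ 0 ∧ |(k : ℝ)| ≤ (α + β - y) / δ then (1 : ENNReal) else 0) := by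
    intro k
    by_cases hk : k = 0
    · simp [hk]
    · have : (fun y : ℝ => (if k ≠ 0 ∧ |(k : ℝ)| ≤ (α + β - y) / δ then (1 : ENNReal) else 0))
        = (Set.Iic (α + β - δ * |(k : ℝ)|)).indicator (fun _ => (1 : ENNReal)) := by
        ext y
        simp only [Set.indicator, Set.mem_Iic, hk, ne_eq, not_false_eq_true, true_and, le_div_iff₀ hδ]
        congr 1
        apply propext
        constructor <;> intro h <;> linarith
      rw [this, lintegral_indicator measurableSet_Iic, Measure.restrict_restrict measurableSet_Iic]
      simp only [lintegral_const, one_mul, Measure.restrict_apply_univ]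
      rw [Set.inter_comm, Set.Ioc_inter_Iic, Real.volume_Ioc]
      simp [hk]
  simp_rw [h1]
  rw [← lintegral_tsum]
  · calc _ ≤ ∫⁻ y in Set.Ioc 0 (2 * β), ENNReal.ofReal (2 * ((α + β - y) / δ)) := by
          apply setLIntegral_mono (by fun_prop)
          intro y hy
          apply k_tsum_int
          apply div_nonneg _ hδ.le
          linarith [hy.2]
      _ = ENNReal.ofReal (∫ y in Set.Ioc 0 (2 * β), (2 * ((α + β - y) / δ))) := by
          rw [ofReal_integral_eq_lintegral_ofReal]
          · apply Continuous.integrableOn_Ioc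
            fun_prop
          · refine (ae_restrict_iff' measurableSet_Ioc).2 (ae_of_all _ fun y hy => ?_)
            have : 0 ≤ α + β - y := by linarith [hy.2]
            simp only [Pi.zero_apply]
            positivity
      _ ≤ _ := by
          apply ENNReal.ofReal_le_ofReal
          rw [← intervalIntegral.integral_of_le (by positivity)]
          simp only [intervalIntegral.integral_const_mul, intervalIntegral.integral_div]
          rw [intervalIntegral.integral_sub (by simp) (by simp)]
          simp only [intervalIntegral.integral_const, integral_id, smul_eq_mul]
          apply le_of_eq
          field_simp
          ring
  · intro k
    apply Measurable.aemeasurable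
    apply Measurable.ite _ measurable_const measurable_const
    have h3 : MeasurableSet {y : ℝ | |(k : ℝ)| ≤ (α + β - y) / δ} :=
      measurableSet_le measurable_const (by fun_prop)
    exact (MeasurableSet.const (k ≠ 0)).inter h3

theorem k_meas (c ρ : ℝ) : MeasurableSet {x : ℝ | |x - c| ≤ ρ} :=
  measurableSet_le (by fun_prop) measurable_const

theorem k_vol_pair (a b α β : ℝ) :
    volume {x : ℝ | |x - a| ≤ α ∧ |x - b| ≤ β} ≤
      ENNReal.ofReal (min (2 * β) (α + β - |a - b|)) := by
  have h1 : {x : ℝ | |x - a| ≤ α ∧ |x - b| ≤ β} ⊆ Set.Icc (b - β) (b + β) := by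
    rintro x ⟨-, h⟩
    rw [abs_le] at h
    constructor <;> linarith
  have h2 := (measure_mono h1).trans_eq (Real.volume_Icc (a := b - β) (b := b + β))
  have h3 : volume {x : ℝ | |x - a| ≤ α ∧ |x - b| ≤ β} ≤ ENNReal.ofReal (α + β - |a - b|) := by
    rcases le_total 0 (a - b) with h | h
    · have h4 : {x : ℝ | |x - a| ≤ α ∧ |x - b| ≤ β} ⊆ Set.Icc (a - α) (b + β) := by
        rintro x ⟨h, h'⟩
        rw [abs_le] at h h'
        constructor <;> linarith
      refine (measure_mono h4).trans_eq ?_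
      rw [Real.volume_Icc, abs_of_nonneg h]
      congr 1; ring
    · have h4 : {x : ℝ | |x - a| ≤ α ∧ |x - b| ≤ β} ⊆ Set.Icc (b - β) (a + α) := by
        rintro x ⟨h, h'⟩
        rw [abs_le] at h h'
        constructor <;> linarith
      refine (measure_mono h4).trans_eq ?_
      rw [Real.volume_Icc, abs_of_nonpos h]
      congr 1; ring
  rcases min_cases (2 * β) (α + β - |a - b|) with h | h
  · rw [h.1]; convert h2 using 2; ring
  · rw [h.1]; exact h3

theorem k_off (q r : ℕ) (hq : 1 ≤ q) (hqr : q < r) :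
    kmu.real {x | ∃ a b : ℤ, a * r ≠ b * q ∧ |x - a / q| ≤ 1 / (q : ℝ) ^ 2 ∧
      |x - b / r| ≤ 1 / (r : ℝ) ^ 2} ≤ 4 / (q * r) := by
  have hr : 1 ≤ r := by omega
  have hq0 : (0 : ℝ) < q := by exact_mod_cast hq
  have hr0 : (0 : ℝ) < r := by exact_mod_cast hr
  have hqz : (0 : ℤ) < q := by exact_mod_cast hq
  obtain ⟨d, hd⟩ : ∃ d, d = Nat.gcd q r := ⟨_, rfl⟩
  have hdpos : 0 < d := hd ▸ Nat.gcd_pos_of_pos_left _ hq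
  obtain ⟨q', hq'⟩ : d ∣ q := hd ▸ Nat.gcd_dvd_left q r
  obtain ⟨r', hr'⟩ : d ∣ r := hd ▸ Nat.gcd_dvd_right q r
  have hcop : Nat.Coprime q' r' := by
    have h : d * Nat.gcd q' r' = d * 1 := by
      rw [← Nat.gcd_mul_left, ← hq', ← hr', ← hd, mul_one]
    exact Nat.eq_of_mul_eq_mul_left hdpos h
  have hq'pos : 0 < q' := by
    rcases Nat.eq_zero_or_pos q' with h | h
    · rw [h] at hq'; omega
    · exact h
  have hr'pos : 0 < r' := by
    rcases Nat.eq_zero_or_pos r' with h | h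
    · rw [h] at hr'; omega
    · exact h
  have hd0 : (0 : ℝ) < d := by exact_mod_cast hdpos
  have hq'0 : (0 : ℝ) < q' := by exact_mod_cast hq'pos
  have hr'0 : (0 : ℝ) < r' := by exact_mod_cast hr'pos
  have hqR : (q : ℝ) = d * q' := by exact_mod_cast hq'
  have hrR : (r : ℝ) = d * r' := by exact_mod_cast hr'
  have h := k_unfold (ι := {p : Fin q × ℤ // ((p.1 : ℕ) : ℤ) * r ≠ p.2 * q})
    (fun p => {x | |x - ((p.1.1 : ℕ) : ℝ) / q| ≤ 1 / (q : ℝ) ^ 2 ∧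
      |x - (p.1.2 : ℝ) / r| ≤ 1 / (r : ℝ) ^ 2})
    (fun p => (k_meas _ _).inter (k_meas _ _))
    {x | ∃ a b : ℤ, a * r ≠ b * q ∧ |x - a / q| ≤ 1 / (q : ℝ) ^ 2 ∧
      |x - b / r| ≤ 1 / (r : ℝ) ^ 2} (by
      rintro x ⟨a, b, hab, hx, hy⟩
      have h0 := Int.emod_nonneg a hqz.ne'
      have h1 := Int.emod_lt_of_pos a hqz
      have h2 := Int.emod_add_mul_ediv a q
      have h4 : (((a % q).toNat : ℕ) : ℤ) = a - q * (a / q) := by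
        rw [Int.toNat_of_nonneg h0]; linarith
      have h3 : (((a % q).toNat : ℕ) : ℝ) = (a : ℝ) - q * ((a / q : ℤ) : ℝ) := by
        exact_mod_cast h4
      refine ⟨⟨⟨⟨(a % q).toNat, by zify; rw [Int.toNat_of_nonneg h0]; exact h1⟩, b - r * (a / q)⟩, ?_⟩, a / q, ?_, ?_⟩
      · simp only [h4]
        intro h
        apply hab
        linarith
      · simp only [h3]
        convert hx using 2
        field_simp
        ring
      · push_cast
        convert hy using 2
        field_simp
        ring)
  have hb : ∀ p : {p : Fin q × ℤ // ((p.1 : ℕ) : ℤ) * r ≠ p.2 * q},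
      ((p.1.1 : ℕ) : ℤ) * r' - p.1.2 * q' ≠ 0 := by
    rintro ⟨⟨a, b⟩, hab⟩ h
    apply hab
    simp only [hq', hr'] at h ⊢
    push_cast
    linear_combination (d : ℤ) * h
  let φ : {p : Fin q × ℤ // ((p.1 : ℕ) : ℤ) * r ≠ p.2 * q} → ℤ × Fin d := fun p =>
    (((p.1.1 : ℕ) : ℤ) * r' - p.1.2 * q', ⟨(p.1.1 : ℕ) / q', by
      apply Nat.div_lt_of_lt_mul
      rw [mul_comm, ← hq']
      exact p.1.1.2⟩)
  have hφ : Function.Injective φ := by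
    rintro ⟨⟨a1, b1⟩, h1⟩ ⟨⟨a2, b2⟩, h2⟩ h
    simp only [φ, Prod.mk.injEq, Fin.mk.injEq] at h
    obtain ⟨e1, e2⟩ := h
    have hdv : (q' : ℤ) ∣ ((a1 : ℕ) : ℤ) - (a2 : ℕ) := by
      have : (q' : ℤ) ∣ (((a1 : ℕ) : ℤ) - (a2 : ℕ)) * r' := ⟨b1 - b2, by linear_combination e1⟩
      exact (Nat.isCoprime_iff_coprime.2 hcop).dvd_of_dvd_mul_right this
    have hmod : (a1 : ℕ) % q' = (a2 : ℕ) % q' := by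
      have := (Int.emod_emod_of_dvd ((a1 : ℕ) : ℤ) (dvd_refl (q' : ℤ)))
      have h5 := Int.emod_emod_of_dvd
      have h6 : ((a2 : ℕ) : ℤ) ≡ (a1 : ℕ) [ZMOD q'] := Int.modEq_iff_dvd.2 hdv
      have h7 := (Int.natCast_modEq_iff.1 h6)
      exact h7.symm
    have ha : (a1 : ℕ) = a2 := by
      rw [← Nat.div_add_mod (a1 : ℕ) q', ← Nat.div_add_mod (a2 : ℕ) q', e2, hmod]
    have hbb : b1 = b2 := by
      rw [ha] at e1
      have : b1 * (q' : ℤ) = b2 * q' := by linarith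
      exact Int.eq_of_mul_eq_mul_right (by exact_mod_cast hq'pos.ne') this
    have ha' : a1 = a2 := Fin.ext ha
    subst ha' hbb
    rfl
  let δ : ℝ := d / (q * r)
  have hδ : 0 < δ := by positivity
  let f : ℤ × Fin d → ENNReal := fun p => if p.1 ≠ 0 then ENNReal.ofReal
    (min (2 * (1 / (r : ℝ) ^ 2)) (1 / (q : ℝ) ^ 2 + 1 / (r : ℝ) ^ 2 - δ * |(p.1 : ℝ)|)) else 0
  have h1 : kmu {x | ∃ a b : ℤ, a * r ≠ b * q ∧ |x - a / q| ≤ 1 / (q : ℝ) ^ 2 ∧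
      |x - b / r| ≤ 1 / (r : ℝ) ^ 2} ≤ ENNReal.ofReal (4 / (q * r)) := by
    calc _ ≤ _ := h
      _ ≤ ∑' p, f (φ p) := by
          apply ENNReal.tsum_le_tsum
          intro p
          refine (k_vol_pair _ _ _ _).trans (le_of_eq ?_)
          simp only [f, φ, if_pos (hb p)]
          congr 3
          rw [← abs_of_pos hδ, ← abs_mul]
          congr 1
          simp only [δ]
          push_cast
          rw [hqR, hrR]
          field_simp
      _ ≤ ∑' p, f p := ENNReal.tsum_comp_le_tsum_of_injective hφ f
      _ = ∑' k : ℤ, ∑' j : Fin d, f (k, j) := ENNReal.tsum_prod (f := fun k j => f (k, j))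
      _ = (d : ENNReal) * ∑' k : ℤ, (if k ≠ 0 then ENNReal.ofReal
        (min (2 * (1 / (r : ℝ) ^ 2)) (1 / (q : ℝ) ^ 2 + 1 / (r : ℝ) ^ 2 - δ * |(k : ℝ)|)) else 0) := by
          rw [← ENNReal.tsum_mul_left]
          congr 1
          ext k
          simp only [f, tsum_fintype, Finset.sum_const, Finset.card_univ, Fintype.card_fin,
            nsmul_eq_mul]
      _ ≤ (d : ENNReal) * ENNReal.ofReal (4 * (1 / (q : ℝ) ^ 2) * (1 / (r : ℝ) ^ 2) / δ) := by
          gcongr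
          apply k_tsum_g _ _ _ (by positivity) _ hδ
          apply one_div_le_one_div_of_le (by positivity)
          have : (q : ℝ) ≤ r := by exact_mod_cast hqr.le
          gcongr
      _ = _ := by
          rw [← ENNReal.ofReal_natCast, ← ENNReal.ofReal_mul (by positivity)]
          congr 1
          simp only [δ]
          field_simp
  exact ENNReal.toReal_le_of_le_ofReal (by positivity) h1

def kE (q : ℕ) : Set ℝ := {x | ∃ a : ℤ, |x - a / q| ≤ 1 / (q : ℝ) ^ 2}
def kF (M q : ℕ) : Set ℝ := {x | ∃ a : ℤ, Int.gcd a q ≤ M ∧ |x - a / q| ≤ 1 / (q : ℝ) ^ 2}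
noncomputable def kH (N : ℕ) : ℝ := ∑ q ∈ Finset.Icc 1 N, 1 / (q : ℝ)

theorem kF_sub (M q : ℕ) : kF M q ⊆ kE q := fun _ ⟨a, _, h⟩ => ⟨a, h⟩

theorem kH_nonneg (N : ℕ) : 0 ≤ kH N := Finset.sum_nonneg fun _ _ => by positivity

theorem kE_meas (q : ℕ) : MeasurableSet (kE q) := by
  have : kE q = ⋃ a : ℤ, {x : ℝ | |x - a / q| ≤ 1 / (q : ℝ) ^ 2} := by
    ext x; simp [kE]
  rw [this]
  exact MeasurableSet.iUnion fun a => k_meas _ _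

theorem kF_meas (M q : ℕ) : MeasurableSet (kF M q) := by
  have : kF M q = ⋃ a : ℤ, ⋃ _ : Int.gcd a q ≤ M, {x : ℝ | |x - a / q| ≤ 1 / (q : ℝ) ^ 2} := by
    ext x; simp [kF]
  rw [this]
  exact MeasurableSet.iUnion fun a => MeasurableSet.iUnion fun _ => k_meas _ _

theorem k_card_dvd (m r : ℕ) (hm : m ∣ r) (hr : 1 ≤ r) :
    ((Finset.range r).filter (fun b => m ∣ b)).card ≤ r / m := by
  rw [← Finset.card_range (r / m)]
  have hm0 : 0 < m := Nat.pos_of_dvd_of_pos hm hr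
  apply Finset.card_le_card_of_injOn (fun b => b / m)
  · intro b hb
    simp only [Finset.coe_filter, Finset.mem_range, Set.mem_ofPred_eq] at hb
    simp only [Finset.coe_range, Set.mem_Iio]
    exact Nat.div_lt_div_of_lt_of_dvd hm hb.1
  · intro a ha b hb h
    simp only [Finset.coe_filter, Finset.mem_range, Set.mem_ofPred_eq] at ha hb h
    rw [← Nat.div_mul_cancel ha.2, ← Nat.div_mul_cancel hb.2, h]

theorem k_mult_sum (m N : ℕ) (hm : 1 ≤ m) :
    ∑ q ∈ (Finset.Icc 1 N).filter (fun q => m ∣ q), 1 / (q : ℝ) ≤ kH N / m := by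
  have h1 : (Finset.Icc 1 N).filter (fun q => m ∣ q) ⊆ (Finset.Icc 1 N).image (fun j => m * j) := by
    intro q hq
    simp only [Finset.mem_filter, Finset.mem_Icc] at hq
    obtain ⟨⟨h1, h2⟩, j, rfl⟩ := hq
    simp only [Finset.mem_image, Finset.mem_Icc]
    refine ⟨j, ⟨?_, ?_⟩, rfl⟩
    · rcases Nat.eq_zero_or_pos j with h | h
      · simp [h] at h1
      · exact h
    · exact (Nat.le_mul_of_pos_left j hm).trans h2
  refine (Finset.sum_le_sum_of_subset_of_nonneg h1 fun _ _ _ => by positivity).trans ?_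
  rw [Finset.sum_image]
  · rw [kH, Finset.sum_div]
    apply le_of_eq
    apply Finset.sum_congr rfl
    intro j _
    push_cast
    rw [mul_comm, div_div]
  · intro a _ b _ h
    exact Nat.eq_of_mul_eq_mul_left hm h

theorem k_gcd_per (q : ℕ) (a n : ℤ) : Int.gcd (a + q * n) q = Int.gcd a q := by
  simp

theorem kE_upper (q : ℕ) (hq : 1 ≤ q) : kmu.real (kE q) ≤ 2 / q := by
  have h := k_ball q hq (1 / (q : ℝ) ^ 2) (by positivity) (fun _ => True) (fun _ _ h => h)
  simp only [true_and, Finset.filter_true, Finset.card_range] at h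
  refine h.trans (le_of_eq ?_)
  have : (q : ℝ) ≠ 0 := by positivity
  field_simp

theorem kE_lower (q : ℕ) (hq : 2 ≤ q) : 2 / (q : ℝ) ≤ kmu.real (kE q) := by
  have hq0 : (0 : ℝ) < q := by positivity
  have hq2 : (2 : ℝ) ≤ q := by exact_mod_cast hq
  have hρ : 0 ≤ 1 / (2 * q : ℝ) - 1 / (q : ℝ) ^ 2 := by
    have : 1 / (2 * q : ℝ) - 1 / (q : ℝ) ^ 2 = (q - 2) / (2 * q ^ 2) := by field_simp
    rw [this]
    apply div_nonneg <;> [linarith; positivity]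
  have h := k_ball (2 * q) (by omega) (1 / (2 * q : ℝ) - 1 / (q : ℝ) ^ 2) hρ
    (fun a => a % 2 = 1) (fun a n h => by push_cast; rw [mul_assoc]; omega)
  have hsub : (kE q)ᶜ ⊆ {x | ∃ a : ℤ, a % 2 = 1 ∧
      |x - a / (2 * q : ℕ)| ≤ (1 / (2 * q : ℝ) - 1 / (q : ℝ) ^ 2)} := by
    intro x hx
    have hx' : ∀ a : ℤ, 1 / (q : ℝ) ^ 2 < |x - a / q| := by
      intro a
      by_contra hc
      exact hx ⟨a, not_lt.1 hc⟩
    refine ⟨2 * ⌊q * x⌋ + 1, by omega, ?_⟩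
    have f1 := Int.floor_le (q * x)
    have f2 := Int.lt_floor_add_one (q * x)
    have g1 := hx' ⌊q * x⌋
    have g2 := hx' (⌊q * x⌋ + 1)
    generalize ⌊q * x⌋ = z at *
    push_cast at *
    have e1 : (z : ℝ) / q ≤ x := by rw [div_le_iff₀ hq0]; linarith
    have e2 : x ≤ ((z : ℝ) + 1) / q := by rw [le_div_iff₀ hq0]; linarith
    rw [abs_of_nonneg (by linarith)] at g1
    rw [abs_of_nonpos (by linarith)] at g2
    have e3 : (2 * (z : ℝ) + 1) / (2 * q) = z / q + 1 / (2 * q) := by field_simp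
    have e4 : ((z : ℝ) + 1) / q = z / q + 1 / (2 * q) + 1 / (2 * q) := by field_simp; ring
    rw [e3, abs_le]
    rw [e4] at g2
    constructor <;> linarith
  have hc : ((Finset.range (2 * q)).filter (fun a : ℕ => (a : ℤ) % 2 = 1)).card ≤ q := by
    conv_rhs => rw [← Finset.card_range q]
    apply Finset.card_le_card_of_injOn (fun b => b / 2)
    · intro b hb
      simp only [Finset.coe_filter, Finset.mem_range, Set.mem_ofPred_eq] at hb
      simp only [Finset.coe_range, Set.mem_Iio]
      omega
    · intro a ha b hb h
      simp only [Finset.coe_filter, Finset.mem_range, Set.mem_ofPred_eq] at ha hb h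
      omega
  have h2 := (measureReal_mono (μ := kmu) hsub).trans h
  rw [probReal_compl_eq_one_sub (kE_meas q)] at h2
  have hc' : (((Finset.range (2 * q)).filter (fun a : ℕ => (a : ℤ) % 2 = 1)).card : ℝ) ≤ q := by
    exact_mod_cast hc
  have h3 := h2.trans (mul_le_mul_of_nonneg_right hc' (by linarith))
  have e5 : (q : ℝ) * (2 * (1 / (2 * q) - 1 / q ^ 2)) = 1 - 2 / q := by field_simp
  linarith

theorem k_tail_one (M N q : ℕ) (hq : 1 ≤ q) (hqN : q ≤ N) :
    kmu.real (kE q \ kF M q) ≤ ∑ m ∈ (Finset.Ioc M N).filter (fun m => m ∣ q), 2 / ((m : ℝ) * q) := by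
  have hq0 : (0 : ℝ) < q := by positivity
  have h := k_ball q hq (1 / (q : ℝ) ^ 2) (by positivity) (fun a => M < Int.gcd a q)
    (fun a n h => by rw [k_gcd_per]; exact h)
  have hsub : kE q \ kF M q ⊆ {x | ∃ a : ℤ, M < Int.gcd a q ∧ |x - a / q| ≤ 1 / (q : ℝ) ^ 2} := by
    rintro x ⟨⟨a, ha⟩, hx⟩
    refine ⟨a, ?_, ha⟩
    by_contra hc
    exact hx ⟨a, not_lt.1 hc, ha⟩
  refine ((measureReal_mono (μ := kmu) hsub).trans h).trans ?_
  have hc : ((Finset.range q).filter (fun a : ℕ => M < Int.gcd (a : ℤ) q)).card ≤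
      ∑ m ∈ (Finset.Ioc M N).filter (fun m => m ∣ q), q / m := by
    have hs : (Finset.range q).filter (fun a : ℕ => M < Int.gcd (a : ℤ) q) ⊆
      ((Finset.Ioc M N).filter (fun m => m ∣ q)).biUnion
        (fun m => (Finset.range q).filter (fun b => m ∣ b)) := by
      intro a ha
      simp only [Finset.mem_filter, Finset.mem_range, Int.gcd_natCast_natCast] at ha
      simp only [Finset.mem_biUnion, Finset.mem_filter, Finset.mem_range, Finset.mem_Ioc]
      refine ⟨Nat.gcd a q, ⟨⟨ha.2, ?_⟩, Nat.gcd_dvd_right _ _⟩, ha.1, Nat.gcd_dvd_left _ _⟩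
      exact (Nat.gcd_le_right _ hq).trans hqN
    refine (Finset.card_le_card hs).trans (Finset.card_biUnion_le.trans ?_)
    apply Finset.sum_le_sum
    intro m hm
    exact k_card_dvd m q (Finset.mem_filter.1 hm).2 hq
  have hc' : (((Finset.range q).filter (fun a : ℕ => M < Int.gcd (a : ℤ) q)).card : ℝ) ≤
      ∑ m ∈ (Finset.Ioc M N).filter (fun m => m ∣ q), (q : ℝ) / m := by
    refine (Nat.cast_le.2 hc).trans ?_
    push_cast
    exact Finset.sum_le_sum fun m _ => Nat.cast_div_le
  refine (mul_le_mul_of_nonneg_right hc' (by positivity)).trans (le_of_eq ?_)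
  rw [Finset.sum_mul]
  apply Finset.sum_congr rfl
  intro m hm
  simp only [Finset.mem_filter, Finset.mem_Ioc] at hm
  have : (0 : ℝ) < m := by
    have : 0 < m := by omega
    exact_mod_cast this
  field_simp

theorem k_tail (M N : ℕ) (hM : 1 ≤ M) :
    ∑ q ∈ Finset.Icc 1 N, kmu.real (kE q \ kF M q) ≤ 2 * kH N / M := by
  calc _ ≤ ∑ q ∈ Finset.Icc 1 N, ∑ m ∈ (Finset.Ioc M N).filter (fun m => m ∣ q),
          2 / ((m : ℝ) * q) := by
        apply Finset.sum_le_sum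
        intro q hq
        rw [Finset.mem_Icc] at hq
        exact k_tail_one M N q hq.1 hq.2
    _ = ∑ m ∈ Finset.Ioc M N, (2 / (m : ℝ)) *
          ∑ q ∈ (Finset.Icc 1 N).filter (fun q => m ∣ q), 1 / (q : ℝ) := by
        simp_rw [Finset.mul_sum]
        rw [Finset.sum_comm' (t' := Finset.Ioc M N)
          (s' := fun m => (Finset.Icc 1 N).filter (fun q => m ∣ q))]
        · apply Finset.sum_congr rfl
          intro m _
          apply Finset.sum_congr rfl
          intro q _
          rw [div_mul_div_comm, mul_one]
        · intro q m
          simp only [Finset.mem_filter]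
          tauto
    _ ≤ ∑ m ∈ Finset.Ioc M N, (2 * kH N) * ((m : ℝ) ^ 2)⁻¹ := by
        apply Finset.sum_le_sum
        intro m hm
        rw [Finset.mem_Ioc] at hm
        have h0 : (0 : ℝ) < m := by
          have : 0 < m := by omega
          exact_mod_cast this
        refine (mul_le_mul_of_nonneg_left (k_mult_sum m N (by omega)) (by positivity)).trans
          (le_of_eq ?_)
        field_simp
    _ = (2 * kH N) * ∑ m ∈ Finset.Ioc M N, ((m : ℝ) ^ 2)⁻¹ := by rw [Finset.mul_sum]
    _ ≤ (2 * kH N) * (M : ℝ)⁻¹ := by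
        apply mul_le_mul_of_nonneg_left _ (by linarith [kH_nonneg N])
        rcases le_total M N with h | h
        · refine (sum_Ioc_inv_sq_le_sub (by omega) h).trans ?_
          have : (0 : ℝ) ≤ (N : ℝ)⁻¹ := by positivity
          linarith
        · rw [Finset.Ioc_eq_empty_of_le h]; simp
    _ = _ := by rw [div_eq_mul_inv]

theorem k_pair (M q r : ℕ) (hq : 1 ≤ q) (hqr : q < r) :
    kmu.real (kF M q ∩ kF M r) ≤ 4 / (q * r) +
      ((Finset.range r).filter (fun b : ℕ => Int.gcd (b : ℤ) r ≤ M ∧ (r : ℤ) ∣ b * q)).card *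
        (2 * (1 / (r : ℝ) ^ 2)) := by
  have h1 := k_off q r hq hqr
  have h2 := k_ball r (by omega) (1 / (r : ℝ) ^ 2) (by positivity)
    (fun b => Int.gcd b r ≤ M ∧ (r : ℤ) ∣ b * q)
    (fun b n h => ⟨by rw [k_gcd_per]; exact h.1, by
      have : (b + r * n) * (q : ℤ) = b * q + r * (n * q) := by ring
      rw [this]
      exact dvd_add h.2 (dvd_mul_right _ _)⟩)
  refine le_trans ?_ (add_le_add h1 h2)
  refine le_trans (measureReal_mono ?_) (measureReal_union_le _ _)
  rintro x ⟨⟨a, _, ha⟩, b, hb, hx⟩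
  by_cases hab : a * r = b * q
  · exact Or.inr ⟨b, ⟨hb, ⟨a, by rw [← hab]; ring⟩⟩, hx⟩
  · exact Or.inl ⟨a, b, hab, ha, hx⟩

theorem k_diag_one (M r : ℕ) (hr : 1 ≤ r) :
    ∑ q ∈ Finset.Ico 1 r, ((Finset.range r).filter
      (fun b : ℕ => Int.gcd (b : ℤ) r ≤ M ∧ (r : ℤ) ∣ b * q)).card ≤
      ∑ _m ∈ (Finset.Icc 1 M).filter (fun m => m ∣ r), r := by
  have e : ∀ q b : ℕ, ((Int.gcd (b : ℤ) r ≤ M ∧ (r : ℤ) ∣ b * q) ↔ (Nat.gcd b r ≤ M ∧ r ∣ b * q)) := by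
    intro q b
    rw [Int.gcd_natCast_natCast]
    norm_cast
  simp_rw [e]
  calc _ = ∑ q ∈ Finset.Ico 1 r, ∑ b ∈ (Finset.range r).filter (fun b => Nat.gcd b r ≤ M),
          if r ∣ b * q then 1 else 0 := by
        apply Finset.sum_congr rfl
        intro q _
        rw [← Finset.card_filter, Finset.filter_filter]
    _ = ∑ b ∈ (Finset.range r).filter (fun b => Nat.gcd b r ≤ M), ∑ q ∈ Finset.Ico 1 r,
          if r ∣ b * q then 1 else 0 := Finset.sum_comm
    _ ≤ ∑ b ∈ (Finset.range r).filter (fun b => Nat.gcd b r ≤ M), Nat.gcd b r := by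
        apply Finset.sum_le_sum
        intro b _
        have hg : 0 < Nat.gcd b r := Nat.gcd_pos_of_pos_right _ hr
        have hgr : Nat.gcd b r ∣ r := Nat.gcd_dvd_right _ _
        rw [← Finset.card_filter]
        have : (Finset.Ico 1 r).filter (fun q => r ∣ b * q) ⊆
            (Finset.Ioc 0 r).filter (fun q => (r / Nat.gcd b r) ∣ q) := by
          intro q hq
          simp only [Finset.mem_filter, Finset.mem_Ico, Finset.mem_Ioc] at hq ⊢
          refine ⟨by omega, ?_⟩
          have hc := Nat.coprime_div_gcd_div_gcd hg
          apply hc.symm.dvd_of_dvd_mul_left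
          obtain ⟨c, hc⟩ := hq.2
          refine ⟨c, ?_⟩
          apply Nat.eq_of_mul_eq_mul_left hg
          rw [← mul_assoc, ← mul_assoc, Nat.mul_div_cancel' (Nat.gcd_dvd_left b r),
            Nat.mul_div_cancel' hgr, hc]
        refine (Finset.card_le_card this).trans ?_
        rw [Nat.Ioc_filter_dvd_card_eq_div]
        rw [Nat.div_div_self hgr (by omega)]
    _ ≤ ∑ b ∈ (Finset.range r).filter (fun b => Nat.gcd b r ≤ M),
          ∑ m ∈ (Finset.Icc 1 M).filter (fun m => m ∣ r), if m ∣ b then m else 0 := by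
        apply Finset.sum_le_sum
        intro b hb
        have hg : 0 < Nat.gcd b r := Nat.gcd_pos_of_pos_right _ hr
        have hm : Nat.gcd b r ∈ (Finset.Icc 1 M).filter (fun m => m ∣ r) := by
          simp only [Finset.mem_filter, Finset.mem_Icc]
          exact ⟨⟨hg, (Finset.mem_filter.1 hb).2⟩, Nat.gcd_dvd_right _ _⟩
        have := Finset.single_le_sum (f := fun m => if m ∣ b then m else 0)
          (fun m _ => Nat.zero_le _) hm
        simpa [Nat.gcd_dvd_left] using this
    _ ≤ ∑ b ∈ Finset.range r,
          ∑ m ∈ (Finset.Icc 1 M).filter (fun m => m ∣ r), if m ∣ b then m else 0 :=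
        Finset.sum_le_sum_of_subset (Finset.filter_subset _ _)
    _ = ∑ m ∈ (Finset.Icc 1 M).filter (fun m => m ∣ r), ∑ b ∈ Finset.range r,
          if m ∣ b then m else 0 := Finset.sum_comm
    _ ≤ _ := by
        apply Finset.sum_le_sum
        intro m hm
        rw [← Finset.sum_filter, Finset.sum_const, smul_eq_mul]
        have hmr := (Finset.mem_filter.1 hm).2
        exact (Nat.mul_le_mul_right m (k_card_dvd m r hmr hr)).trans (Nat.div_mul_cancel hmr).le

theorem k_diag (M N : ℕ) :
    ∑ r ∈ Finset.Icc 1 N, ∑ q ∈ Finset.Ico 1 r, ((Finset.range r).filter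
      (fun b : ℕ => Int.gcd (b : ℤ) r ≤ M ∧ (r : ℤ) ∣ b * q)).card * (2 * (1 / (r : ℝ) ^ 2))
      ≤ 2 * kH M * kH N := by
  calc _ ≤ ∑ r ∈ Finset.Icc 1 N, ∑ m ∈ (Finset.Icc 1 M).filter (fun m => m ∣ r), 2 * (1 / (r : ℝ)) := by
        apply Finset.sum_le_sum
        intro r hr
        rw [Finset.mem_Icc] at hr
        have hr0 : (0 : ℝ) < r := by exact_mod_cast hr.1
        rw [← Finset.sum_mul]
        have h := k_diag_one M r hr.1
        have h' : (∑ q ∈ Finset.Ico 1 r, (((Finset.range r).filter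
          (fun b : ℕ => Int.gcd (b : ℤ) r ≤ M ∧ (r : ℤ) ∣ b * q)).card : ℝ)) ≤
          ∑ m ∈ (Finset.Icc 1 M).filter (fun m => m ∣ r), (r : ℝ) := by exact_mod_cast h
        refine (mul_le_mul_of_nonneg_right h' (by positivity)).trans (le_of_eq ?_)
        rw [Finset.sum_mul]
        apply Finset.sum_congr rfl
        intro m _
        field_simp
    _ = ∑ m ∈ Finset.Icc 1 M, ∑ r ∈ (Finset.Icc 1 N).filter (fun r => m ∣ r), 2 * (1 / (r : ℝ)) := by
        apply Finset.sum_comm'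
        intro q m
        simp only [Finset.mem_filter]
        tauto
    _ ≤ ∑ m ∈ Finset.Icc 1 M, 2 * (kH N / m) := by
        apply Finset.sum_le_sum
        intro m hm
        rw [← Finset.mul_sum]
        exact mul_le_mul_of_nonneg_left (k_mult_sum m N (Finset.mem_Icc.1 hm).1) (by norm_num)
    _ = _ := by
        have : kH M = ∑ m ∈ Finset.Icc 1 M, 1 / (m : ℝ) := rfl
        rw [this, Finset.mul_sum, Finset.sum_mul]
        apply Finset.sum_congr rfl
        intro m _
        ring

theorem k_symm_sum (f : ℕ → ℕ → ℝ) (hf : ∀ q r, f q r = f r q) (N : ℕ) :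
    ∑ q ∈ Finset.Icc 1 N, ∑ r ∈ Finset.Icc 1 N, f q r =
      ∑ r ∈ Finset.Icc 1 N, f r r + 2 * ∑ r ∈ Finset.Icc 1 N, ∑ q ∈ Finset.Ico 1 r, f q r := by
  induction N with
  | zero => simp
  | succ n ih =>
    have h : 1 ≤ n + 1 := by omega
    simp only [Finset.sum_Icc_succ_top h, Finset.sum_add_distrib, ih]
    have e : Finset.Ico 1 (n + 1) = Finset.Icc 1 n := by ext; simp
    have e2 : ∑ r ∈ Finset.Icc 1 n, f (n + 1) r = ∑ r ∈ Finset.Icc 1 n, f r (n + 1) :=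
      Finset.sum_congr rfl fun r _ => hf _ _
    rw [e, e2]
    ring

noncomputable def kT (M N : ℕ) (x : ℝ) : ℝ :=
  ∑ q ∈ Finset.Icc 1 N, (kF M q).indicator (fun _ => (1 : ℝ)) x
noncomputable def kS (N : ℕ) (x : ℝ) : ℝ :=
  ∑ q ∈ Finset.Icc 1 N, (kE q).indicator (fun _ => (1 : ℝ)) x

theorem k_ind_int (A : Set ℝ) (hA : MeasurableSet A) :
    Integrable (A.indicator (fun _ => (1 : ℝ))) kmu :=
  (integrable_const (1 : ℝ)).indicator hA

theorem k_ind_eq (A : Set ℝ) (hA : MeasurableSet A) :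
    ∫ x, A.indicator (fun _ => (1 : ℝ)) x ∂kmu = kmu.real A := by
  rw [integral_indicator_const _ hA]; simp

theorem kT_meas (M N : ℕ) : Measurable (kT M N) :=
  Finset.measurable_sum _ fun q _ => measurable_const.indicator (kF_meas M q)

theorem kT_int (M N : ℕ) : Integrable (kT M N) kmu :=
  integrable_finsetSum _ fun q _ => k_ind_int _ (kF_meas M q)

theorem kT_sq (M N : ℕ) (x : ℝ) : kT M N x ^ 2 = ∑ q ∈ Finset.Icc 1 N, ∑ r ∈ Finset.Icc 1 N,
    (kF M q ∩ kF M r).indicator (fun _ => (1 : ℝ)) x := by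
  rw [kT, sq, Finset.sum_mul_sum]
  apply Finset.sum_congr rfl; intro q _
  apply Finset.sum_congr rfl; intro r _
  by_cases h1 : x ∈ kF M q <;> by_cases h2 : x ∈ kF M r <;> simp [h1, h2]

theorem kT_sq_int (M N : ℕ) : Integrable (fun x => kT M N x ^ 2) kmu := by
  simp_rw [kT_sq]
  exact integrable_finsetSum _ fun q _ => integrable_finsetSum _ fun r _ =>
    k_ind_int _ ((kF_meas M q).inter (kF_meas M r))

theorem k_first (M N : ℕ) (hM : 1 ≤ M) :
    2 * kH N - 1 - 2 * kH N / M ≤ ∫ x, kT M N x ∂kmu := by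
  have h1 : ∫ x, kT M N x ∂kmu = ∑ q ∈ Finset.Icc 1 N, kmu.real (kF M q) := by
    simp only [kT]
    rw [integral_finsetSum _ fun q _ => k_ind_int _ (kF_meas M q)]
    exact Finset.sum_congr rfl fun q _ => k_ind_eq _ (kF_meas M q)
  have h2 : ∀ q, kmu.real (kF M q) = kmu.real (kE q) - kmu.real (kE q \ kF M q) := by
    intro q
    rw [measureReal_sdiff (kF_sub M q) (kF_meas M q)]
    ring
  have h3 : 2 * kH N - 1 ≤ ∑ q ∈ Finset.Icc 1 N, kmu.real (kE q) := by
    have h4 : ∀ q ∈ Finset.Icc 1 N, 2 * (1 / (q : ℝ)) - (if q = 1 then 1 else 0) ≤ kmu.real (kE q) := by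
      intro q hq
      rw [Finset.mem_Icc] at hq
      by_cases h : q = 1
      · subst h
        have : kE 1 = Set.univ := by
          ext x
          simp only [kE, Set.mem_univ, iff_true]
          refine ⟨⌊x⌋, ?_⟩
          have h1 := Int.floor_le x
          have h2 := Int.lt_floor_add_one x
          rw [Nat.cast_one, div_one, one_pow, div_one, abs_le]
          constructor <;> linarith
        rw [this]
        norm_num
      · have := kE_lower q (by omega)
        rw [if_neg h, sub_zero, mul_one_div]
        exact this
    refine le_trans ?_ (Finset.sum_le_sum h4)
    rw [Finset.sum_sub_distrib, ← Finset.mul_sum, ← kH, Finset.sum_ite_eq' (Finset.Icc 1 N)]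
    split_ifs <;> linarith
  rw [h1]
  simp_rw [h2]
  rw [Finset.sum_sub_distrib]
  linarith [k_tail M N hM]

theorem k_second (M N : ℕ) :
    ∫ x, kT M N x ^ 2 ∂kmu ≤ 4 * kH N ^ 2 + 2 * kH N + 4 * kH M * kH N := by
  have h1 : ∫ x, kT M N x ^ 2 ∂kmu = ∑ q ∈ Finset.Icc 1 N, ∑ r ∈ Finset.Icc 1 N,
      kmu.real (kF M q ∩ kF M r) := by
    simp only [kT_sq]
    rw [integral_finsetSum _ fun q _ => integrable_finsetSum _ fun r _ =>
      k_ind_int _ ((kF_meas M q).inter (kF_meas M r))]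
    apply Finset.sum_congr rfl; intro q _
    rw [integral_finsetSum _ fun r _ => k_ind_int _ ((kF_meas M q).inter (kF_meas M r))]
    exact Finset.sum_congr rfl fun r _ => k_ind_eq _ ((kF_meas M q).inter (kF_meas M r))
  rw [h1, k_symm_sum _ (fun q r => by rw [Set.inter_comm])]
  have h2 : ∑ r ∈ Finset.Icc 1 N, kmu.real (kF M r ∩ kF M r) ≤ 2 * kH N := by
    rw [kH, Finset.mul_sum]
    apply Finset.sum_le_sum
    intro r hr
    rw [Set.inter_self, mul_one_div]
    exact (measureReal_mono (kF_sub M r)).trans (kE_upper r (Finset.mem_Icc.1 hr).1)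
  have h3 := k_symm_sum (fun q r => 4 / ((q : ℝ) * r)) (fun q r => by simp only [mul_comm]) N
  have h4 : ∑ q ∈ Finset.Icc 1 N, ∑ r ∈ Finset.Icc 1 N, 4 / ((q : ℝ) * r) = 4 * kH N ^ 2 := by
    rw [kH, sq, Finset.sum_mul_sum, Finset.mul_sum]
    apply Finset.sum_congr rfl; intro q _
    rw [Finset.mul_sum]
    apply Finset.sum_congr rfl; intro r _
    rw [div_mul_div_comm]; ring
  have h5 : 0 ≤ ∑ r ∈ Finset.Icc 1 N, 4 / ((r : ℝ) * r) :=
    Finset.sum_nonneg fun _ _ => by positivity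
  have h6 : ∑ r ∈ Finset.Icc 1 N, ∑ q ∈ Finset.Ico 1 r, kmu.real (kF M q ∩ kF M r) ≤
      ∑ r ∈ Finset.Icc 1 N, ∑ q ∈ Finset.Ico 1 r, (4 / ((q : ℝ) * r) +
      ((Finset.range r).filter (fun b : ℕ => Int.gcd (b : ℤ) r ≤ M ∧ (r : ℤ) ∣ b * q)).card *
        (2 * (1 / (r : ℝ) ^ 2))) := by
    apply Finset.sum_le_sum; intro r _
    apply Finset.sum_le_sum; intro q hq
    rw [Finset.mem_Ico] at hq
    exact k_pair M q r hq.1 hq.2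
  simp_rw [Finset.sum_add_distrib] at h6
  have h7 := k_diag M N
  rw [h4] at h3
  linarith

theorem k_var (M N : ℕ) (hM : 1 ≤ M) :
    ∫ x, (kT M N x - 2 * kH N) ^ 2 ∂kmu ≤ 6 * kH N + 4 * kH M * kH N + 8 * kH N ^ 2 / M := by
  have e : ∀ x, (kT M N x - 2 * kH N) ^ 2 = kT M N x ^ 2 - (4 * kH N) * kT M N x + 4 * kH N ^ 2 := by
    intro x; ring
  simp_rw [e]
  have hi : Integrable (fun x => kT M N x ^ 2 - (4 * kH N) * kT M N x) kmu :=
    (kT_sq_int M N).sub ((kT_int M N).const_mul _)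
  rw [integral_add hi (integrable_const _),
    integral_sub (kT_sq_int M N) ((kT_int M N).const_mul _), integral_const_mul, integral_const]
  simp only [probReal_univ, smul_eq_mul, one_mul]
  have h1 := k_second M N
  have h2 := mul_le_mul_of_nonneg_left (k_first M N hM)
    (by linarith [kH_nonneg N] : 0 ≤ 4 * kH N)
  have e2 : 4 * kH N * (2 * kH N - 1 - 2 * kH N / M) = 8 * kH N ^ 2 - 4 * kH N - 8 * kH N ^ 2 / M := by
    ring
  linarith

def kB (M N : ℕ) : Set ℝ :=
  {x | ∃ q ∈ Finset.Icc 1 N, ∃ a : ℤ, |x - a / q| ≤ 1 / ((M : ℝ) * q) ^ 2}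

theorem kB_le (M N : ℕ) (hM : 1 ≤ M) : kmu.real (kB M N) ≤ 2 * kH N / M ^ 2 := by
  have h : kB M N = ⋃ q ∈ Finset.Icc 1 N, {x : ℝ | ∃ a : ℤ, True ∧ |x - a / q| ≤ 1 / ((M : ℝ) * q) ^ 2} := by
    ext x; simp [kB]
  rw [h]
  refine (measureReal_biUnion_finset_le _ _).trans ?_
  rw [kH, Finset.mul_sum, Finset.sum_div]
  apply Finset.sum_le_sum
  intro q hq
  rw [Finset.mem_Icc] at hq
  refine (k_ball q hq.1 (1 / ((M : ℝ) * q) ^ 2) (by positivity) (fun _ => True) (fun _ _ h => h)).trans ?_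
  simp only [Finset.filter_true, Finset.card_range]
  have : (0 : ℝ) < q := by exact_mod_cast hq.1
  have : (0 : ℝ) < M := by exact_mod_cast hM
  apply le_of_eq
  field_simp

theorem kB_eq (M N : ℕ) (hM : 1 ≤ M) (x : ℝ) (hx : x ∉ kB M N) : kS N x = kT M N x := by
  apply Finset.sum_congr rfl
  intro q hq
  have hq' := Finset.mem_Icc.1 hq
  have : x ∈ kE q ↔ x ∈ kF M q := by
    refine ⟨?_, fun h => kF_sub M q h⟩
    rintro ⟨a, ha⟩
    refine ⟨a, ?_, ha⟩
    by_contra hc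
    push Not at hc
    apply hx
    obtain ⟨m, hm⟩ : ∃ m, m = Int.gcd a q := ⟨_, rfl⟩
    rw [← hm] at hc
    obtain ⟨q0, hq0⟩ : m ∣ q := by
      have := Int.gcd_dvd_right a q
      rw [← hm] at this
      exact_mod_cast this
    obtain ⟨a0, ha0⟩ : (m : ℤ) ∣ a := hm ▸ Int.gcd_dvd_left a q
    have hq0pos : 0 < q0 := by
      rcases Nat.eq_zero_or_pos q0 with h | h
      · rw [h] at hq0; omega
      · exact h
    refine ⟨q0, ?_, a0, ?_⟩
    · rw [Finset.mem_Icc]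
      refine ⟨hq0pos, le_trans ?_ hq'.2⟩
      rw [hq0]
      exact Nat.le_mul_of_pos_left _ (by omega)
    · have e1 : (a : ℝ) = m * a0 := by exact_mod_cast ha0
      have e2 : (q : ℝ) = m * q0 := by exact_mod_cast hq0
      have hm0 : (0 : ℝ) < m := by
        have : 0 < m := by omega
        exact_mod_cast this
      have hM0 : (0 : ℝ) < M := by exact_mod_cast hM
      have hq00 : (0 : ℝ) < q0 := by exact_mod_cast hq0pos
      rw [e1, e2, mul_div_mul_left _ _ hm0.ne'] at ha
      refine ha.trans ?_
      apply one_div_le_one_div_of_le (by positivity)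
      have : (M : ℝ) ≤ m := by exact_mod_cast hc.le
      gcongr
  by_cases h : x ∈ kF M q
  · simp [h, this.2 h]
  · simp [h, mt this.1 h]

theorem kH_bounds (j : ℕ) : j * Real.log 2 ≤ kH (2 ^ j) ∧ kH (2 ^ j) ≤ 1 + j * Real.log 2 := by
  have e : kH (2 ^ j) = (harmonic (2 ^ j) : ℝ) := by
    rw [harmonic_eq_sum_Icc, kH]; push_cast; simp
  have h1 := log_add_one_le_harmonic (2 ^ j)
  have h2 := harmonic_le_one_add_log (2 ^ j)
  rw [e]
  have e2 : Real.log ((2 ^ j : ℕ) : ℝ) = j * Real.log 2 := by push_cast; rw [Real.log_pow]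
  rw [e2] at h2
  refine ⟨?_, h2⟩
  refine le_trans ?_ h1
  rw [← e2]
  apply Real.log_le_log (by positivity)
  push_cast; linarith

theorem kH_log (M : ℕ) : kH M ≤ 1 + Real.log M := by
  have e : kH M = (harmonic M : ℝ) := by
    rw [harmonic_eq_sum_Icc, kH]; push_cast; simp
  rw [e]; exact harmonic_le_one_add_log M

theorem k_ratio (k : ℕ) :
    ∫ x, ((kT ((k + 1) ^ 4) (2 ^ ((k + 1) ^ 4)) x - 2 * kH (2 ^ ((k + 1) ^ 4))) /
      kH (2 ^ ((k + 1) ^ 4))) ^ 2 ∂kmu ≤ 60 * (1 / ((k + 1 : ℕ) : ℝ) ^ 3) := by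
  have hM : 1 ≤ (k + 1) ^ 4 := Nat.one_le_pow _ _ (by omega)
  have hv := k_var ((k + 1) ^ 4) (2 ^ ((k + 1) ^ 4)) hM
  have h1 := (kH_bounds ((k + 1) ^ 4)).1
  have h2 := kH_log ((k + 1) ^ 4)
  simp_rw [div_pow, integral_div]
  set H := kH (2 ^ ((k + 1) ^ 4))
  push_cast at h1 h2 hv ⊢
  set y : ℝ := (k : ℝ) + 1
  have hy : 1 ≤ y := by simp [y]
  have h3 : Real.log (y ^ 4) ≤ 4 * y := by
    rw [Real.log_pow]
    have := Real.log_le_sub_one_of_pos (by linarith : 0 < y)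
    push_cast
    linarith
  have hl : (0.69 : ℝ) < Real.log 2 := by linarith [Real.log_two_gt_d9]
  have hH : y ^ 4 * 0.5 ≤ H := by
    refine le_trans ?_ h1
    gcongr
    linarith
  have hy4 : 0 < y ^ 4 := by positivity
  have hH0 : 0 < H := by linarith
  rw [div_le_iff₀ (by positivity)]
  refine hv.trans ?_
  have a1 : 6 * H + 4 * kH ((k + 1) ^ 4) * H ≤ 26 * y * H := by
    have : kH ((k + 1) ^ 4) ≤ 5 * y := by linarith
    nlinarith
  have a2 : H ≤ 2 * H ^ 2 / y ^ 4 := by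
    rw [le_div_iff₀ hy4]; nlinarith
  have a3 : 26 * y * H ≤ 52 * (1 / y ^ 3) * H ^ 2 := by
    have := mul_le_mul_of_nonneg_left a2 (by linarith : 0 ≤ 26 * y)
    refine this.trans (le_of_eq ?_)
    field_simp
    norm_num
  have a4 : 8 * H ^ 2 / y ^ 4 ≤ 8 * (1 / y ^ 3) * H ^ 2 := by
    rw [div_eq_mul_one_div]
    have : 1 / y ^ 4 ≤ 1 / y ^ 3 := by
      apply one_div_le_one_div_of_le (by positivity)
      exact pow_le_pow_right₀ hy (by norm_num)
    nlinarith [sq_nonneg H]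
  nlinarith

theorem k_ae_sub : ∀ᵐ x ∂kmu, Tendsto (fun k : ℕ => kS (2 ^ ((k + 1) ^ 4)) x /
    (((k + 1) ^ 4 : ℕ) : ℝ)) atTop (nhds (2 * Real.log 2)) := by
  let g : ℕ → ℝ → ℝ := fun k x => ((kT ((k + 1) ^ 4) (2 ^ ((k + 1) ^ 4)) x -
    2 * kH (2 ^ ((k + 1) ^ 4))) / kH (2 ^ ((k + 1) ^ 4))) ^ 2
  have hgm : ∀ k, Measurable (g k) := fun k =>
    (((kT_meas _ _).sub_const _).div_const _).pow_const 2
  have hgi : ∀ k, Integrable (g k) kmu := by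
    intro k
    have e : ∀ x, g k x = (kT ((k + 1) ^ 4) (2 ^ ((k + 1) ^ 4)) x ^ 2 -
      (4 * kH (2 ^ ((k + 1) ^ 4))) * kT ((k + 1) ^ 4) (2 ^ ((k + 1) ^ 4)) x +
        4 * kH (2 ^ ((k + 1) ^ 4)) ^ 2) / kH (2 ^ ((k + 1) ^ 4)) ^ 2 := by
      intro x; simp only [g]; rw [div_pow]; congr 1; ring
    have : g k = _ := funext e
    rw [this]
    exact ((((kT_sq_int _ _).sub ((kT_int _ _).const_mul _))).add (integrable_const _)).div_const _
  have hs3 : Summable (fun k : ℕ => 60 * (1 / ((k + 1 : ℕ) : ℝ) ^ 3)) := by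
    apply Summable.mul_left
    exact (summable_nat_add_iff 1 (f := fun n : ℕ => 1 / (n : ℝ) ^ 3)).2
      (Real.summable_one_div_nat_pow.2 (by norm_num))
  have hfin : ∫⁻ x, ∑' k, ENNReal.ofReal (g k x) ∂kmu ≠ ⊤ := by
    rw [lintegral_tsum fun k => (hgm k).ennreal_ofReal.aemeasurable]
    have hle : ∑' k, ∫⁻ x, ENNReal.ofReal (g k x) ∂kmu ≤
        ∑' k : ℕ, ENNReal.ofReal (60 * (1 / ((k + 1 : ℕ) : ℝ) ^ 3)) := by
      apply ENNReal.tsum_le_tsum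
      intro k
      rw [← ofReal_integral_eq_lintegral_ofReal (hgi k) (ae_of_all _ fun x => sq_nonneg _)]
      exact ENNReal.ofReal_le_ofReal (k_ratio k)
    exact ne_top_of_le_ne_top hs3.tsum_ofReal_ne_top hle
  have hae1 : ∀ᵐ x ∂kmu, ∑' k, ENNReal.ofReal (g k x) < ⊤ :=
    ae_lt_top (Measurable.tsum fun k => (hgm k).ennreal_ofReal) hfin
  have hae2 : ∀ᵐ x ∂kmu, ∀ᶠ k : ℕ in atTop, x ∉ kB ((k + 1) ^ 4) (2 ^ ((k + 1) ^ 4)) := by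
    apply ae_eventually_notMem
    have hle : ∀ k : ℕ, kmu (kB ((k + 1) ^ 4) (2 ^ ((k + 1) ^ 4))) ≤
        ENNReal.ofReal (60 * (1 / ((k + 1 : ℕ) : ℝ) ^ 3)) := by
      intro k
      have hM : 1 ≤ (k + 1) ^ 4 := Nat.one_le_pow _ _ (by omega)
      have h1 := kB_le ((k + 1) ^ 4) (2 ^ ((k + 1) ^ 4)) hM
      have h2 := (kH_bounds ((k + 1) ^ 4)).2
      rw [← ENNReal.ofReal_toReal (measure_ne_top kmu (kB ((k + 1) ^ 4) (2 ^ ((k + 1) ^ 4))))]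
      apply ENNReal.ofReal_le_ofReal
      refine le_trans h1 ?_
      push_cast at h2 ⊢
      set y : ℝ := (k : ℝ) + 1
      have hy : 1 ≤ y := by simp [y]
      have hy4 : 1 ≤ y ^ 4 := one_le_pow₀ hy
      have hl : Real.log 2 < 1 := by linarith [Real.log_two_lt_d9]
      have h3 : kH (2 ^ ((k + 1) ^ 4)) ≤ 2 * y ^ 4 := by nlinarith
      rw [div_le_iff₀ (by positivity)]
      have e : 60 * (1 / y ^ 3) * (y ^ 4) ^ 2 = 60 * y * y ^ 4 := by field_simp
      rw [e]
      nlinarith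
    exact ne_top_of_le_ne_top hs3.tsum_ofReal_ne_top (ENNReal.tsum_le_tsum hle)
  filter_upwards [hae1, hae2] with x hx1 hx2
  have t1 := ENNReal.tendsto_atTop_zero_of_tsum_ne_top hx1.ne
  have t2 : Tendsto (fun k => g k x) atTop (nhds 0) := by
    have := (ENNReal.tendsto_toReal ENNReal.zero_ne_top).comp t1
    simp only [ENNReal.toReal_zero] at this
    refine this.congr fun k => ?_
    simp only [Function.comp]
    exact ENNReal.toReal_ofReal (sq_nonneg _)
  have t3 : Tendsto (fun k : ℕ => (kT ((k + 1) ^ 4) (2 ^ ((k + 1) ^ 4)) x -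
    2 * kH (2 ^ ((k + 1) ^ 4))) / kH (2 ^ ((k + 1) ^ 4))) atTop (nhds 0) := by
    rw [tendsto_zero_iff_abs_tendsto_zero]
    have := t2.sqrt
    rw [Real.sqrt_zero] at this
    refine this.congr fun k => ?_
    exact Real.sqrt_sq_eq_abs _
  have hj : Tendsto (fun k : ℕ => (k + 1) ^ 4) atTop atTop :=
    (tendsto_pow_atTop (by norm_num)).comp (tendsto_add_atTop_nat 1)
  have t4 : Tendsto (fun j : ℕ => kH (2 ^ j) / j) atTop (nhds (Real.log 2)) := by
    have u1 : Tendsto (fun j : ℕ => 1 / (j : ℝ) + Real.log 2) atTop (nhds (Real.log 2)) := by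
      simpa using tendsto_one_div_atTop_nhds_zero_nat.add_const (Real.log 2)
    refine tendsto_of_tendsto_of_tendsto_of_le_of_le' tendsto_const_nhds u1 ?_ ?_
    · filter_upwards [eventually_gt_atTop 0] with j hj
      have : (0 : ℝ) < j := by exact_mod_cast hj
      rw [le_div_iff₀ this]
      linarith [(kH_bounds j).1]
    · filter_upwards [eventually_gt_atTop 0] with j hj
      have : (0 : ℝ) < j := by exact_mod_cast hj
      rw [div_le_iff₀ this]
      have e : (1 / (j : ℝ) + Real.log 2) * j = 1 + j * Real.log 2 := by field_simp
      rw [e]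
      exact (kH_bounds j).2
  have t5 := (t3.add_const 2).mul (t4.comp hj)
  rw [zero_add] at t5
  refine t5.congr' ?_
  filter_upwards [hx2] with k hk
  have hM : 1 ≤ (k + 1) ^ 4 := Nat.one_le_pow _ _ (by omega)
  rw [kB_eq _ _ hM x hk]
  have hH : 0 < kH (2 ^ ((k + 1) ^ 4)) := by
    refine lt_of_lt_of_le ?_ (kH_bounds ((k + 1) ^ 4)).1
    have := Real.log_pos (by norm_num : (1 : ℝ) < 2)
    positivity
  simp only [Function.comp]
  field_simp
  ring

theorem kS_mono (x : ℝ) : Monotone (fun N => kS N x) := by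
  intro a b hab
  apply Finset.sum_le_sum_of_subset_of_nonneg (Finset.Icc_subset_Icc_right hab)
  intro q _ _
  exact Set.indicator_nonneg (fun _ _ => zero_le_one) x

theorem k_ae : ∀ᵐ x ∂kmu, Tendsto (fun j : ℕ => kS (2 ^ j) x / j) atTop (nhds (2 * Real.log 2)) := by
  filter_upwards [k_ae_sub] with x hx
  apply tendsto_div_of_monotone_of_exists_subseq_tendsto_div (fun j => kS (2 ^ j) x)
  · intro a b hab
    exact kS_mono x (Nat.pow_le_pow_right (by norm_num) hab)
  · intro a ha
    refine ⟨fun k => (k + 1) ^ 4, ?_, ?_, hx⟩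
    · have h1 : Tendsto (fun k : ℕ => (1 + 1 / ((k : ℝ) + 1)) ^ 4) atTop (nhds 1) := by
        have := (tendsto_one_div_add_atTop_nhds_zero_nat (𝕜 := ℝ)).const_add 1
        simpa using this.pow 4
      filter_upwards [h1.eventually_lt_const ha] with k hk
      have hk0 : (0 : ℝ) < (k : ℝ) + 1 := by positivity
      push_cast
      have e : (k : ℝ) + 1 + 1 = (1 + 1 / ((k : ℝ) + 1)) * (k + 1) := by field_simp
      rw [e, mul_pow]
      gcongr
    · exact (tendsto_pow_atTop (by norm_num)).comp (tendsto_add_atTop_nat 1)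

theorem kS_per (N : ℕ) (x : ℝ) (n : ℤ) : kS N (x - n) = kS N x := by
  apply Finset.sum_congr rfl
  intro q hq
  have hq0 : (0 : ℝ) < q := by exact_mod_cast (Finset.mem_Icc.1 hq).1
  have : x - n ∈ kE q ↔ x ∈ kE q := by
    constructor
    · rintro ⟨a, ha⟩
      refine ⟨a + q * n, ?_⟩
      convert ha using 2
      push_cast
      field_simp
      ring
    · rintro ⟨a, ha⟩
      refine ⟨a - q * n, ?_⟩
      convert ha using 2
      push_cast
      field_simp
      ring
  by_cases h : x ∈ kE q
  · simp [h, this.2 h]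
  · simp [h, mt this.1 h]

theorem k_ae_vol : ∀ᵐ x : ℝ, Tendsto (fun j : ℕ => kS (2 ^ j) x / j) atTop
    (nhds (2 * Real.log 2)) := by
  have h := k_ae
  rw [kmu, ae_restrict_iff' measurableSet_Ico] at h
  have h2 : ∀ n : ℤ, ∀ᵐ x : ℝ, x - n ∈ Set.Ico (0 : ℝ) 1 →
      Tendsto (fun j : ℕ => kS (2 ^ j) (x - n) / j) atTop (nhds (2 * Real.log 2)) := fun n =>
    (measurePreserving_sub_right volume (n : ℝ)).quasiMeasurePreserving.ae h
  filter_upwards [ae_all_iff.2 h2] with x hx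
  have := hx ⌊x⌋ ⟨by linarith [Int.floor_le x], by linarith [Int.lt_floor_add_one x]⟩
  simpa only [kS_per] using this

theorem k_ae_t : ∀ᵐ t : ℝ, Tendsto (fun j : ℕ => kS (2 ^ j) (t / (2 * Real.pi)) / j) atTop
    (nhds (2 * Real.log 2)) := by
  have h := k_ae_vol
  rw [ae_iff] at h ⊢
  have hpi : (2 * Real.pi)⁻¹ ≠ 0 := inv_ne_zero (by positivity)
  have := Real.volume_preimage_mul_right hpi
    {x : ℝ | ¬ Tendsto (fun j : ℕ => kS (2 ^ j) x / j) atTop (nhds (2 * Real.log 2))}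
  rw [h, mul_zero] at this
  rw [← this]
  congr 1

theorem k_det (D : Set ℕ) (h0 : 0 ∉ D) (c : ℕ → ℝ)
    (hc : ∀ N, c N = (Nat.card {q : ℕ // q ≤ N ∧ q ∈ D} : ℝ))
    (hlim : Tendsto (fun j : ℕ => c (2 ^ j) / j) atTop (nhds (2 * Real.log 2))) :
    D.Infinite ∧ Tendsto (fun k : ℕ => (Nat.nth (· ∈ D) k : ℝ) ^ ((1 : ℝ) / ((k : ℝ) + 1)))
        atTop (nhds (Real.exp (1 / 2))) := by
  classical
  have hl := Real.log_pos (by norm_num : (1 : ℝ) < 2)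
  have hcc : ∀ N, c N = (Nat.count (· ∈ D) (N + 1) : ℝ) := by
    intro N
    rw [hc, Nat.count_eq_card_filter_range]
    congr 1
    exact Nat.subtype_card _ fun q => by
      simp only [Finset.mem_filter, Finset.mem_range, Nat.lt_succ_iff]
  have hmono : Monotone c := by
    intro a b hab
    rw [hcc, hcc]
    exact_mod_cast Nat.count_monotone _ (by omega)
  have hinf : D.Infinite := by
    intro hfin
    have hb : ∀ N, c N ≤ hfin.toFinset.card := by
      intro N
      rw [hcc, Nat.count_eq_card_filter_range]
      exact_mod_cast Finset.card_le_card (fun q hq => by simpa using (Finset.mem_filter.1 hq).2)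
    have : Tendsto (fun j : ℕ => c (2 ^ j) / j) atTop (nhds 0) := by
      refine squeeze_zero (fun j => ?_) (fun j => ?_)
        (tendsto_const_div_atTop_nhds_zero_nat (hfin.toFinset.card : ℝ))
      · rw [hcc]; positivity
      · gcongr; exact hb _
    have := tendsto_nhds_unique hlim this
    linarith
  refine ⟨hinf, ?_⟩
  have hinf' : (Set.ofPred (· ∈ D)).Infinite := hinf
  let n : ℕ → ℕ := Nat.nth (· ∈ D)
  have hnmem : ∀ k, n k ∈ D := fun k => Nat.nth_mem_of_infinite hinf' k
  have hn0 : ∀ k, n k ≠ 0 := fun k h => h0 (h ▸ hnmem k)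
  have hnmono : StrictMono n := Nat.nth_strictMono hinf'
  have hcn : ∀ k, c (n k) = k + 1 := by
    intro k
    rw [hcc, Nat.count_succ, if_pos (hnmem k)]
    have : Nat.count (· ∈ D) (n k) = k := Nat.count_nth_of_infinite hinf' k
    rw [this]; push_cast; rfl
  let J : ℕ → ℕ := fun k => Nat.log 2 (n k)
  have hJ : Tendsto J atTop atTop := by
    apply tendsto_atTop_atTop.2
    intro b
    refine ⟨2 ^ b, fun k hk => ?_⟩
    apply Nat.le_log_of_pow_le (by norm_num)
    exact hk.trans (hnmono.id_le k)
  have hJ1 : ∀ k, 2 ^ J k ≤ n k := fun k => Nat.pow_log_le_self 2 (hn0 k)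
  have hJ2 : ∀ k, n k < 2 ^ (J k + 1) := fun k => Nat.lt_pow_succ_log_self (by norm_num) _
  have hnpos : ∀ k, (0 : ℝ) < n k := fun k => by exact_mod_cast Nat.pos_of_ne_zero (hn0 k)
  have hA : ∀ k, J k * Real.log 2 ≤ Real.log (n k) := by
    intro k
    rw [← Real.log_pow]
    exact Real.log_le_log (by positivity) (by exact_mod_cast hJ1 k)
  have hB : ∀ k, Real.log (n k) ≤ (J k + 1) * Real.log 2 := by
    intro k
    have : ((J k : ℝ) + 1) * Real.log 2 = Real.log (2 ^ (J k + 1)) := by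
      rw [Real.log_pow]; push_cast; rfl
    rw [this]
    exact Real.log_le_log (hnpos k) (by exact_mod_cast (hJ2 k).le)
  have hC : ∀ k : ℕ, c (2 ^ J k) ≤ (k : ℝ) + 1 := fun k => by rw [← hcn]; exact hmono (hJ1 k)
  have hD : ∀ k : ℕ, (k : ℝ) + 1 ≤ c (2 ^ (J k + 1)) := fun k => by rw [← hcn]; exact hmono (hJ2 k).le
  -- basic limits in j
  have hL : 2 * Real.log 2 ≠ 0 := by positivity
  have i1 : Tendsto (fun j : ℕ => (j : ℝ) / c (2 ^ j)) atTop (nhds (2 * Real.log 2)⁻¹) := by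
    refine (hlim.inv₀ hL).congr fun j => ?_
    rw [inv_div]
  have r1 : Tendsto (fun j : ℕ => ((j : ℝ) + 1) / j) atTop (nhds 1) := by
    have := (tendsto_one_div_atTop_nhds_zero_nat (𝕜 := ℝ)).const_add 1
    rw [add_zero] at this
    refine this.congr' ?_
    filter_upwards [eventually_gt_atTop 0] with j hj
    have : (0 : ℝ) < j := by exact_mod_cast hj
    field_simp
  have up : Tendsto (fun j : ℕ => (((j : ℝ) + 1) * Real.log 2) / c (2 ^ j)) atTop (nhds (1 / 2)) := by
    have := (r1.mul i1).mul_const (Real.log 2)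
    have e : 1 * (2 * Real.log 2)⁻¹ * Real.log 2 = 1 / 2 := by field_simp
    rw [e] at this
    refine this.congr' ?_
    filter_upwards [eventually_gt_atTop 0] with j hj
    have : (0 : ℝ) < j := by exact_mod_cast hj
    field_simp
  have lo : Tendsto (fun j : ℕ => ((j : ℝ) * Real.log 2) / c (2 ^ (j + 1))) atTop (nhds (1 / 2)) := by
    have := ((r1.inv₀ one_ne_zero).mul (i1.comp (tendsto_add_atTop_nat 1))).mul_const (Real.log 2)
    have e : (1 : ℝ)⁻¹ * (2 * Real.log 2)⁻¹ * Real.log 2 = 1 / 2 := by field_simp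
    rw [e] at this
    refine this.congr' ?_
    filter_upwards [eventually_gt_atTop 0] with j hj
    have : (0 : ℝ) < j := by exact_mod_cast hj
    simp only [Function.comp]
    push_cast
    field_simp
  have hpos : ∀ᶠ j : ℕ in atTop, 0 < c (2 ^ j) := by
    have := hlim.eventually_const_lt (by positivity : (0 : ℝ) < 2 * Real.log 2)
    filter_upwards [this] with j hj
    by_contra hcon
    exact absurd hj (not_lt.2 (div_nonpos_of_nonpos_of_nonneg (not_lt.1 hcon) (by positivity)))
  have hmain : Tendsto (fun k : ℕ => Real.log (n k) / ((k : ℝ) + 1)) atTop (nhds (1 / 2)) := by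
    refine tendsto_of_tendsto_of_tendsto_of_le_of_le' (lo.comp hJ) (up.comp hJ) ?_ ?_
    · refine Eventually.of_forall fun k => ?_
      simp only [Function.comp]
      have : (0 : ℝ) < (k : ℝ) + 1 := by positivity
      apply div_le_div₀ ((by positivity : (0 : ℝ) ≤ J k * Real.log 2).trans (hA k)) (hA k) this (hD k)
    · filter_upwards [hJ.eventually hpos] with k hk
      simp only [Function.comp]
      exact div_le_div₀ (by positivity) (hB k) hk (hC k)
  have := (Real.continuous_exp.tendsto _).comp hmain
  refine this.congr fun k => ?_
  simp only [Function.comp]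
  rw [Real.rpow_def_of_pos (hnpos k), mul_one_div]

theorem kS_card (t : ℝ) (N : ℕ) : kS N (t / (2 * Real.pi)) =
    (Nat.card {q : ℕ // q ≤ N ∧ q ∈ dirichletSet t} : ℝ) := by
  classical
  have h : ∀ q, q ∈ (Finset.Icc 1 N).filter (fun q => t / (2 * Real.pi) ∈ kE q) ↔
      q ≤ N ∧ q ∈ dirichletSet t := by
    intro q
    simp only [Finset.mem_filter, Finset.mem_Icc]
    constructor
    · rintro ⟨⟨h1, h2⟩, h3⟩; exact ⟨h2, h1, h3⟩
    · rintro ⟨h2, h1, h3⟩; exact ⟨⟨h1, h2⟩, h3⟩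
  have e : Nat.card {q : ℕ // q ≤ N ∧ q ∈ dirichletSet t} =
      ((Finset.Icc 1 N).filter (fun q => t / (2 * Real.pi) ∈ kE q)).card :=
    Nat.subtype_card _ h
  rw [e, Finset.card_filter]
  push_cast
  rfl

/-- Khinchin–Lévy: there is an absolute constant `γ > 1` such that for almost every `t`,
the set `Q(t)` of Dirichlet denominators is infinite, and its increasing enumeration
`q₁(t) < q₂(t) < ⋯` satisfies `q_k(t)^{1/k} → γ`.  (Here `Nat.nth (· ∈ dirichletSet t) k`
is the `(k+1)`-st element of the set, i.e. `q_{k+1}(t)`.) -/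
theorem khinchin_levy :
    ∃ γ : ℝ, 1 < γ ∧ ∀ᵐ t : ℝ, (dirichletSet t).Infinite ∧
      Tendsto (fun k : ℕ => (Nat.nth (· ∈ dirichletSet t) k : ℝ) ^ ((1 : ℝ) / ((k : ℝ) + 1)))
        atTop (nhds γ) := by
  refine ⟨Real.exp (1 / 2), Real.one_lt_exp_iff.2 (by norm_num), ?_⟩
  filter_upwards [k_ae_t] with t ht
  refine k_det (dirichletSet t) (fun h => absurd h.1 (by norm_num))
    (fun N => kS N (t / (2 * Real.pi))) (kS_card t) ht
end

section
/- For almost every t ∈ ℝ the following holds: for every ε > 0 there is a constant C = C(t,ε) such that for every integer N ≥ 1, sup_{x∈ℝ} |Σ_{n=1}^{N} e^{-itn² + inx}| ≤ C N^{1/2 + ε}. -/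
open Filter MeasureTheory Finset

theorem normsq_le (a : ℕ → ℂ) (N : ℕ) :
    ‖∑ n ∈ range N, a n‖^2 ≤ 2 * (∑ m ∈ range N, ∑ k ∈ range (m+1), a m * star (a k)).re := by
  induction N with
  | zero => simp
  | succ N ih =>
    rw [sum_range_succ, sum_range_succ (fun m => ∑ k ∈ range (m+1), a m * star (a k))]
    rw [Complex.add_re, ← mul_sum, ← star_sum]
    rw [sum_range_succ (f := a)]
    set S := ∑ n ∈ range N, a n
    rw [← Complex.normSq_eq_norm_sq] at *
    simp [Complex.normSq_apply] at *
    nlinarith [mul_self_nonneg (a N).re, mul_self_nonneg (a N).im]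

theorem normsq_le' (a : ℕ → ℂ) (N : ℕ) :
    ‖∑ n ∈ range N, a n‖^2 ≤ 2 * ∑ d ∈ range N, ‖∑ n ∈ range (N - d), a (n + d) * star (a n)‖ := by
  refine (normsq_le a N).trans ?_
  have h := Finset.sum_range_diag_flip N (fun d n => a (n + d) * star (a n))
  have h2 : ∑ m ∈ range N, ∑ k ∈ range (m+1), a m * star (a k)
      = ∑ m ∈ range N, ∑ k ∈ range (m+1), a (m - k + k) * star (a (m - k)) := by
    refine sum_congr rfl fun m _ => ?_
    rw [← Finset.sum_flip]
    refine sum_congr rfl fun k hk => ?_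
    rw [Nat.sub_add_cancel (by simp at hk; omega)]
  rw [h2, h]
  gcongr
  exact (Complex.re_le_norm _).trans (norm_sum_le _ _)

theorem geom_bd (θ : ℝ) (M : ℕ) (h : Real.sin θ ≠ 0) :
    ‖∑ n ∈ range M, (Complex.exp (Complex.I * ((-2 * θ : ℝ) : ℂ))) ^ n‖ ≤ |Real.sin θ|⁻¹ := by
  set w := Complex.exp (Complex.I * ((-2 * θ : ℝ) : ℂ)) with hw
  have h1 : ‖w - 1‖ = 2 * |Real.sin θ| := by
    rw [hw, Complex.norm_exp_I_mul_ofReal_sub_one]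
    rw [show -2 * θ / 2 = -θ by ring, Real.sin_neg]; simp
  have hs : 0 < |Real.sin θ| := abs_pos.2 h
  have hw1 : ‖w‖ = 1 := by rw [hw, mul_comm]; exact Complex.norm_exp_ofReal_mul_I _
  have hne : w ≠ 1 := by
    intro h0; rw [h0] at h1; simp at h1; exact h h1
  rw [geom_sum_eq hne, norm_div, h1]
  have : ‖w ^ M - 1‖ ≤ 2 := by
    refine (norm_sub_le _ _).trans ?_
    rw [norm_pow, hw1]; norm_num
  rw [div_le_iff₀ (by positivity)]
  field_simp
  linarith

theorem interp {G N s δ : ℝ} (hG : 0 ≤ G) (h1 : G ≤ N) (h2 : G ≤ s⁻¹) (hδ : 0 < δ) (hδ1 : δ < 1) (hs : 0 < s) :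
    G ≤ N ^ δ * s ^ (-(1-δ)) := by
  have hN : 0 ≤ N := hG.trans h1
  calc G = G ^ (δ + (1 - δ)) := by simp
    _ = G ^ δ * G ^ (1-δ) := Real.rpow_add_of_nonneg hG hδ.le (by linarith)
    _ ≤ N ^ δ * (s⁻¹) ^ (1-δ) := by gcongr
    _ = _ := by rw [Real.inv_rpow hs.le, Real.rpow_neg hs.le]

theorem corr_bd (t x : ℝ) (N d : ℕ) (δ : ℝ) (hδ : 0 < δ) (hδ1 : δ < 1) (h : Real.sin (d * t) ≠ 0)
    (a : ℕ → ℂ) (ha : ∀ n : ℕ, a n = Complex.exp (Complex.I * (((n + 1 : ℕ) : ℂ) * (x : ℂ) - (t : ℂ) * ((n + 1 : ℕ) : ℂ) ^ 2))) :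
    ‖∑ n ∈ range (N - d), a (n + d) * star (a n)‖ ≤ (N:ℝ) ^ δ * |Real.sin (d * t)| ^ (-(1-δ)) := by
  have key : ∀ n, a (n + d) * star (a n) =
      Complex.exp (((d * x - t * (2 * d + d ^ 2) : ℝ) : ℂ) * Complex.I) * (Complex.exp (Complex.I * ((-2 * (d * t) : ℝ) : ℂ))) ^ n := by
    intro n
    rw [ha, ha, ← starRingEnd_apply, ← Complex.exp_conj, ← Complex.exp_nat_mul, ← Complex.exp_add, ← Complex.exp_add]
    congr 1
    simp
    ring
  simp_rw [key]
  rw [← mul_sum, norm_mul, Complex.norm_exp_ofReal_mul_I, one_mul]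
  refine interp (norm_nonneg _) ?_ (geom_bd _ _ h) hδ hδ1 (abs_pos.2 h)
  refine (norm_sum_le _ _).trans ?_
  have : ∀ n, ‖(Complex.exp (Complex.I * ((-2 * (d * t) : ℝ) : ℂ))) ^ n‖ = 1 := by
    intro n
    rw [norm_pow, mul_comm, Complex.norm_exp_ofReal_mul_I, one_pow]
  simp_rw [this]
  simp

noncomputable def sphi (δ s : ℝ) : ENNReal := ENNReal.ofReal |Real.sin s| ^ (-(1-δ))

theorem sphi_meas (δ : ℝ) : Measurable (sphi δ) := by
  unfold sphi
  have : Measurable fun s : ℝ => ENNReal.ofReal |Real.sin s| :=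
    ENNReal.measurable_ofReal.comp (Real.continuous_sin.abs.measurable)
  exact this.pow_const _

theorem sphi_add (δ s : ℝ) : sphi δ (s + Real.pi) = sphi δ s := by
  simp [sphi, Real.sin_add_pi]

theorem sphi_add_int (δ s : ℝ) (m : ℤ) : sphi δ (s + m * Real.pi) = sphi δ s := by
  simp [sphi, Real.sin_add_int_mul_pi, abs_mul]

theorem sphi_fin (δ : ℝ) (hδ : 0 < δ) (hδ1 : δ < 1) :
    ∫⁻ s in Set.Ioc 0 Real.pi, sphi δ s < ⊤ := by
  have hpi := Real.pi_pos
  have i0 : IntervalIntegrable (fun x : ℝ => x ^ (-(1-δ))) volume 0 Real.pi :=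
    intervalIntegral.intervalIntegrable_rpow' (by linarith)
  have i1 : IntervalIntegrable (fun x : ℝ => (Real.pi - x) ^ (-(1-δ))) volume 0 Real.pi := by
    have := (i0.comp_sub_left Real.pi).symm
    simpa using this
  have i2 := ((i0.add i1).const_mul ((2/Real.pi) ^ (-(1-δ))))
  rw [intervalIntegrable_iff_integrableOn_Ioc_of_le hpi.le] at i2
  have hf := i2.lintegral_lt_top
  refine lt_of_le_of_lt ?_ hf
  rw [← restrict_Ioo_eq_restrict_Ioc]
  refine setLIntegral_mono' measurableSet_Ioo fun s hs => ?_
  have hsin : 0 < Real.sin s := Real.sin_pos_of_pos_of_lt_pi hs.1 hs.2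
  rw [sphi, abs_of_pos hsin, ENNReal.ofReal_rpow_of_pos hsin]
  apply ENNReal.ofReal_le_ofReal
  have hs1 := hs.1
  have hs2 : 0 < Real.pi - s := by linarith [hs.2]
  have aux : ∀ u : ℝ, 0 < u → u ≤ Real.pi / 2 → 
      Real.sin u ^ (-(1-δ)) ≤ (2/Real.pi) ^ (-(1-δ)) * u ^ (-(1-δ)) := by
    intro u hu hu2
    rw [← Real.mul_rpow (by positivity) hu.le]
    exact Real.rpow_le_rpow_of_nonpos (by positivity) (Real.mul_le_sin hu.le hu2) (by linarith)
  have p0 : 0 ≤ (2/Real.pi) ^ (-(1-δ)) * s ^ (-(1-δ)) := by positivity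
  have p1 : 0 ≤ (2/Real.pi) ^ (-(1-δ)) * (Real.pi - s) ^ (-(1-δ)) := by positivity
  rw [mul_add]
  rcases le_total s (Real.pi / 2) with h | h
  · linarith [aux s hs1 h]
  · have := aux (Real.pi - s) hs2 (by linarith)
    rw [Real.sin_pi_sub] at this
    linarith

theorem sphi_block (δ : ℝ) (m : ℤ) (n : ℕ) :
    ∫⁻ s in Set.Ioc (m * Real.pi) ((m + n) * Real.pi), sphi δ s
      = n * ∫⁻ s in Set.Ioc 0 Real.pi, sphi δ s := by
  have hpi := Real.pi_pos
  induction n with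
  | zero => simp
  | succ n ih =>
    have hu : Set.Ioc (m * Real.pi) ((m + (n + 1 : ℕ)) * Real.pi) =
        Set.Ioc (m * Real.pi) ((m + n) * Real.pi) ∪ Set.Ioc ((m + n) * Real.pi) ((m + (n + 1 : ℕ)) * Real.pi) := by
      rw [Set.Ioc_union_Ioc_eq_Ioc]
      · gcongr; simp
      · gcongr; simp
    rw [hu, lintegral_union measurableSet_Ioc (Set.Ioc_disjoint_Ioc_of_le le_rfl), ih]
    have h2 := (measurePreserving_add_right (volume : Measure ℝ) (((m + n : ℤ) : ℝ) * Real.pi)).setLIntegral_comp_preimage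
      (s := Set.Ioc ((m + n) * Real.pi) ((m + (n + 1 : ℕ)) * Real.pi)) measurableSet_Ioc (sphi_meas δ)
    rw [← h2]
    simp_rw [sphi_add_int]
    rw [Set.preimage_add_const_Ioc]
    push_cast
    rw [show ((m:ℝ) + n) * Real.pi - (m + n) * Real.pi = 0 by ring,
      show ((m:ℝ) + (n + 1)) * Real.pi - (m + n) * Real.pi = Real.pi by ring]
    ring

theorem sphi_scale (δ : ℝ) (K h : ℕ) (hh : h ≠ 0) :
    ∫⁻ t in Set.Ioc (-K * Real.pi) (K * Real.pi), sphi δ (h * t)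
      = (2 * K : ℕ) * ∫⁻ s in Set.Ioc 0 Real.pi, sphi δ s := by
  have hpi := Real.pi_pos
  have hpos : (0:ℝ) < h := by positivity
  have b := sphi_block δ (-(K * h : ℕ)) (2 * K * h)
  rw [← Real.smul_map_volume_mul_left hpos.ne', setLIntegral_smul_measure,
    setLIntegral_map measurableSet_Ioc (sphi_meas δ) (by fun_prop)] at b
  have hp : (fun x : ℝ => (h:ℝ) * x) ⁻¹' Set.Ioc (((-(K * h : ℕ) : ℤ) : ℝ) * Real.pi) ((((-(K * h : ℕ) : ℤ) : ℝ) + (2 * K * h : ℕ)) * Real.pi)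
      = Set.Ioc (-K * Real.pi) (K * Real.pi) := by
    ext x
    simp only [Set.mem_preimage, Set.mem_Ioc]
    push_cast
    rw [show -((K:ℝ) * h) * Real.pi = h * (-K * Real.pi) by ring,
      show (-((K:ℝ) * h) + 2 * K * h) * Real.pi = h * (K * Real.pi) by ring,
      mul_lt_mul_iff_right₀ hpos, mul_le_mul_iff_right₀ hpos]
  rw [hp, Real.smul_map_volume_mul_left hpos.ne', abs_of_pos hpos, ENNReal.ofReal_natCast, smul_eq_mul, Nat.cast_mul, mul_comm (((2 * K : ℕ) : ENNReal)), mul_assoc] at b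
  exact (ENNReal.mul_right_inj (by simpa using hh) (by simp)).1 b

theorem ae_sum (δ : ℝ) (hδ : 0 < δ) (hδ1 : δ < 1) :
    ∀ᵐ t : ℝ, ∑' h : ℕ, ENNReal.ofReal (((h + 1 : ℕ) : ℝ) ^ (-(1 + δ))) * sphi δ ((h + 1 : ℕ) * t) < ⊤ := by
  have hpi := Real.pi_pos
  have key : ∀ K : ℕ, ∀ᵐ t : ℝ, t ∈ Set.Ioc (-K * Real.pi) (K * Real.pi) → 
      ∑' h : ℕ, ENNReal.ofReal (((h + 1 : ℕ) : ℝ) ^ (-(1 + δ))) * sphi δ ((h + 1 : ℕ) * t) < ⊤ := by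
    intro K
    rw [← ae_restrict_iff' measurableSet_Ioc]
    have hm : ∀ h : ℕ, Measurable fun t : ℝ => sphi δ ((h + 1 : ℕ) * t) := fun h =>
      (sphi_meas δ).comp (by fun_prop)
    have hm' : ∀ h : ℕ, Measurable fun t : ℝ =>
        ENNReal.ofReal (((h + 1 : ℕ) : ℝ) ^ (-(1 + δ))) * sphi δ ((h + 1 : ℕ) * t) := fun h =>
      (hm h).const_mul _
    refine ae_lt_top (Measurable.tsum hm') ?_
    rw [lintegral_tsum fun h => (hm' h).aemeasurable]
    simp_rw [lintegral_const_mul _ (hm _), sphi_scale δ K _ (Nat.succ_ne_zero _)]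
    rw [ENNReal.tsum_mul_right]
    refine ENNReal.mul_ne_top ?_ (ENNReal.mul_ne_top (ENNReal.natCast_ne_top _) (sphi_fin δ hδ hδ1).ne)
    have hs : Summable fun h : ℕ => ((h + 1 : ℕ) : ℝ) ^ (-(1 + δ)) :=
      (summable_nat_add_iff 1).2 (Real.summable_nat_rpow.2 (by linarith))
    rw [← ENNReal.ofReal_tsum_of_nonneg (fun h => by positivity) hs]
    simp
  filter_upwards [ae_all_iff.2 key] with t ht
  obtain ⟨K, hK⟩ := exists_nat_gt (|t| / Real.pi)
  rw [div_lt_iff₀ hpi, abs_lt] at hK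
  exact ht K ⟨by linarith [hK.1], hK.2.le⟩

theorem det_bd (δ t : ℝ) (hδ : 0 < δ) (hδ1 : δ < 1)
    (ht : ∑' h : ℕ, ENNReal.ofReal (((h + 1 : ℕ) : ℝ) ^ (-(1 + δ))) * sphi δ ((h + 1 : ℕ) * t) < ⊤) :
    ∃ C : ℝ, 0 ≤ C ∧ ∀ N : ℕ, 1 ≤ N → ∀ x : ℝ,
      ‖∑ n ∈ Finset.Icc 1 N,
          Complex.exp (Complex.I * ((n : ℂ) * (x : ℂ) - (t : ℂ) * (n : ℂ) ^ 2))‖ ≤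
        C * (N : ℝ) ^ ((1 : ℝ) / 2 + δ) := by
  set F : ℕ → ENNReal := fun h => ENNReal.ofReal (((h + 1 : ℕ) : ℝ) ^ (-(1 + δ))) * sphi δ ((h + 1 : ℕ) * t) with hF
  have hsum := ENNReal.summable_toReal ht.ne
  have hsin : ∀ h : ℕ, Real.sin ((h + 1 : ℕ) * t) ≠ 0 := by
    intro h h0
    have := ENNReal.ne_top_of_tsum_ne_top ht.ne h
    apply this
    simp only [hF, sphi, h0, abs_zero, ENNReal.ofReal_zero]
    rw [ENNReal.zero_rpow_of_neg (by linarith), ENNReal.mul_top]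
    simp only [ne_eq, ENNReal.ofReal_eq_zero, not_le]
    positivity
  have hFr : ∀ h : ℕ, (F h).toReal = ((h + 1 : ℕ) : ℝ) ^ (-(1 + δ)) * |Real.sin ((h + 1 : ℕ) * t)| ^ (-(1-δ)) := by
    intro h
    simp only [hF, sphi]
    rw [ENNReal.ofReal_rpow_of_pos (abs_pos.2 (hsin h)), ENNReal.toReal_mul,
      ENNReal.toReal_ofReal (by positivity), ENNReal.toReal_ofReal (by positivity)]
  set A := ∑' h, (F h).toReal with hA
  have hA0 : 0 ≤ A := tsum_nonneg fun _ => ENNReal.toReal_nonneg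
  refine ⟨√(2 + 2 * A), Real.sqrt_nonneg _, fun N hN x => ?_⟩
  have hNp : (1:ℝ) ≤ N := by exact_mod_cast hN
  have hN0 : (0:ℝ) < N := by linarith
  set a : ℕ → ℂ := fun n => Complex.exp (Complex.I * (((n + 1 : ℕ) : ℂ) * (x : ℂ) - (t : ℂ) * ((n + 1 : ℕ) : ℂ) ^ 2)) with ha
  have hS : ∑ n ∈ Finset.Icc 1 N,
          Complex.exp (Complex.I * ((n : ℂ) * (x : ℂ) - (t : ℂ) * (n : ℂ) ^ 2)) = ∑ n ∈ range N, a n := by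
    rw [← Finset.sum_image (s := range N) (g := fun n => n + 1) (f := fun n : ℕ => Complex.exp (Complex.I * ((n : ℂ) * (x : ℂ) - (t : ℂ) * (n : ℂ) ^ 2))) (by intro u _ v _ h; simpa using h)]
    congr 1
    ext n
    simp only [Finset.mem_Icc, Finset.mem_image, Finset.mem_range]
    exact ⟨fun h => ⟨n - 1, by omega, by omega⟩, fun ⟨m, h, h'⟩ => by omega⟩
  rw [hS]
  have h1 := normsq_le' a N
  have h2 : ∑ d ∈ range N, ‖∑ n ∈ range (N - d), a (n + d) * star (a n)‖ ≤ N + N ^ (1 + 2 * δ) * A := by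
    obtain ⟨M, rfl⟩ : ∃ M, N = M + 1 := ⟨N - 1, by omega⟩
    rw [sum_range_succ', add_comm]
    refine add_le_add ?_ ?_
    · refine (norm_sum_le _ _).trans ?_
      have : ∀ n, ‖a n‖ = 1 := by
        intro n
        have := Complex.norm_exp_ofReal_mul_I ((n + 1) * x - t * (n + 1) ^ 2)
        rw [← this, ha]
        congr 2
        push_cast; ring
      simp [this]
    · have hb : ∀ d ∈ range M, ‖∑ n ∈ range (M + 1 - (d + 1)), a (n + (d + 1)) * star (a n)‖ ≤
          ((M + 1 : ℕ) : ℝ) ^ (1 + 2 * δ) * (F d).toReal := by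
        intro d hd
        refine (corr_bd t x (M+1) (d+1) δ hδ hδ1 (hsin d) a (fun n => rfl)).trans ?_
        rw [hFr, ← mul_assoc]
        gcongr
        have hd' : ((d + 1 : ℕ) : ℝ) ≤ ((M + 1 : ℕ) : ℝ) := by
          have := mem_range.1 hd
          exact_mod_cast (by omega)
        have : ((M + 1 : ℕ) : ℝ) ^ (-(1 + δ)) ≤ ((d + 1 : ℕ) : ℝ) ^ (-(1 + δ)) :=
          Real.rpow_le_rpow_of_nonpos (by positivity) hd' (by linarith)
        calc ((M + 1 : ℕ) : ℝ) ^ δ = ((M + 1 : ℕ) : ℝ) ^ (1 + 2 * δ) * ((M + 1 : ℕ) : ℝ) ^ (-(1 + δ)) := by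
              rw [← Real.rpow_add hN0]; congr 1; ring
          _ ≤ _ := by gcongr
      refine (sum_le_sum hb).trans ?_
      rw [← mul_sum]
      gcongr
      exact hsum.sum_le_tsum _ fun _ _ => ENNReal.toReal_nonneg
  have h3 : (N:ℝ) ≤ N ^ (1 + 2 * δ) := by
    conv_lhs => rw [← Real.rpow_one (N:ℝ)]
    exact Real.rpow_le_rpow_of_exponent_le hNp (by linarith)
  refine (sq_le_sq₀ (norm_nonneg _) (by positivity)).1 ?_
  rw [mul_pow, Real.sq_sqrt (by positivity), ← Real.rpow_natCast (_ ^ _) 2, ← Real.rpow_mul hN0.le]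
  rw [show (1 / 2 + δ) * ((2:ℕ):ℝ) = 1 + 2 * δ by push_cast; ring]
  nlinarith

/-- For almost every `t`: for every `ε > 0` there is a constant `C = C(t,ε)` such that
`sup_x |Σ_{n=1}^N e^{-itn² + inx}| ≤ C N^{1/2+ε}` for all `N ≥ 1`. -/
theorem weyl_sum_ae_bound :
    ∀ᵐ t : ℝ, ∀ ε : ℝ, 0 < ε → ∃ C : ℝ, ∀ N : ℕ, 1 ≤ N → ∀ x : ℝ,
      ‖∑ n ∈ Finset.Icc 1 N,
          Complex.exp (Complex.I * ((n : ℂ) * (x : ℂ) - (t : ℂ) * (n : ℂ) ^ 2))‖ ≤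
        C * (N : ℝ) ^ ((1 : ℝ) / 2 + ε) := by
  have hk : ∀ k : ℕ, (0:ℝ) < 1 / ((k:ℝ) + 2) ∧ 1 / ((k:ℝ) + 2) < 1 := fun k =>
    ⟨by positivity, by rw [div_lt_one (by positivity)]; linarith [(Nat.cast_nonneg k : (0:ℝ) ≤ k)]⟩
  filter_upwards [ae_all_iff.2 fun k : ℕ => ae_sum _ (hk k).1 (hk k).2] with t ht ε hε
  obtain ⟨k, hkε⟩ := exists_nat_one_div_lt hε
  obtain ⟨C, hC, h⟩ := det_bd _ t (hk k).1 (hk k).2 (ht k)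
  refine ⟨C, fun N hN x => (h N hN x).trans ?_⟩
  have hle : 1 / ((k:ℝ) + 2) ≤ ε := by
    refine le_trans ?_ hkε.le
    apply one_div_le_one_div_of_le <;> [positivity; linarith]
  have hN1 : (1:ℝ) ≤ N := by exact_mod_cast hN
  gcongr
end

section
/- For almost every t ∈ ℝ the following holds: the partial sums H_{N,t}(x) = Σ_{0<|n|≤N} e^{-itn² + inx}/n converge uniformly in x ∈ ℝ as N → ∞ to a continuous 2π-periodic function H_t, and for every ε > 0 there is a constant C = C(t,ε) such that for every integer j ≥ 1, sup_{x∈ℝ} | Σ_{2^{j-1} ≤ |n| < 2^{j}} e^{-itn² + inx}/n | ≤ C · 2^{-j(1/2 − ε)}. -/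
open Filter MeasureTheory Finset

/-- The partial sum `H_{N,t}(x) = Σ_{0<|n|≤N} e^{-itn²+inx}/n`. -/
noncomputable def HPartial (t : ℝ) (N : ℕ) (x : ℝ) : ℂ :=
  ∑ n ∈ (Finset.Icc (-(N : ℤ)) (N : ℤ)).erase 0,
    Complex.exp (Complex.I * ((n : ℂ) * (x : ℂ) - (t : ℂ) * (n : ℂ) ^ 2)) / (n : ℂ)

/-- The dyadic block `Σ_{2^{j-1} ≤ |n| < 2^j} e^{-itn²+inx}/n`. -/
noncomputable def HBlock (t : ℝ) (j : ℕ) (x : ℝ) : ℂ :=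
  ∑ n ∈ (Finset.Icc (-(2 ^ j : ℤ)) (2 ^ j : ℤ)).filter
      (fun n : ℤ => (2 : ℤ) ^ (j - 1) ≤ |n| ∧ |n| < (2 : ℤ) ^ j),
    Complex.exp (Complex.I * ((n : ℂ) * (x : ℂ) - (t : ℂ) * (n : ℂ) ^ 2)) / (n : ℂ)


lemma sinpow_int (δ : ℝ) (h0 : 0 < δ) (h1 : δ < 1) (a b : ℝ) :
    IntervalIntegrable (fun t : ℝ => |Real.sin t| ^ (-(1 - δ))) volume a b := by
  have hpi := Real.pi_pos
  have hper : Function.Periodic (fun t : ℝ => |Real.sin t| ^ (-(1 - δ))) Real.pi := by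
    intro t
    simp [Real.sin_add_pi]
  have hmeas : Measurable (fun t : ℝ => |Real.sin t| ^ (-(1 - δ))) := by
    fun_prop
  have hA : IntervalIntegrable (fun t : ℝ => |Real.sin t| ^ (-(1 - δ))) volume 0 (Real.pi / 2) := by
    have hg : IntervalIntegrable (fun t : ℝ => (2 / Real.pi) ^ (-(1 - δ)) * t ^ (-(1 - δ)))
        volume 0 (Real.pi / 2) :=
      (intervalIntegral.intervalIntegrable_rpow' (by linarith)).const_mul _
    refine hg.mono_fun' hmeas.aestronglyMeasurable ?_
    rw [Set.uIoc_of_le (by positivity)]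
    refine (ae_restrict_iff' measurableSet_Ioc).2 (Eventually.of_forall fun t ht => ?_)
    have hp : 0 < 2 / Real.pi * t := mul_pos (by positivity) ht.1
    have hs := Real.mul_le_sin ht.1.le ht.2
    show ‖|Real.sin t| ^ (-(1 - δ))‖ ≤ (2 / Real.pi) ^ (-(1 - δ)) * t ^ (-(1 - δ))
    rw [← Real.mul_rpow (by positivity) ht.1.le, Real.norm_of_nonneg (by positivity)]
    exact Real.rpow_le_rpow_of_nonpos hp (hs.trans (le_abs_self _)) (by linarith)
  have hB : IntervalIntegrable (fun t : ℝ => |Real.sin t| ^ (-(1 - δ))) volume (-(Real.pi / 2)) 0 := by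
    have := ((IntervalIntegrable.iff_comp_neg (by simp)).1 hA).symm
    simpa using this
  refine hper.intervalIntegrable hpi.ne' (t := -(Real.pi / 2)) ?_ a b
  have := hB.trans hA
  convert this using 1
  ring

lemma sinpow_scaled (δ : ℝ) (h0 : 0 < δ) (h1 : δ < 1) (R : ℕ) (d : ℤ) (hd : d ≠ 0) :
    IntervalIntegrable (fun t : ℝ => |Real.sin (d * t)| ^ (-(1 - δ))) volume
      (-(R * Real.pi)) (R * Real.pi) ∧
    ∫ t in (-(R * Real.pi))..(R * Real.pi), |Real.sin (d * t)| ^ (-(1 - δ)) =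
      2 * R * ∫ t in (0 : ℝ)..Real.pi, |Real.sin t| ^ (-(1 - δ)) := by
  have hd' : (d : ℝ) ≠ 0 := by exact_mod_cast hd
  have hper : Function.Periodic (fun t : ℝ => |Real.sin t| ^ (-(1 - δ))) Real.pi := by
    intro t
    simp [Real.sin_add_pi]
  have hI := sinpow_int δ h0 h1
  constructor
  · have := (hI (d * (-(R * Real.pi))) (d * (R * Real.pi))).comp_mul_left (c := (d : ℝ))
    rwa [mul_div_cancel_left₀ _ hd', mul_div_cancel_left₀ _ hd'] at this
  · rw [intervalIntegral.integral_comp_mul_left (fun t : ℝ => |Real.sin t| ^ (-(1 - δ))) hd']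
    have := hper.intervalIntegral_add_zsmul_eq (2 * d * R) (d * (-(R * Real.pi))) hI
    have e : (d : ℝ) * (-(R * Real.pi)) + (2 * d * R : ℤ) • Real.pi = d * (R * Real.pi) := by
      rw [zsmul_eq_mul]; push_cast; ring
    rw [e, hper.intervalIntegral_add_eq _ 0, zero_add] at this
    rw [this, zsmul_eq_mul, smul_eq_mul]
    push_cast
    field_simp

lemma ae_summable_sin (δ : ℝ) (h0 : 0 < δ) (h1 : δ < 1) :
    ∀ᵐ t : ℝ, Summable fun d : ℤ =>
      |(d : ℝ)| ^ (-(1 + δ)) * |Real.sin (d * t)| ^ (-(1 - δ)) := by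
  have hpi := Real.pi_pos
  have key : ∀ R : ℕ, ∀ᵐ t : ℝ, t ∈ Set.Ioc (-(R * Real.pi)) (R * Real.pi) →
      Summable fun d : ℤ =>
      |(d : ℝ)| ^ (-(1 + δ)) * |Real.sin (d * t)| ^ (-(1 - δ)) := by
    intro R
    rw [← ae_restrict_iff' measurableSet_Ioc]
    set I := ∫ t in (0 : ℝ)..Real.pi, |Real.sin t| ^ (-(1 - δ)) with hIdef
    have hle : -(R * Real.pi) ≤ R * Real.pi := by
      have : 0 ≤ R * Real.pi := by positivity
      linarith
    have hm : ∀ d : ℤ, Measurable fun t : ℝ => ENNReal.ofReal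
        (|(d : ℝ)| ^ (-(1 + δ)) * |Real.sin (d * t)| ^ (-(1 - δ))) := by
      intro d
      fun_prop
    have hterm : ∀ d : ℤ, ∫⁻ t in Set.Ioc (-(R * Real.pi)) (R * Real.pi), ENNReal.ofReal
        (|(d : ℝ)| ^ (-(1 + δ)) * |Real.sin (d * t)| ^ (-(1 - δ))) =
        ENNReal.ofReal (|(d : ℝ)| ^ (-(1 + δ)) * (2 * R * I)) := by
      intro d
      by_cases hd : d = 0
      · subst hd
        have : (0 : ℝ) ^ (-(1 + δ)) = 0 := Real.zero_rpow (by linarith)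
        simp only [Int.cast_zero, abs_zero, this, zero_mul, ENNReal.ofReal_zero, lintegral_zero]
      · obtain ⟨hi, he⟩ := sinpow_scaled δ h0 h1 R d hd
        rw [← ofReal_integral_eq_lintegral_ofReal]
        · rw [← intervalIntegral.integral_of_le hle, intervalIntegral.integral_const_mul, he]
        · exact ((intervalIntegrable_iff_integrableOn_Ioc_of_le hle).1 hi).const_mul _
        · exact Eventually.of_forall fun t => by positivity
    have hfin : ∫⁻ t in Set.Ioc (-(R * Real.pi)) (R * Real.pi), ∑' d : ℤ, ENNReal.ofReal
        (|(d : ℝ)| ^ (-(1 + δ)) * |Real.sin (d * t)| ^ (-(1 - δ))) ≠ ⊤ := by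
      rw [lintegral_tsum fun d => (hm d).aemeasurable]
      simp_rw [hterm]
      exact ((Real.summable_abs_int_rpow (by linarith)).mul_right _).tsum_ofReal_ne_top
    filter_upwards [ae_lt_top (Measurable.tsum hm) hfin] with t ht
    have := ENNReal.summable_toReal ht.ne
    refine this.congr fun d => ?_
    rw [ENNReal.toReal_ofReal (by positivity)]
  filter_upwards [ae_all_iff.2 key] with t ht
  obtain ⟨R, hR⟩ := exists_nat_gt (|t| / Real.pi)
  rw [div_lt_iff₀ hpi, abs_lt] at hR
  exact ht R ⟨hR.1, hR.2.le⟩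

lemma ae_sin_ne : ∀ᵐ t : ℝ, ∀ d : ℤ, d ≠ 0 → Real.sin (d * t) ≠ 0 := by
  rw [ae_all_iff]
  intro d
  by_cases hd : d = 0
  · simp [hd]
  have hd' : (d : ℝ) ≠ 0 := by exact_mod_cast hd
  have hc : (Set.range fun k : ℤ => (k : ℝ) * Real.pi / d).Countable := Set.countable_range _
  filter_upwards [hc.ae_notMem volume] with t ht _ hs
  obtain ⟨k, hk⟩ := Real.sin_eq_zero_iff.1 hs
  exact ht ⟨k, by simp only [hk]; field_simp⟩

noncomputable def zt (t x : ℝ) (n : ℤ) : ℂ :=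
  Complex.exp (Complex.I * ((n : ℂ) * (x : ℂ) - (t : ℂ) * (n : ℂ) ^ 2))

lemma zt_eq (t x : ℝ) (n : ℤ) : zt t x n = Complex.exp (Complex.I * ((n * x - t * n ^ 2 : ℝ) : ℂ)) := by
  simp [zt]

lemma geo_bound (A θ : ℝ) (p q : ℤ) (hs : Real.sin (θ / 2) ≠ 0) :
    ‖∑ m ∈ Ico p q, Complex.exp (Complex.I * ((A + m * θ : ℝ) : ℂ))‖ ≤ |Real.sin (θ / 2)|⁻¹ := by
  rcases le_or_gt q p with h | h
  · rw [Ico_eq_empty (by omega)]; simp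
  have tel : ∀ q, p ≤ q → (Complex.exp (Complex.I * (θ : ℝ)) - 1) *
      ∑ m ∈ Ico p q, Complex.exp (Complex.I * ((A + m * θ : ℝ) : ℂ)) =
      Complex.exp (Complex.I * ((A + q * θ : ℝ) : ℂ)) - Complex.exp (Complex.I * ((A + p * θ : ℝ) : ℂ)) := by
    intro q hq
    induction q, hq using Int.leInduction with
    | base => simp
    | succ n hn ih =>
      rw [← insert_Ico_right_eq_Ico_add_one hn, sum_insert (by simp), mul_add, ih, sub_mul, ← Complex.exp_add]
      have : Complex.I * (θ : ℝ) + Complex.I * ((A + n * θ : ℝ) : ℂ) = Complex.I * ((A + (n + 1 : ℤ) * θ : ℝ) : ℂ) := by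
        push_cast; ring
      rw [this]; ring
  have h1 := congrArg norm (tel q h.le)
  rw [norm_mul, Complex.norm_exp_I_mul_ofReal_sub_one] at h1
  have h2 : ‖Complex.exp (Complex.I * ((A + q * θ : ℝ) : ℂ)) - Complex.exp (Complex.I * ((A + p * θ : ℝ) : ℂ))‖ ≤ 2 := by
    refine (norm_sub_le _ _).trans ?_
    rw [Complex.norm_exp_I_mul_ofReal, Complex.norm_exp_I_mul_ofReal]; norm_num
  rw [← h1, norm_mul, Real.norm_eq_abs, Real.norm_eq_abs] at h2
  have hp : 0 < |Real.sin (θ / 2)| := abs_pos.2 hs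
  rw [← one_div, le_div_iff₀ hp]
  have : |(2 : ℝ)| = 2 := by norm_num
  rw [this] at h2
  linarith

lemma interp_s5 (δ X M σ : ℝ) (h0 : 0 < δ) (h1 : δ < 1) (hX : 0 ≤ X) (hM : X ≤ M) (hσ : 0 < σ)
    (h : X ≤ σ⁻¹) : X ≤ M ^ δ * σ ^ (-(1 - δ)) := by
  calc X = X ^ δ * X ^ (1 - δ) := by
        rw [← Real.rpow_add_of_nonneg hX h0.le (by linarith)]; simp
    _ ≤ M ^ δ * (σ⁻¹) ^ (1 - δ) := by
        have : 0 ≤ M := hX.trans hM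
        have : 0 ≤ 1 - δ := by linarith
        gcongr
    _ = _ := by rw [Real.inv_rpow hσ.le, Real.rpow_neg hσ.le]

lemma weyl (δ : ℝ) (h0 : 0 < δ) (h1 : δ < 1) (t : ℝ)
    (hsum : Summable fun d : ℤ =>
      |(d : ℝ)| ^ (-(1 + δ)) * |Real.sin (d * t)| ^ (-(1 - δ)))
    (hsin : ∀ d : ℤ, d ≠ 0 → Real.sin (d * t) ≠ 0) :
    ∃ C : ℝ, 0 ≤ C ∧ ∀ x : ℝ, ∀ a b : ℤ, a < b →
      ‖∑ n ∈ Ico a b, zt t x n‖ ≤ C * ((b - a : ℤ) : ℝ) ^ (1 / 2 + δ) := by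
  set g : ℤ → ℝ := fun d : ℤ =>
      |(d : ℝ)| ^ (-(1 + δ)) * |Real.sin (d * t)| ^ (-(1 - δ)) with hg
  have hgn : ∀ d, 0 ≤ g d := fun d => by positivity
  set K := ∑' d, g d with hK
  have hKn : 0 ≤ K := tsum_nonneg hgn
  refine ⟨Real.sqrt (1 + K), Real.sqrt_nonneg _, fun x a b hab => ?_⟩
  set M : ℝ := ((b - a : ℤ) : ℝ) with hM
  have hM1 : 1 ≤ M := by rw [hM]; exact_mod_cast (by omega : 1 ≤ b - a)
  have hM0 : 0 < M := by linarith
  have expand : ((‖∑ n ∈ Ico a b, zt t x n‖ ^ 2 : ℝ) : ℂ) =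
      ∑ d ∈ Ioo (a - b) (b - a), ∑ m ∈ Ico (max a (a - d)) (min b (b - d)),
        zt t x (m + d) * (starRingEnd ℂ) (zt t x m) := by
    rw [← Complex.normSq_eq_norm_sq, ← Complex.mul_conj, map_sum, mul_comm, sum_mul_sum]
    have hc := sum_comm' (s := Ico a b) (t := fun m => Ico (a - m) (b - m))
      (t' := Ioo (a - b) (b - a)) (s' := fun d => Ico (max a (a - d)) (min b (b - d)))
      (f := fun m d => zt t x (m + d) * (starRingEnd ℂ) (zt t x m)) (by
        intro m d
        simp only [mem_Ico, mem_Ioo]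
        omega)
    rw [← hc]
    refine sum_congr rfl fun m _ => ?_
    have := sum_Ico_add' (fun n => zt t x n * (starRingEnd ℂ) (zt t x m)) (a - m) (b - m) m
    simp only [sub_add_cancel] at this
    rw [show (∑ d ∈ Ico (a - m) (b - m), zt t x (m + d) * (starRingEnd ℂ) (zt t x m)) = _ from
      (sum_congr rfl fun d _ => by rw [add_comm m d]), this]
    exact sum_congr rfl fun n _ => mul_comm _ _
  have hinner : ∀ d ∈ Ioo (a - b) (b - a), ‖∑ m ∈ Ico (max a (a - d)) (min b (b - d)),
        zt t x (m + d) * (starRingEnd ℂ) (zt t x m)‖ ≤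
        (if d = 0 then M else 0) + M ^ (1 + 2 * δ) * g d := by
    intro d hd
    rw [mem_Ioo] at hd
    have hterm : ∀ m : ℤ, zt t x (m + d) * (starRingEnd ℂ) (zt t x m) =
        Complex.exp (Complex.I * (((d * x - t * d ^ 2) + m * (-2 * (d * t)) : ℝ) : ℂ)) := by
      intro m
      rw [zt_eq, zt_eq, ← Complex.exp_conj, ← Complex.exp_add, map_mul, Complex.conj_I, Complex.conj_ofReal]
      congr 1
      push_cast; ring
    simp_rw [hterm]
    set X := ‖∑ m ∈ Ico (max a (a - d)) (min b (b - d)),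
      Complex.exp (Complex.I * (((d * x - t * d ^ 2) + m * (-2 * (d * t)) : ℝ) : ℂ))‖ with hX
    have hXM : X ≤ M := by
      refine (norm_sum_le _ _).trans ?_
      simp_rw [Complex.norm_exp_I_mul_ofReal]
      rw [sum_const, nsmul_eq_mul, mul_one, Int.card_Ico, hM]
      have : (((min b (b - d) - max a (a - d)).toNat : ℤ)) ≤ b - a := by omega
      exact_mod_cast this
    by_cases hd0 : d = 0
    · rw [if_pos hd0]
      have := hgn d
      have : 0 ≤ M ^ (1 + 2 * δ) * g d := by positivity
      linarith
    · rw [if_neg hd0, zero_add]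
      have hs := hsin d hd0
      have e : Real.sin (-2 * (d * t) / 2) = - Real.sin (d * t) := by
        rw [← Real.sin_neg]; congr 1; ring
      have hgeo := geo_bound (d * x - t * d ^ 2) (-2 * (d * t)) (max a (a - d)) (min b (b - d))
        (by rw [e]; exact neg_ne_zero.2 hs)
      rw [e, abs_neg] at hgeo
      have hi := interp_s5 δ X M _ h0 h1 (norm_nonneg _) hXM (abs_pos.2 hs) hgeo
      refine hi.trans ?_
      have hdp : 0 < |(d : ℝ)| := abs_pos.2 (by exact_mod_cast hd0)
      have hdM : |(d : ℝ)| ≤ M := by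
        rw [hM]; exact_mod_cast (by rw [abs_le]; omega : |d| ≤ b - a)
      have h3 : 1 ≤ M ^ (1 + δ) * |(d : ℝ)| ^ (-(1 + δ)) := by
        rw [Real.rpow_neg hdp.le, ← div_eq_mul_inv, one_le_div (by positivity)]
        gcongr
      have h4 : M ^ (1 + 2 * δ) = M ^ δ * M ^ (1 + δ) := by
        rw [← Real.rpow_add hM0]; congr 1; ring
      rw [hg, h4]
      have h5 : 0 ≤ M ^ δ * |Real.sin (d * t)| ^ (-(1 - δ)) := by positivity
      nlinarith [mul_le_mul_of_nonneg_left h3 h5]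
  have hsq : ‖∑ n ∈ Ico a b, zt t x n‖ ^ 2 ≤ (1 + K) * M ^ (1 + 2 * δ) := by
    have hn := congrArg norm expand
    rw [Complex.norm_real, Real.norm_of_nonneg (by positivity)] at hn
    rw [hn]
    refine (norm_sum_le _ _).trans ((sum_le_sum hinner).trans ?_)
    rw [sum_add_distrib, ← mul_sum, sum_ite_eq' (Ioo (a - b) (b - a)) 0 (fun _ => M), if_pos (by rw [mem_Ioo]; omega)]
    have h6 : ∑ d ∈ Ioo (a - b) (b - a), g d ≤ K := hsum.sum_le_tsum _ fun d _ => hgn d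
    have h7 : M ≤ M ^ (1 + 2 * δ) := by
      conv_lhs => rw [← Real.rpow_one M]
      exact Real.rpow_le_rpow_of_exponent_le hM1 (by linarith)
    have h8 : 0 ≤ M ^ (1 + 2 * δ) := by positivity
    nlinarith [mul_le_mul_of_nonneg_left h6 h8]
  refine ((Real.le_sqrt (norm_nonneg _) (by positivity)).2 hsq).trans ?_
  rw [Real.sqrt_mul (by positivity), Real.sqrt_eq_rpow (M ^ _), ← Real.rpow_mul hM0.le]
  apply le_of_eq
  congr 2
  ring

lemma abel (z : ℤ → ℂ) (a : ℤ) (ha : 1 ≤ a) (B : ℝ) (b : ℤ) (hab : a ≤ b)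
    (hB : ∀ c, a ≤ c → c ≤ b → ‖∑ n ∈ Ico a c, z n‖ ≤ B) :
    ‖∑ n ∈ Ico a b, z n / n‖ ≤ B / a := by
  have ha0 : (0 : ℝ) < a := by exact_mod_cast (by omega : 0 < a)
  have claim : ∀ c, a ≤ c → c ≤ b →
      ‖∑ n ∈ Ico a c, z n / n - (∑ n ∈ Ico a c, z n) / c‖ ≤ B * (1 / a - 1 / c) := by
    intro c hc
    induction c, hc using Int.leInduction with
    | base => intro _; simp
    | succ n hn ih =>
      intro hnb
      have hn0 : (0 : ℝ) < n := by exact_mod_cast (by omega : 0 < n)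
      have hnc : (n : ℂ) ≠ 0 := by exact_mod_cast (by omega : n ≠ 0)
      have hnc1 : (n : ℂ) + 1 ≠ 0 := by exact_mod_cast (by omega : n + 1 ≠ 0)
      have h1 := ih (by omega)
      have h2 := hB (n + 1) (by omega) hnb
      have e1 : ∑ k ∈ Ico a (n + 1), z k / k = z n / n + ∑ k ∈ Ico a n, z k / k := by
        rw [← insert_Ico_right_eq_Ico_add_one hn, sum_insert (by simp)]
      have e2 : ∑ k ∈ Ico a (n + 1), z k = z n + ∑ k ∈ Ico a n, z k := by
        rw [← insert_Ico_right_eq_Ico_add_one hn, sum_insert (by simp)]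
      have e3 : ∑ k ∈ Ico a (n + 1), z k / k - (∑ k ∈ Ico a (n + 1), z k) / (n + 1 : ℤ) =
          (∑ k ∈ Ico a n, z k / k - (∑ k ∈ Ico a n, z k) / n) +
          (∑ k ∈ Ico a (n + 1), z k) * ((1 / n - 1 / (n + 1) : ℝ) : ℂ) := by
        rw [e1, e2]; push_cast; field_simp; ring
      rw [e3]
      refine (norm_add_le _ _).trans ?_
      rw [norm_mul, Complex.norm_real]
      have h3 : 0 ≤ (1 / n - 1 / (n + 1) : ℝ) := by
        rw [sub_nonneg]; gcongr; linarith
      rw [Real.norm_of_nonneg h3]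
      have := mul_le_mul_of_nonneg_right h2 h3
      push_cast
      linarith
  have h1 := claim b hab le_rfl
  have h2 := hB b hab le_rfl
  have hb0 : (0 : ℝ) < b := by exact_mod_cast (by omega : 0 < b)
  have h3 : ‖(∑ n ∈ Ico a b, z n) / (b : ℂ)‖ ≤ B * (1 / b) := by
    rw [norm_div, Complex.norm_intCast, abs_of_pos hb0, div_eq_mul_one_div]
    gcongr
  have := norm_add_le (∑ n ∈ Ico a b, z n / n - (∑ n ∈ Ico a b, z n) / (b : ℂ)) ((∑ n ∈ Ico a b, z n) / (b : ℂ))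
  rw [sub_add_cancel] at this
  rw [div_eq_mul_one_div]
  linarith

lemma block_bound (δ : ℝ) (h0 : 0 < δ) (t C : ℝ) (hC : 0 ≤ C)
    (hw : ∀ x : ℝ, ∀ a b : ℤ, a < b →
      ‖∑ n ∈ Ico a b, zt t x n‖ ≤ C * ((b - a : ℤ) : ℝ) ^ (1 / 2 + δ))
    (x : ℝ) (a b : ℤ) (ha : 1 ≤ a) (hab : a ≤ b) (hb : b ≤ 2 * a) :
    ‖∑ n ∈ Ico a b, zt t x n / n‖ ≤ C * (a : ℝ) ^ (-(1 / 2 - δ)) := by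
  have ha0 : (0 : ℝ) < a := by exact_mod_cast (by omega : 0 < a)
  have := abel (zt t x) a ha (C * (a : ℝ) ^ (1 / 2 + δ)) b hab (by
    intro c hac hcb
    rcases hac.eq_or_lt with rfl | h
    · simp; positivity
    refine (hw x a c h).trans ?_
    have : (0 : ℝ) ≤ ((c - a : ℤ) : ℝ) := by exact_mod_cast (by omega : 0 ≤ c - a)
    have : ((c - a : ℤ) : ℝ) ≤ a := by exact_mod_cast (by omega : c - a ≤ a)
    gcongr)
  refine this.trans (le_of_eq ?_)
  rw [mul_div_assoc, ← Real.rpow_sub_one ha0.ne']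
  congr 2
  ring

lemma tail_bound (t C : ℝ) (hC : 0 ≤ C)
    (hb : ∀ (x : ℝ) (a b : ℤ), 1 ≤ a → a ≤ b → b ≤ 2 * a →
      ‖∑ n ∈ Ico a b, zt t x n / n‖ ≤ C * (a : ℝ) ^ (-(1 / 4) : ℝ)) :
    ∃ D : ℝ, 0 ≤ D ∧ ∀ (x : ℝ) (a b : ℤ), 1 ≤ a → a ≤ b →
      ‖∑ n ∈ Ico a b, zt t x n / n‖ ≤ D * (a : ℝ) ^ (-(1 / 4) : ℝ) := by
  set r : ℝ := (2 : ℝ) ^ (-(1 / 4) : ℝ) with hr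
  have hr1 : r < 1 := Real.rpow_lt_one_of_one_lt_of_neg (by norm_num) (by norm_num)
  have hr1' : 0 < 1 - r := by linarith
  have hr0 : 0 < r := by positivity
  refine ⟨C / (1 - r), by positivity, ?_⟩
  have hD : C + C / (1 - r) * r = C / (1 - r) := by field_simp; ring
  have hCD : C ≤ C / (1 - r) := by
    have : 0 ≤ C / (1 - r) * r := by positivity
    linarith
  have main : ∀ (k : ℕ) (x : ℝ) (a b : ℤ), 1 ≤ a → a ≤ b → b - a ≤ k →
      ‖∑ n ∈ Ico a b, zt t x n / n‖ ≤ C / (1 - r) * (a : ℝ) ^ (-(1 / 4) : ℝ) := by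
    intro k
    induction k with
    | zero =>
      intro x a b ha hab hk
      refine (hb x a b ha hab (by omega)).trans ?_
      have : (0 : ℝ) < a := by exact_mod_cast (by omega : 0 < a)
      gcongr
    | succ k ih =>
      intro x a b ha hab hk
      have ha0 : (0 : ℝ) < a := by exact_mod_cast (by omega : 0 < a)
      rcases le_or_gt b (2 * a) with h | h
      · refine (hb x a b ha hab h).trans ?_
        gcongr
      · have e : ∑ n ∈ Ico a b, zt t x n / n =
            ∑ n ∈ Ico a (2 * a), zt t x n / n + ∑ n ∈ Ico (2 * a) b, zt t x n / n := by
          rw [← sum_union (Ico_disjoint_Ico_consecutive _ _ _), Ico_union_Ico_eq_Ico (by omega) h.le]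
        rw [e]
        refine (norm_add_le _ _).trans ?_
        have i1 := hb x a (2 * a) ha (by omega) le_rfl
        have i2 := ih x (2 * a) b (by omega) h.le (by omega)
        push_cast at i2
        rw [Real.mul_rpow (by norm_num) ha0.le, ← hr] at i2
        calc _ ≤ _ := add_le_add i1 i2
          _ = (C + C / (1 - r) * r) * (a : ℝ) ^ (-(1 / 4) : ℝ) := by ring
          _ = _ := by rw [hD]
  intro x a b ha hab
  exact main (b - a).toNat x a b ha hab (by omega)

lemma sym_sum (t x : ℝ) (s S : Finset ℤ) (hs : ∀ n, n ∈ s ↔ 0 < n ∧ n ∈ S)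
    (h0 : (0 : ℤ) ∉ S) (hS : ∀ n, n ∈ S ↔ -n ∈ S) :
    ∑ n ∈ S, zt t x n / n = ∑ n ∈ s, zt t x n / n - ∑ n ∈ s, zt t (-x) n / n := by
  have hSe : S = s ∪ s.image (fun n => -n) := by
    ext n
    simp only [mem_union, mem_image, hs]
    constructor
    · intro h
      rcases lt_trichotomy n 0 with h' | h' | h'
      · exact Or.inr ⟨-n, ⟨by omega, (hS n).1 h⟩, by simp⟩
      · subst h'; exact absurd h h0
      · exact Or.inl ⟨h', h⟩
    · rintro (h | ⟨m, h, rfl⟩)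
      · exact h.2
      · exact (hS m).1 h.2
  have hd : Disjoint s (s.image (fun n => -n)) := by
    rw [Finset.disjoint_left]
    intro n hn hn'
    obtain ⟨m, hm, rfl⟩ := mem_image.1 hn'
    have := ((hs _).1 hm).1
    have := ((hs _).1 hn).1
    omega
  rw [hSe, sum_union hd, sum_image (fun _ _ _ _ h => neg_injective h), sub_eq_add_neg, ← sum_neg_distrib]
  congr 1
  refine sum_congr rfl fun n _ => ?_
  unfold zt
  push_cast
  rw [div_neg]
  congr 3
  ring_nf

lemma HPartial_eq (t : ℝ) (N : ℕ) (x : ℝ) : HPartial t N x =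
    ∑ n ∈ Ico 1 ((N : ℤ) + 1), zt t x n / n - ∑ n ∈ Ico 1 ((N : ℤ) + 1), zt t (-x) n / n := by
  rw [← sym_sum t x _ ((Finset.Icc (-(N : ℤ)) (N : ℤ)).erase 0)]
  · rfl
  · intro n; simp only [mem_Ico, mem_erase, mem_Icc]; omega
  · simp
  · intro n; simp only [mem_erase, mem_Icc]; omega

lemma HBlock_eq (t : ℝ) (j : ℕ) (hj : 1 ≤ j) (x : ℝ) : HBlock t j x =
    ∑ n ∈ Ico ((2 : ℤ) ^ (j - 1)) (2 ^ j), zt t x n / n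
      - ∑ n ∈ Ico ((2 : ℤ) ^ (j - 1)) (2 ^ j), zt t (-x) n / n := by
  have hp : (0 : ℤ) < 2 ^ (j - 1) := by positivity
  rw [← sym_sum t x _ ((Finset.Icc (-(2 ^ j : ℤ)) (2 ^ j : ℤ)).filter
      (fun n : ℤ => (2 : ℤ) ^ (j - 1) ≤ |n| ∧ |n| < (2 : ℤ) ^ j))]
  · rfl
  · intro n; simp only [mem_Ico, mem_filter, mem_Icc]
    constructor
    · rintro ⟨h1, h2⟩
      rw [abs_of_pos (by omega)]
      omega
    · rintro ⟨h1, _, h2⟩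
      rwa [abs_of_pos h1] at h2
  · simp only [mem_filter, abs_zero]; omega
  · intro n; simp only [mem_filter, mem_Icc, abs_neg]; omega

/-- For almost every `t`, the partial sums `H_{N,t}` converge uniformly to a continuous
`2π`-periodic function `H_t`, and each dyadic block is `O(2^{-j(1/2-ε)})` uniformly in `x`. -/
theorem HPartial_uniform_limit :
    ∀ᵐ t : ℝ, ∃ H : ℝ → ℂ, Continuous H ∧ Function.Periodic H (2 * Real.pi) ∧
      TendstoUniformly (HPartial t) H atTop ∧
      ∀ ε : ℝ, 0 < ε → ∃ C : ℝ, ∀ j : ℕ, 1 ≤ j → ∀ x : ℝ,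
        ‖HBlock t j x‖ ≤ C * (2 : ℝ) ^ (-(j : ℝ) * ((1 : ℝ) / 2 - ε)) := by
  have hk0 : ∀ k : ℕ, (0 : ℝ) < 1 / ((k : ℝ) + 2) := fun k => by positivity
  have hk1 : ∀ k : ℕ, 1 / ((k : ℝ) + 2) < 1 := fun k => by
    rw [div_lt_one (by positivity)]
    have : (0 : ℝ) ≤ k := by positivity
    linarith
  filter_upwards [ae_sin_ne, ae_all_iff.2 fun k : ℕ => ae_summable_sin _ (hk0 k) (hk1 k)]
    with t hsin hsum
  have hblock : ∀ k : ℕ, ∃ C : ℝ, 0 ≤ C ∧ ∀ (x : ℝ) (a b : ℤ), 1 ≤ a → a ≤ b → b ≤ 2 * a →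
      ‖∑ n ∈ Ico a b, zt t x n / n‖ ≤ C * (a : ℝ) ^ (-(1 / 2 - 1 / ((k : ℝ) + 2))) := by
    intro k
    obtain ⟨C, hC, hw⟩ := weyl _ (hk0 k) (hk1 k) t (hsum k) hsin
    exact ⟨C, hC, block_bound _ (hk0 k) t C hC hw⟩
  obtain ⟨D, hD, htail⟩ : ∃ D : ℝ, 0 ≤ D ∧ ∀ (x : ℝ) (a b : ℤ), 1 ≤ a → a ≤ b →
      ‖∑ n ∈ Ico a b, zt t x n / n‖ ≤ D * (a : ℝ) ^ (-(1 / 4) : ℝ) := by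
    obtain ⟨C, hC, hb⟩ := hblock 2
    refine tail_bound t C hC fun x a b h1 h2 h3 => ?_
    convert hb x a b h1 h2 h3 using 3
    norm_num
  have hdiff : ∀ (x : ℝ) (M N : ℕ), M ≤ N →
      ‖HPartial t N x - HPartial t M x‖ ≤ 2 * D * ((M : ℝ) + 1) ^ (-(1 / 4) : ℝ) := by
    intro x M N hMN
    have e : ∀ y : ℝ, ∑ n ∈ Ico 1 ((N : ℤ) + 1), zt t y n / n =
        ∑ n ∈ Ico 1 ((M : ℤ) + 1), zt t y n / n + ∑ n ∈ Ico ((M : ℤ) + 1) ((N : ℤ) + 1), zt t y n / n := by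
      intro y
      rw [← sum_union (Ico_disjoint_Ico_consecutive _ _ _), Ico_union_Ico_eq_Ico (by omega) (by omega)]
    have i1 := htail x (M + 1) (N + 1) (by omega) (by omega)
    have i2 := htail (-x) (M + 1) (N + 1) (by omega) (by omega)
    rw [HPartial_eq, HPartial_eq, e, e]
    have e2 : ∀ A B C D : ℂ, (A + B) - (C + D) - (A - C) = B - D := by intros; ring
    rw [e2]
    refine (norm_sub_le _ _).trans ?_
    push_cast at i1 i2
    linarith
  have hlim0 : Tendsto (fun M : ℕ => 2 * D * ((M : ℝ) + 1) ^ (-(1 / 4) : ℝ)) atTop (nhds 0) := by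
    have h1 : Tendsto (fun M : ℕ => (M : ℝ) + 1) atTop atTop :=
      tendsto_atTop_add_const_right _ _ tendsto_natCast_atTop_atTop
    have := ((tendsto_rpow_neg_atTop (by norm_num : (0 : ℝ) < 1 / 4)).comp h1).const_mul (2 * D)
    simpa using this
  have hcauchy : UniformCauchySeqOn (HPartial t) atTop Set.univ := by
    rw [Metric.uniformCauchySeqOn_iff]
    intro ε hε
    obtain ⟨N, hN⟩ := eventually_atTop.1 (hlim0.eventually (gt_mem_nhds hε))
    refine ⟨N, fun m hm n hn x _ => ?_⟩
    rcases le_total m n with h | h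
    · rw [dist_comm, dist_eq_norm]
      exact (hdiff x m n h).trans_lt (hN m hm)
    · rw [dist_eq_norm]
      exact (hdiff x n m h).trans_lt (hN n hn)
  have hpt : ∀ x : ℝ, ∃ y : ℂ, Tendsto (fun n => HPartial t n x) atTop (nhds y) := fun x =>
    cauchySeq_tendsto_of_complete (hcauchy.cauchySeq (Set.mem_univ x))
  choose H hH using hpt
  have hunif : TendstoUniformly (HPartial t) H atTop := by
    rw [← tendstoUniformlyOn_univ]
    exact hcauchy.tendstoUniformlyOn_of_tendsto fun x _ => hH x
  refine ⟨H, ?_, ?_, hunif, ?_⟩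
  · refine hunif.continuous (Frequently.of_forall fun N => ?_)
    unfold HPartial
    fun_prop
  · intro x
    refine tendsto_nhds_unique (hH (x + 2 * Real.pi)) ((hH x).congr fun N => ?_)
    unfold HPartial
    refine sum_congr rfl fun n _ => ?_
    congr 1
    rw [Complex.exp_eq_exp_iff_exists_int]
    refine ⟨-n, ?_⟩
    push_cast
    ring
  · intro ε hε
    obtain ⟨k, hk⟩ := exists_nat_gt (1 / ε)
    have hkε : 1 / ((k : ℝ) + 2) ≤ ε := by
      rw [div_le_iff₀ (by positivity)]
      rw [div_lt_iff₀ hε] at hk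
      nlinarith
    obtain ⟨C, hC, hb⟩ := hblock k
    set δ : ℝ := 1 / ((k : ℝ) + 2) with hδ
    refine ⟨2 * C * (2 : ℝ) ^ (1 / 2 - δ), fun j hj x => ?_⟩
    have hp : (2 : ℤ) ^ j = 2 * 2 ^ (j - 1) := by
      rw [← pow_succ']; congr 1; omega
    have hp1 : (1 : ℤ) ≤ 2 ^ (j - 1) := one_le_pow₀ (by norm_num)
    have i1 := hb x (2 ^ (j - 1)) (2 ^ j) hp1 (by omega) (by omega)
    have i2 := hb (-x) (2 ^ (j - 1)) (2 ^ j) hp1 (by omega) (by omega)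
    have e : (((2 : ℤ) ^ (j - 1) : ℤ) : ℝ) ^ (-(1 / 2 - δ)) =
        (2 : ℝ) ^ (1 / 2 - δ) * (2 : ℝ) ^ (-(j : ℝ) * (1 / 2 - δ)) := by
      push_cast
      rw [← Real.rpow_natCast, ← Real.rpow_mul (by norm_num), ← Real.rpow_add (by norm_num),
        Nat.cast_sub hj]
      congr 1
      push_cast
      ring
    rw [e] at i1 i2
    rw [HBlock_eq t j hj]
    refine (norm_sub_le _ _).trans ?_
    have hle : (2 : ℝ) ^ (-(j : ℝ) * (1 / 2 - δ)) ≤ (2 : ℝ) ^ (-(j : ℝ) * (1 / 2 - ε)) := by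
      apply Real.rpow_le_rpow_of_exponent_le (by norm_num)
      have : (0 : ℝ) ≤ j := by positivity
      nlinarith
    calc _ ≤ _ := add_le_add i1 i2
      _ = 2 * C * (2 : ℝ) ^ (1 / 2 - δ) * (2 : ℝ) ^ (-(j : ℝ) * (1 / 2 - δ)) := by ring
      _ ≤ _ := by gcongr
end

section
/- Let g: T → ℂ have bounded variation. Then for almost every t ∈ ℝ, the L²(T) function e^{it∂ₓₓ}g has a representative which is α-Hölder continuous for every exponent 0 < α < 1/2 (with Hölder constant depending on g, t and α). -/
open MeasureTheory


/-- The `n`-th Fourier coefficient `ĝ(n) = (1/2π) ∫₀^{2π} e^{-inx} g(x) dx` of a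
`2π`-periodic function `g : ℝ → ℂ`. -/
noncomputable def fourierCoef (g : ℝ → ℂ) (n : ℤ) : ℂ :=
  (1 / (2 * Real.pi)) * ∫ x in (0 : ℝ)..(2 * Real.pi),
    Complex.exp (-Complex.I * (n : ℂ) * (x : ℂ)) * g x


noncomputable def phs (t z : ℝ) (n : ℝ) : ℂ := Complex.exp (Complex.I * ((n * z - t * n ^ 2 : ℝ) : ℂ))

noncomputable def kerF (N : ℕ) (s : ℝ) : ℝ := N / (1 + N * |Real.sin s|)

noncomputable def weylW (N : ℕ) (t : ℝ) : ℝ := ∑ h ∈ Finset.range N, 4 * kerF N (h * t)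

lemma norm_phs (t z n : ℝ) : ‖phs t z n‖ = 1 := by
  unfold phs; rw [mul_comm]; exact Complex.norm_exp_ofReal_mul_I _

lemma kerF_nonneg (N : ℕ) (s : ℝ) : 0 ≤ kerF N s := by unfold kerF; positivity

lemma geom_bound (N L : ℕ) (hL : L ≤ N) (s : ℝ) (c : ℂ) (hc : ‖c‖ = 1) :
    ‖∑ l ∈ Finset.range L, c * Complex.exp (Complex.I * ((2 * s : ℝ) : ℂ)) ^ l‖ ≤ 2 * kerF N s := by
  rw [← Finset.mul_sum, norm_mul, hc, one_mul]
  set r := Complex.exp (Complex.I * ((2 * s : ℝ) : ℂ)) with hr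
  have hr1 : ‖r‖ = 1 := by rw [hr, mul_comm]; exact Complex.norm_exp_ofReal_mul_I _
  set S := ∑ l ∈ Finset.range L, r ^ l with hS
  have h1 : ‖S‖ ≤ N := by
    refine (norm_sum_le _ _).trans ?_
    simp [hr1, hL]
  have h2 : ‖S‖ * (2 * |Real.sin s|) ≤ 2 := by
    have := geom_sum_mul r L
    have h3 : ‖r - 1‖ = 2 * |Real.sin s| := by
      rw [hr, Complex.norm_exp_I_mul_ofReal_sub_one]; simp
    rw [← h3, ← norm_mul, hS, this]
    refine (norm_sub_le _ _).trans ?_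
    simp [hr1]; norm_num
  unfold kerF
  rw [← mul_div_assoc, le_div_iff₀ (by positivity)]
  have : (0:ℝ) ≤ N := by positivity
  nlinarith [norm_nonneg S, abs_nonneg (Real.sin s)]

lemma normsq_expand (f : ℕ → ℂ) (M : ℕ) :
    ‖∑ j ∈ Finset.range M, f j‖ ^ 2 ≤
      2 * (∑ m ∈ Finset.range M, ∑ k ∈ Finset.range (m + 1),
        f (k + (m - k)) * (starRingEnd ℂ) (f (m - k))).re := by
  induction M with
  | zero => simp
  | succ M ih =>
    rw [Finset.sum_range_succ, Finset.sum_range_succ _ M]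
    have e : ∑ k ∈ Finset.range (M + 1), f (k + (M - k)) * (starRingEnd ℂ) (f (M - k))
       = f M * (starRingEnd ℂ) (∑ j ∈ Finset.range (M+1), f j) := by
      rw [map_sum, Finset.mul_sum, ← Finset.sum_range_reflect]
      refine Finset.sum_congr rfl fun k hk => ?_
      have : k ≤ M := by simpa [Nat.lt_succ_iff] using hk
      have h1 : M + 1 - 1 - k + (M - (M + 1 - 1 - k)) = M := by omega
      have h2 : M - (M + 1 - 1 - k) = k := by omega
      rw [h1, h2]
    rw [e, Finset.sum_range_succ, Complex.add_re, mul_add]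
    refine le_trans ?_ (add_le_add_left ih _)
    set Z := ∑ j ∈ Finset.range M, f j
    rw [← Complex.normSq_eq_norm_sq, ← Complex.normSq_eq_norm_sq]
    simp only [Complex.normSq_apply, Complex.mul_re, map_add, Complex.add_re, Complex.add_im, Complex.conj_re, Complex.conj_im]
    nlinarith [sq_nonneg (f M).re, sq_nonneg (f M).im]

lemma phs_mul (t z a h l : ℝ) : phs t z (a + (h + l)) * (starRingEnd ℂ) (phs t z (a + l)) =
    Complex.exp (Complex.I * ((h * z - t * h ^ 2 - 2 * t * h * a : ℝ) : ℂ)) *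
    Complex.exp (Complex.I * ((-(2 * t * h * l) : ℝ) : ℂ)) := by
  unfold phs
  rw [← Complex.exp_conj, ← Complex.exp_add, ← Complex.exp_add]
  simp only [map_mul, Complex.conj_I, Complex.conj_ofReal]
  congr 1
  push_cast
  ring

lemma weyl_s6 (t z : ℝ) (a : ℝ) (M N : ℕ) (h : M ≤ N) :
    ‖∑ j ∈ Finset.range M, phs t z (a + j)‖ ^ 2 ≤ weylW N t := by
  refine (normsq_expand (fun j => phs t z (a + j)) M).trans ?_
  rw [Finset.sum_range_diag_flip M (fun k l => phs t z (a + ((k + l : ℕ):ℝ)) * (starRingEnd ℂ) (phs t z (a + (l:ℝ))))]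
  have h1 : ∀ k ∈ Finset.range M, ‖∑ l ∈ Finset.range (M - k), phs t z (a + ((k + l : ℕ):ℝ)) * (starRingEnd ℂ) (phs t z (a + (l:ℝ)))‖ ≤ 2 * kerF N (k * t) := by
    intro k hk
    have := geom_bound N (M - k) (by omega) (-(k * t)) (Complex.exp (Complex.I * (((k:ℝ) * z - t * (k:ℝ) ^ 2 - 2 * t * (k:ℝ) * a : ℝ) : ℂ))) (by rw [mul_comm]; exact Complex.norm_exp_ofReal_mul_I _)
    have e : kerF N (-(k*t)) = kerF N (k * t) := by simp [kerF]
    rw [e] at this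
    refine le_trans (le_of_eq ?_) this
    congr 1
    refine Finset.sum_congr rfl fun l _ => ?_
    push_cast
    have := phs_mul t z a k l
    rw [this, ← Complex.exp_nat_mul]
    push_cast
    congr 2
    ring
  have h2 := (Complex.re_le_norm _).trans ((norm_sum_le _ _).trans (Finset.sum_le_sum h1))
  have h3 : ∑ k ∈ Finset.range M, 2 * kerF N (k * t) ≤ ∑ k ∈ Finset.range N, 2 * kerF N (k * t) :=
    Finset.sum_le_sum_of_subset_of_nonneg (Finset.range_mono h) (fun _ _ _ => by have := kerF_nonneg N; exact mul_nonneg (by norm_num) (this _))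
  refine (mul_le_mul_of_nonneg_left (h2.trans h3) (by norm_num)).trans (le_of_eq ?_)
  unfold weylW
  rw [Finset.mul_sum]
  refine Finset.sum_congr rfl fun l _ => by ring

lemma abel_s6 (a : ℕ → ℝ) (ha : Antitone a) (ha0 : ∀ i, 0 ≤ a i) (z : ℕ → ℂ) (B : ℝ) (M : ℕ)
    (hB : ∀ m ≤ M, ‖∑ i ∈ Finset.range m, z i‖ ≤ B) :
    ‖∑ i ∈ Finset.range M, (a i : ℂ) * z i‖ ≤ a 0 * B := by
  have key : ∀ m ≤ M, ‖∑ i ∈ Finset.range m, (a i : ℂ) * z i - a m * ∑ i ∈ Finset.range m, z i‖ ≤ (a 0 - a m) * B := by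
    intro m
    induction m with
    | zero => simp
    | succ m ih =>
      intro hm
      have e : ∑ i ∈ Finset.range (m+1), (a i : ℂ) * z i - a (m+1) * ∑ i ∈ Finset.range (m+1), z i
        = (∑ i ∈ Finset.range m, (a i : ℂ) * z i - a m * ∑ i ∈ Finset.range m, z i) + ((a m - a (m+1) : ℝ) : ℂ) * ∑ i ∈ Finset.range (m+1), z i := by
        rw [Finset.sum_range_succ, Finset.sum_range_succ]; push_cast; ring
      rw [e]
      refine (norm_add_le _ _).trans ?_
      have h0 : 0 ≤ a m - a (m+1) := sub_nonneg.2 (ha (Nat.le_succ m))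
      rw [norm_mul, Complex.norm_real, Real.norm_of_nonneg h0]
      have := mul_le_mul_of_nonneg_left (hB (m+1) hm) h0
      have := ih (by omega)
      linarith
  have h1 := key M le_rfl
  have h2 := hB M le_rfl
  have h3 := norm_add_le (∑ i ∈ Finset.range M, (a i : ℂ) * z i - a M * ∑ i ∈ Finset.range M, z i) (a M * ∑ i ∈ Finset.range M, z i)
  rw [sub_add_cancel, norm_mul, Complex.norm_real, Real.norm_of_nonneg (ha0 M)] at h3
  have := mul_le_mul_of_nonneg_left h2 (ha0 M)
  linarith

lemma kerF_cont (N : ℕ) : Continuous (kerF N) := by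
  unfold kerF
  refine Continuous.div (by fun_prop) (by fun_prop) (fun s => by positivity)

lemma kerF_int_base (N : ℕ) : ∫ s in (-(Real.pi/2))..(Real.pi/2), kerF N s ≤ Real.pi * Real.log (1 + N) := by
  have hpi := Real.pi_pos
  have ii : ∀ a b, IntervalIntegrable (kerF N) volume a b := fun a b => (kerF_cont N).intervalIntegrable a b
  have hd : ∀ x ∈ Set.uIcc 0 (Real.pi/2), HasDerivAt (fun x : ℝ => Real.pi / 2 * Real.log (1 + N * (2 / Real.pi * x))) (N / (1 + N * (2 / Real.pi * x))) x := by
    intro x hx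
    rw [Set.uIcc_of_le (by positivity)] at hx
    have hx0 := hx.1
    have hne : (1 + N * (2 / Real.pi * x)) ≠ 0 := by positivity
    have h1 : HasDerivAt (fun x : ℝ => 1 + N * (2 / Real.pi * x)) (N * (2 / Real.pi * 1)) x :=
      (((hasDerivAt_id x).const_mul _).const_mul _).const_add _
    have := (h1.log hne).const_mul (Real.pi / 2)
    refine this.congr_deriv ?_
    rw [mul_one, ← mul_div_assoc]
    congr 1
    field_simp
  have hcont : ContinuousOn (fun x : ℝ => (N:ℝ) / (1 + N * (2 / Real.pi * x))) (Set.uIcc 0 (Real.pi/2)) := by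
    refine ContinuousOn.div (by fun_prop) (by fun_prop) ?_
    intro x hx
    rw [Set.uIcc_of_le (by positivity)] at hx
    have hx0 := hx.1
    positivity
  have hhalf : ∫ s in (0:ℝ)..(Real.pi/2), kerF N s ≤ Real.pi / 2 * Real.log (1 + N) := by
    have e := intervalIntegral.integral_eq_sub_of_hasDerivAt hd hcont.intervalIntegrable
    have e2 : Real.pi / 2 * Real.log (1 + N * (2 / Real.pi * (Real.pi/2))) - Real.pi / 2 * Real.log (1 + N * (2 / Real.pi * 0)) = Real.pi / 2 * Real.log (1 + N) := by
      have : 2 / Real.pi * (Real.pi/2) = 1 := by field_simp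
      rw [this]; simp
    rw [e2] at e
    rw [← e]
    refine intervalIntegral.integral_mono_on (by positivity) (ii _ _) hcont.intervalIntegrable ?_
    intro x hx
    unfold kerF
    have h0 := hx.1
    have h3 := Real.mul_le_sin hx.1 hx.2
    have h4 : 2 / Real.pi * x ≤ |Real.sin x| := h3.trans (le_abs_self _)
    gcongr
  have hneg : ∫ s in (-(Real.pi/2))..0, kerF N s = ∫ s in (0:ℝ)..(Real.pi/2), kerF N s := by
    have := intervalIntegral.integral_comp_neg (f := kerF N) (a := 0) (b := Real.pi/2)
    rw [neg_zero] at this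
    rw [← this]
    congr 1; ext x; simp [kerF]
  rw [← intervalIntegral.integral_add_adjacent_intervals (ii _ 0) (ii 0 _), hneg]
  linarith

lemma kerF_int (N : ℕ) (m h : ℕ) (hh : 0 < h) :
    ∫ t in (-(m * Real.pi))..(m * Real.pi), kerF N (h * t) ≤ 2 * m * (Real.pi * Real.log (1 + N)) := by
  have ii : ∀ a b, IntervalIntegrable (kerF N) volume a b := fun a b => (kerF_cont N).intervalIntegrable a b
  have hper : Function.Periodic (kerF N) Real.pi := by intro x; simp [kerF, Real.sin_add_pi]
  have hh' : (h:ℝ) ≠ 0 := by positivity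
  rw [intervalIntegral.integral_comp_mul_left _ hh']
  have := hper.intervalIntegral_add_zsmul_eq (2 * h * m : ℤ) (h * (-(m*Real.pi))) ii
  have e : (h:ℝ) * (-(m*Real.pi)) + (2 * h * m : ℤ) • Real.pi = h * (m * Real.pi) := by
    rw [zsmul_eq_mul]; push_cast; ring
  rw [e] at this
  rw [this, hper.intervalIntegral_add_eq _ (-(Real.pi/2))]
  have e2 : -(Real.pi/2) + Real.pi = Real.pi/2 := by ring
  rw [e2, zsmul_eq_mul, smul_eq_mul]
  push_cast
  have := kerF_int_base N
  calc (h:ℝ)⁻¹ * (2 * h * m * ∫ s in (-(Real.pi/2))..(Real.pi/2), kerF N s)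
      = 2 * m * ∫ s in (-(Real.pi/2))..(Real.pi/2), kerF N s := by field_simp
    _ ≤ _ := by gcongr

lemma weylW_cont (N : ℕ) : Continuous (weylW N) := by
  unfold weylW
  have := kerF_cont N
  fun_prop

lemma weylW_nonneg (N : ℕ) (t : ℝ) : 0 ≤ weylW N t :=
  Finset.sum_nonneg fun h _ => mul_nonneg (by norm_num) (kerF_nonneg _ _)

lemma weylW_int (k m : ℕ) :
    ∫ t in (-(m * Real.pi))..(m * Real.pi), weylW (2 ^ k) t ≤ 16 * m * Real.pi * (2 ^ k * (k + 1)) := by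
  set N := 2 ^ k with hN
  have hc := kerF_cont N
  have hpi := Real.pi_pos
  have hint : ∀ h : ℕ, IntervalIntegrable (fun t : ℝ => 4 * kerF N (h * t)) volume (-(m * Real.pi)) (m * Real.pi) := by
    intro h; apply Continuous.intervalIntegrable; fun_prop
  unfold weylW
  rw [intervalIntegral.integral_finsetSum (fun h _ => hint h)]
  have hlog : Real.log (1 + (N:ℝ)) ≤ k + 1 := by
    have h1 : (1:ℝ) + N ≤ 2 ^ (k+1) := by
      have : 1 ≤ 2 ^ k := Nat.one_le_two_pow
      have : 1 + N ≤ 2 ^ (k+1) := by rw [pow_succ]; omega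
      exact_mod_cast this
    have h2 := Real.log_le_log (by positivity) h1
    rw [Real.log_pow] at h2
    have h3 := Real.log_two_lt_d9
    push_cast at h2
    nlinarith [Real.log_pos one_lt_two, (Nat.cast_nonneg k : (0:ℝ) ≤ k)]
  have hN0 : N = (N - 1) + 1 := by have : 0 < N := by positivity
                                   omega
  have hNr : ((2:ℝ) ^ k) = N := by simp [hN]
  have hb : ∀ h ∈ Finset.range (N-1), ∫ t in (-(m * Real.pi))..(m * Real.pi), 4 * kerF N ((h+1 : ℕ) * t) ≤ 8 * m * Real.pi * (k+1) := by
    intro h _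
    rw [intervalIntegral.integral_const_mul]
    have := kerF_int N m (h+1) (by omega)
    have h2 : 2 * m * (Real.pi * Real.log (1 + (N:ℝ))) ≤ 2 * m * (Real.pi * (k+1)) := by gcongr
    linarith
  have hz : ∫ t in (-(m * Real.pi))..(m * Real.pi), 4 * kerF N ((0:ℕ) * t) = 8 * m * Real.pi * N := by
    simp [kerF]; ring
  have hs := Finset.sum_le_sum hb
  have e := Finset.sum_range_succ' (fun h : ℕ => ∫ t in (-(m * Real.pi))..(m * Real.pi), 4 * kerF N (h * t)) (N-1)
  rw [← hN0] at e
  rw [e, hz, hNr]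
  refine (add_le_add_left hs _).trans ?_
  rw [Finset.sum_const, Finset.card_range, nsmul_eq_mul]
  have h5 : ((N-1 : ℕ):ℝ) ≤ N := by exact_mod_cast Nat.sub_le _ _
  have h6 : ((N-1 : ℕ):ℝ) * (8 * m * Real.pi * (k+1)) ≤ N * (8 * m * Real.pi * (k+1)) := by gcongr
  have h7 : 0 ≤ 8 * m * Real.pi * N * k := by positivity
  nlinarith

lemma ae_weyl : ∀ᵐ t : ℝ, ∃ C : ℝ, 0 ≤ C ∧ ∀ k : ℕ, weylW (2 ^ k) t ≤ C ^ 2 * (2 ^ k * (k + 1) ^ 4) := by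
  have main : ∀ m : ℕ, ∀ᵐ t : ℝ, t ∈ Set.Ioc (-(m * Real.pi)) (m * Real.pi) →
      ∃ C : ℝ, 0 ≤ C ∧ ∀ k : ℕ, weylW (2 ^ k) t ≤ C ^ 2 * (2 ^ k * (k + 1) ^ 4) := by
    intro m
    rw [← ae_restrict_iff' measurableSet_Ioc]
    set f : ℕ → ℝ → ENNReal := fun k t => ENNReal.ofReal (weylW (2 ^ k) t / (2 ^ k * (k + 1) ^ 4)) with hf
    have hfm : ∀ k, Measurable (f k) := fun k =>
      ENNReal.measurable_ofReal.comp ((weylW_cont _).measurable.div_const _)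
    have hpi := Real.pi_pos
    have hsm : Summable (fun k : ℕ => 16 * m * Real.pi * (1 / ((k:ℝ) + 1) ^ 3)) := by
      have := (summable_nat_add_iff 1).2 (Real.summable_one_div_nat_pow.2 (by norm_num : 1 < 3))
      push_cast at this
      exact this.mul_left _
    have hle : ∀ k, ∫⁻ t in Set.Ioc (-(m * Real.pi)) (m * Real.pi), f k t ≤ ENNReal.ofReal (16 * m * Real.pi * (1 / ((k:ℝ) + 1) ^ 3)) := by
      intro k
      rw [← ofReal_integral_eq_lintegral_ofReal]
      · apply ENNReal.ofReal_le_ofReal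
        rw [integral_div, ← intervalIntegral.integral_of_le (by nlinarith [(Nat.cast_nonneg m : (0:ℝ) ≤ m)])]
        rw [div_le_iff₀ (by positivity)]
        refine (weylW_int k m).trans (le_of_eq ?_)
        field_simp
      · exact ((weylW_cont _).div_const _).integrableOn_Ioc
      · exact Filter.Eventually.of_forall fun t => div_nonneg (weylW_nonneg _ _) (by positivity)
    have hfin : ∫⁻ t in Set.Ioc (-(m * Real.pi)) (m * Real.pi), ∑' k, f k t ≠ ⊤ := by
      rw [lintegral_tsum (fun k => (hfm k).aemeasurable)]
      refine ne_top_of_le_ne_top ?_ (ENNReal.tsum_le_tsum hle)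
      exact hsm.tsum_ofReal_ne_top
    have := ae_lt_top (Measurable.tsum hfm) hfin
    filter_upwards [this] with t ht
    refine ⟨Real.sqrt (∑' k, f k t).toReal, Real.sqrt_nonneg _, fun k => ?_⟩
    rw [Real.sq_sqrt ENNReal.toReal_nonneg, ← div_le_iff₀ (by positivity)]
    have h1 := ENNReal.toReal_mono ht.ne (ENNReal.le_tsum (f := fun k => f k t) k)
    rwa [hf, ENNReal.toReal_ofReal (div_nonneg (weylW_nonneg _ _) (by positivity))] at h1
  have := ae_all_iff.2 main
  filter_upwards [this] with t ht
  obtain ⟨m, hm⟩ := exists_nat_gt (|t| / Real.pi)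
  rw [div_lt_iff₀ Real.pi_pos] at hm
  have := abs_lt.1 hm
  exact ht m ⟨this.1, this.2.le⟩

lemma bv_phi (g : ℝ → ℂ) (c : ℝ) (hc : 0 ≤ c) (hbv : BoundedVariationOn g (Set.Icc 0 c)) :
    ∃ φ : ℝ → ℝ, ∀ x y, 0 ≤ x → x ≤ y → y ≤ c → ‖g y - g x‖ ≤ φ y - φ x := by
  refine ⟨fun x => variationOnFromTo g (Set.Icc 0 c) 0 x, fun x y hx hxy hy => ?_⟩
  have h0 : (0:ℝ) ∈ Set.Icc 0 c := ⟨le_rfl, hc⟩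
  have hxm : x ∈ Set.Icc 0 c := ⟨hx, hxy.trans hy⟩
  have hym : y ∈ Set.Icc 0 c := ⟨hx.trans hxy, hy⟩
  have hl := hbv.locallyBoundedVariationOn
  have := variationOnFromTo.add hl h0 hxm hym
  have h1 : variationOnFromTo g (Set.Icc 0 c) 0 y - variationOnFromTo g (Set.Icc 0 c) 0 x = variationOnFromTo g (Set.Icc 0 c) x y := by linarith
  show _ ≤ variationOnFromTo g (Set.Icc 0 c) 0 y - variationOnFromTo g (Set.Icc 0 c) 0 x
  rw [h1, variationOnFromTo.eq_of_le _ _ hxy, ← dist_eq_norm]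
  exact (hl _ _ hxm hym).dist_le ⟨hym, hxy, le_rfl⟩ ⟨hxm, le_rfl, hxy⟩

lemma bv_integrable (g : ℝ → ℂ) (c : ℝ) (hc : 0 ≤ c) (hbv : BoundedVariationOn g (Set.Icc 0 c)) :
    IntervalIntegrable g volume 0 c := by
  have key : ∀ f : ℝ → ℝ, BoundedVariationOn f (Set.Icc 0 c) → IntervalIntegrable f volume 0 c := by
    intro f hf
    obtain ⟨p, q, hp, hq, rfl⟩ := hf.locallyBoundedVariationOn.exists_monotoneOn_sub_monotoneOn
    rw [← Set.uIcc_of_le hc] at hp hq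
    exact hp.intervalIntegrable.sub hq.intervalIntegrable
  have h1 := key (fun x => (g x).re) (Complex.reCLM.lipschitz.comp_boundedVariationOn hbv)
  have h2 := key (fun x => (g x).im) (Complex.imCLM.lipschitz.comp_boundedVariationOn hbv)
  have h3 : IntervalIntegrable (fun x => ((g x).re : ℂ) + ((g x).im : ℂ) * Complex.I) volume 0 c := by
    refine IntervalIntegrable.add ?_ (IntervalIntegrable.mul_const ?_ _)
    · rw [intervalIntegrable_iff] at *; exact h1.ofReal
    · rw [intervalIntegrable_iff] at *; exact h2.ofReal
  simpa [Complex.re_add_im] using h3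

lemma bv_ibp (g : ℝ → ℂ) (c : ℝ) (hc : 0 < c) (hbv : BoundedVariationOn g (Set.Icc 0 c)) :
    ∃ K : ℝ, 0 ≤ K ∧ ∀ (F F' : ℝ → ℂ) (B : ℝ), (∀ x, HasDerivAt F (F' x) x) → Continuous F' →
      (∀ x, ‖F x‖ ≤ B) → ‖∫ x in (0:ℝ)..c, F' x * g x‖ ≤ K * B := by
  obtain ⟨φ, hφ⟩ := bv_phi g c hc.le hbv
  have hg := bv_integrable g c hc.le hbv
  have hφ0 : 0 ≤ φ c - φ 0 := (norm_nonneg _).trans (hφ 0 c le_rfl hc.le le_rfl)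
  refine ⟨(φ c - φ 0) + (‖g c‖ + ‖g 0‖), by positivity, fun F F' B hF hF' hB => ?_⟩
  have hB0 : 0 ≤ B := (norm_nonneg _).trans (hB 0)
  obtain ⟨D, hD⟩ := (isCompact_Icc (a := (0:ℝ)) (b := c)).exists_bound_of_continuousOn hF'.continuousOn
  have hD0 : 0 ≤ D := (norm_nonneg _).trans (hD 0 ⟨le_rfl, hc.le⟩)
  have hFg : ∀ a b, 0 ≤ a → a ≤ b → b ≤ c → IntervalIntegrable (fun x => F' x * g x) volume a b := by
    intro a b ha hab hb
    refine IntervalIntegrable.continuousOn_mul ?_ hF'.continuousOn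
    refine hg.mono_set ?_
    rw [Set.uIcc_of_le hab, Set.uIcc_of_le hc.le]
    exact Set.Icc_subset_Icc ha hb
  have piece : ∀ a b, 0 ≤ a → a ≤ b → b ≤ c →
      ‖(∫ x in a..b, F' x * g x) - (F b * g b - F a * g a)‖ ≤ (B + D * (b - a)) * (φ b - φ a) := by
    intro a b ha hab hb
    have e1 : ∫ x in a..b, F' x = F b - F a :=
      intervalIntegral.integral_eq_sub_of_hasDerivAt (fun x _ => hF x) (hF'.intervalIntegrable _ _)
    have e2 : ∫ x in a..b, F' x * (g x - g a) = (∫ x in a..b, F' x * g x) - (F b - F a) * g a := by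
      rw [← e1, ← intervalIntegral.integral_mul_const, ← intervalIntegral.integral_sub (hFg a b ha hab hb)]
      · congr 1; ext x; ring
      · exact (hF'.intervalIntegrable _ _).mul_const _
    have e3 : ‖∫ x in a..b, F' x * (g x - g a)‖ ≤ (D * (φ b - φ a)) * |b - a| := by
      refine intervalIntegral.norm_integral_le_of_norm_le_const fun x hx => ?_
      rw [Set.uIoc_of_le hab] at hx
      rw [norm_mul]
      have h1 := hφ a x ha hx.1.le (hx.2.trans hb)
      have h2 := (norm_nonneg _).trans (hφ x b (ha.trans hx.1.le) hx.2 hb)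
      exact mul_le_mul (hD x ⟨ha.trans hx.1.le, hx.2.trans hb⟩) (by linarith) (norm_nonneg _) hD0
    have e4 : (∫ x in a..b, F' x * g x) - (F b * g b - F a * g a) = (∫ x in a..b, F' x * (g x - g a)) - F b * (g b - g a) := by
      rw [e2]; ring
    rw [e4]
    refine (norm_sub_le _ _).trans ?_
    rw [norm_mul]
    rw [abs_of_nonneg (by linarith)] at e3
    have := mul_le_mul (hB b) (hφ a b ha hab hb) (norm_nonneg _) hB0
    linarith
  have tot : ∀ m : ℕ, ‖(∫ x in (0:ℝ)..c, F' x * g x) - (F c * g c - F 0 * g 0)‖ ≤ (B + D * (c * (1 / ((m:ℝ)+1)))) * (φ c - φ 0) := by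
    intro m
    set a : ℕ → ℝ := fun i => c * (i / ((m:ℝ)+1)) with ha
    have hm : (0:ℝ) < m + 1 := by positivity
    have ha0 : ∀ i, 0 ≤ a i := fun i => by positivity
    have hmono : ∀ i, a i ≤ a (i+1) := fun i => by simp only [ha]; push_cast; gcongr; linarith
    have hac : ∀ i, i < m + 1 → a (i+1) ≤ c := by
      intro i hi
      have : ((i+1:ℕ):ℝ) ≤ m + 1 := by exact_mod_cast hi
      have : ((i+1:ℕ):ℝ) / (m + 1) ≤ 1 := (div_le_one hm).2 this
      simp only [ha]; nlinarith
    have hdiff : ∀ i, a (i+1) - a i = c * (1 / ((m:ℝ)+1)) := fun i => by simp only [ha]; push_cast; field_simp; ring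
    have s1 := intervalIntegral.sum_integral_adjacent_intervals (μ := volume) (f := fun x => F' x * g x) (a := a) (n := m+1)
      (fun i hi => hFg _ _ (ha0 i) (hmono i) (hac i hi))
    have s2 := Finset.sum_range_sub (fun i => F (a i) * g (a i)) (m+1)
    have s3 := Finset.sum_range_sub (fun i => φ (a i)) (m+1)
    have az : a 0 = 0 := by simp [ha]
    have al : a (m+1) = c := by simp only [ha]; push_cast; field_simp
    rw [az, al] at s1 s2 s3
    rw [← s1, ← s2, ← s3, ← Finset.sum_sub_distrib, Finset.mul_sum]
    refine (norm_sum_le _ _).trans (Finset.sum_le_sum fun i hi => ?_)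
    have := piece _ _ (ha0 i) (hmono i) (hac i (Finset.mem_range.1 hi))
    rwa [hdiff] at this
  have lim : ‖(∫ x in (0:ℝ)..c, F' x * g x) - (F c * g c - F 0 * g 0)‖ ≤ (B + D * (c * 0)) * (φ c - φ 0) := by
    refine ge_of_tendsto' (((tendsto_one_div_add_atTop_nhds_zero_nat.const_mul c).const_mul D).const_add B |>.mul_const _) tot
  have h3 := norm_add_le ((∫ x in (0:ℝ)..c, F' x * g x) - (F c * g c - F 0 * g 0)) (F c * g c - F 0 * g 0)
  rw [sub_add_cancel] at h3
  have h4 := norm_sub_le (F c * g c) (F 0 * g 0)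
  rw [norm_mul, norm_mul] at h4
  have h5 := mul_le_mul_of_nonneg_right (hB c) (norm_nonneg (g c))
  have h6 := mul_le_mul_of_nonneg_right (hB 0) (norm_nonneg (g 0))
  nlinarith

lemma fc_bound (g : ℝ → ℂ) (hbv : BoundedVariationOn g (Set.Icc 0 (2 * Real.pi))) :
    ∃ K : ℝ, 0 ≤ K ∧ ∀ (M : ℕ) (ν : ℕ → ℤ) (c : ℕ → ℂ) (B : ℝ),
      (∀ y : ℝ, ‖∑ j ∈ Finset.range M, c j * Complex.exp (-Complex.I * (ν j : ℂ) * (y : ℂ))‖ ≤ B) →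
      ‖∑ j ∈ Finset.range M, (ν j : ℂ) * c j * fourierCoef g (ν j)‖ ≤ K * B := by
  have hpi := Real.pi_pos
  obtain ⟨K, hK, h⟩ := bv_ibp g (2 * Real.pi) (by positivity) hbv
  have hg := bv_integrable g (2 * Real.pi) (by positivity) hbv
  refine ⟨K / (2 * Real.pi), by positivity, fun M ν c B hB => ?_⟩
  have := h (fun y => ∑ j ∈ Finset.range M, c j * Complex.exp (-Complex.I * (ν j : ℂ) * (y : ℂ)))
    (fun y => ∑ j ∈ Finset.range M, c j * (Complex.exp (-Complex.I * (ν j : ℂ) * (y : ℂ)) * (-Complex.I * (ν j : ℂ)))) B ?_ (by fun_prop) hB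
  · have e : ∫ x in (0:ℝ)..(2 * Real.pi), (∑ j ∈ Finset.range M, c j * (Complex.exp (-Complex.I * (ν j : ℂ) * (x : ℂ)) * (-Complex.I * (ν j : ℂ)))) * g x
       = (-Complex.I * (2 * Real.pi)) * ∑ j ∈ Finset.range M, (ν j : ℂ) * c j * fourierCoef g (ν j) := by
      simp_rw [Finset.sum_mul]
      rw [intervalIntegral.integral_finsetSum]
      · rw [Finset.mul_sum]
        refine Finset.sum_congr rfl fun j _ => ?_
        unfold fourierCoef
        have hpc : (Real.pi : ℂ) ≠ 0 := by exact_mod_cast hpi.ne'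
        have e1 : ∀ x : ℝ, c j * (Complex.exp (-Complex.I * (ν j : ℂ) * (x : ℂ)) * (-Complex.I * (ν j : ℂ))) * g x
          = (c j * (-Complex.I * (ν j : ℂ))) * (Complex.exp (-Complex.I * (ν j : ℂ) * (x : ℂ)) * g x) := fun x => by ring
        simp_rw [e1]
        rw [intervalIntegral.integral_const_mul]
        field_simp
      · intro j _
        exact IntervalIntegrable.continuousOn_mul hg (Continuous.continuousOn (by fun_prop))
    rw [e, norm_mul] at this
    have e2 : ‖(-Complex.I * (2 * Real.pi) : ℂ)‖ = 2 * Real.pi := by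
      simp [abs_of_pos hpi]
    rw [e2] at this
    rw [div_mul_eq_mul_div, le_div_iff₀ (by positivity)]
    linarith
  · intro x
    refine HasDerivAt.fun_sum fun j _ => HasDerivAt.const_mul _ ?_
    have h1 : HasDerivAt (fun y : ℝ => -Complex.I * (ν j : ℂ) * (y : ℂ)) (-Complex.I * (ν j : ℂ)) x := by
      simpa using (Complex.ofRealCLM.hasDerivAt (x := x)).const_mul (-Complex.I * (ν j : ℂ))
    exact h1.cexp

noncomputable def blk (g : ℝ → ℂ) (t : ℝ) (σ : ℤ) (k : ℕ) (x : ℝ) : ℂ :=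
  ∑ j ∈ Finset.range (2 ^ k), phs t x ((σ * (2 ^ k + j) : ℤ) : ℝ) * fourierCoef g (σ * (2 ^ k + j))

lemma phs_sign (t z m : ℝ) (σ : ℤ) (hσ : σ = 1 ∨ σ = -1) : phs t z (σ * m) = phs t (σ * z) m := by
  unfold phs
  rcases hσ with rfl | rfl <;> simp

lemma phs_shift (t x y : ℝ) (n : ℤ) :
    phs t x n * Complex.exp (-Complex.I * (n : ℂ) * (y : ℂ)) = phs t (x - y) n := by
  unfold phs
  rw [← Complex.exp_add]
  congr 1
  push_cast
  ring

lemma blk_core (t z : ℝ) (σ : ℤ) (hσ : σ = 1 ∨ σ = -1) (k M : ℕ) (hM : M ≤ 2 ^ k) (R : ℝ) (hR : 0 ≤ R)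
    (h : weylW (2 ^ k) t ≤ R ^ 2) :
    ‖∑ j ∈ Finset.range M, phs t z ((σ * (2 ^ k + j) : ℤ) : ℝ)‖ ≤ R := by
  have := (weyl_s6 t (σ * z) (2 ^ k) M (2 ^ k) hM).trans h
  refine le_trans (le_of_eq ?_) (abs_le_of_sq_le_sq' this hR).2
  congr 1
  refine Finset.sum_congr rfl fun j _ => ?_
  rw [← phs_sign t z _ σ hσ]
  push_cast; rfl

lemma phs_deriv (t n x : ℝ) : HasDerivAt (fun x => phs t x n) (Complex.I * n * phs t x n) x := by
  unfold phs
  have h1 : HasDerivAt (fun x : ℝ => Complex.I * ((n * x - t * n ^ 2 : ℝ) : ℂ)) (Complex.I * n) x := by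
    have : HasDerivAt (fun x : ℝ => n * x - t * n ^ 2) n x := by
      simpa using ((hasDerivAt_id x).const_mul n).sub_const (t * n ^ 2)
    exact this.ofReal_comp.const_mul _
  convert h1.cexp using 1
  ring

lemma blk_bounds (g : ℝ → ℂ) (hbv : BoundedVariationOn g (Set.Icc 0 (2 * Real.pi))) :
    ∃ K : ℝ, 0 ≤ K ∧ ∀ (t : ℝ) (σ : ℤ) (k : ℕ) (R : ℝ), (σ = 1 ∨ σ = -1) → 0 ≤ R →
      weylW (2 ^ k) t ≤ R ^ 2 →
      (∀ x, ‖blk g t σ k x‖ ≤ K * ((1 / 2 ^ k) * R)) ∧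
      ∀ x y, ‖blk g t σ k x - blk g t σ k y‖ ≤ K * R * |x - y| := by
  obtain ⟨K, hK, h⟩ := fc_bound g hbv
  refine ⟨K, hK, fun t σ k R hσ hR hW => ⟨fun x => ?_, fun x y => ?_⟩⟩
  · have := h (2 ^ k) (fun j => σ * (2 ^ k + j)) (fun j => ((1 / ((2:ℝ) ^ k + j) : ℝ) : ℂ) * phs t x ((σ * (2 ^ k + j) : ℤ) : ℝ)) ((1 / 2 ^ k) * R) ?_
    · refine le_trans (le_of_eq ?_) this
      have e : ∑ j ∈ Finset.range (2 ^ k), ((σ * (2 ^ k + j) : ℤ) : ℂ) * (((1 / ((2:ℝ) ^ k + j) : ℝ) : ℂ) * phs t x ((σ * (2 ^ k + j) : ℤ) : ℝ)) * fourierCoef g (σ * (2 ^ k + j)) = σ * blk g t σ k x := by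
        unfold blk
        rw [Finset.mul_sum]
        refine Finset.sum_congr rfl fun j _ => ?_
        have h0 : ((2:ℂ) ^ k + j) ≠ 0 := by
          have : ((2:ℝ) ^ k + j) ≠ 0 := by positivity
          exact_mod_cast this
        have h1 : ((σ * (2 ^ k + j) : ℤ) : ℂ) * ((1 / ((2:ℝ) ^ k + j) : ℝ) : ℂ) = σ := by
          push_cast; field_simp
        rw [← mul_assoc, h1, mul_assoc]
      rw [e, norm_mul]
      rcases hσ with rfl | rfl <;> simp
    · intro y
      have := abel_s6 (fun j => 1 / ((2:ℝ) ^ k + j)) ?_ (fun i => by positivity) (fun j => phs t (x - y) ((σ * (2 ^ k + j) : ℤ) : ℝ)) R (2 ^ k) (fun m hm => blk_core t (x - y) σ hσ k m hm R hR hW)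
      · simp only [Nat.cast_zero, add_zero] at this
        refine le_trans (le_of_eq ?_) this
        congr 1
        refine Finset.sum_congr rfl fun j _ => ?_
        rw [mul_assoc, phs_shift]
      · intro i j hij
        have : (i:ℝ) ≤ j := by exact_mod_cast hij
        dsimp only
        gcongr
  · have hd : ∀ x ∈ Set.univ, HasDerivWithinAt (blk g t σ k) (∑ j ∈ Finset.range (2 ^ k), Complex.I * ((σ * (2 ^ k + j) : ℤ) : ℝ) * phs t x ((σ * (2 ^ k + j) : ℤ) : ℝ) * fourierCoef g (σ * (2 ^ k + j))) Set.univ x := by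
      intro x _
      apply HasDerivAt.hasDerivWithinAt
      unfold blk
      exact HasDerivAt.fun_sum fun j _ => (phs_deriv _ _ _).mul_const _
    have := Convex.norm_image_sub_le_of_norm_hasDerivWithin_le (C := K * R) hd ?_ convex_univ (Set.mem_univ y) (Set.mem_univ x)
    · simpa using this
    · intro x _
      have := h (2 ^ k) (fun j => σ * (2 ^ k + j)) (fun j => phs t x ((σ * (2 ^ k + j) : ℤ) : ℝ)) R ?_
      · refine le_trans (le_of_eq ?_) this
        have e : ∑ j ∈ Finset.range (2 ^ k), Complex.I * ((σ * (2 ^ k + j) : ℤ) : ℝ) * phs t x ((σ * (2 ^ k + j) : ℤ) : ℝ) * fourierCoef g (σ * (2 ^ k + j)) = Complex.I * ∑ j ∈ Finset.range (2 ^ k), ((σ * (2 ^ k + j) : ℤ) : ℂ) * phs t x ((σ * (2 ^ k + j) : ℤ) : ℝ) * fourierCoef g (σ * (2 ^ k + j)) := by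
          rw [Finset.mul_sum]
          refine Finset.sum_congr rfl fun j _ => ?_
          rw [Complex.ofReal_intCast]
          ring
        rw [e, norm_mul, Complex.norm_I, one_mul]
      · intro y
        refine le_trans (le_of_eq ?_) (blk_core t (x - y) σ hσ k (2^k) le_rfl R hR hW)
        congr 1
        exact Finset.sum_congr rfl fun j _ => phs_shift _ _ _ _

lemma min_interp (a A s α : ℝ) (hA : 0 ≤ A) (hs : 0 ≤ s) (h1 : a ≤ A) (h2 : a ≤ A * s) (hα : 0 < α) (hα1 : α < 1) :
    a ≤ A * s ^ α := by
  rcases le_total 1 s with h | h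
  · exact h1.trans (le_mul_of_one_le_right hA (Real.one_le_rpow h hα.le))
  · refine h2.trans (mul_le_mul_of_nonneg_left ?_ hA)
    simpa using Real.rpow_le_rpow_of_exponent_ge' hs h hα.le hα1.le

lemma summ_geo (ρ : ℝ) (h0 : 0 < ρ) (h1 : ρ < 1) : Summable (fun k : ℕ => ((k:ℝ) + 1) ^ 2 * ρ ^ k) := by
  have := (summable_nat_add_iff 1).2 (summable_pow_mul_geometric_of_norm_lt_one 2 (r := ρ) (by rwa [Real.norm_of_nonneg h0.le]))
  have := this.mul_right ρ⁻¹
  refine this.congr fun k => ?_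
  push_cast
  rw [pow_succ ρ k]
  field_simp

lemma fc_exp (t : ℝ) (n m : ℤ) : (1 / (2 * Real.pi) : ℂ) * ∫ x in (0:ℝ)..(2 * Real.pi), Complex.exp (-Complex.I * (n : ℂ) * (x : ℂ)) * phs t x m =
    if m = n then Complex.exp (-Complex.I * (t : ℂ) * (n : ℂ) ^ 2) else 0 := by
  have hpc : (Real.pi : ℂ) ≠ 0 := by exact_mod_cast Real.pi_pos.ne'
  have e : ∀ x : ℝ, Complex.exp (-Complex.I * (n : ℂ) * (x : ℂ)) * phs t x m = Complex.exp (-Complex.I * (t : ℂ) * (m : ℂ) ^ 2) * Complex.exp ((Complex.I * ((m - n : ℤ) : ℂ)) * (x : ℂ)) := by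
    intro x
    unfold phs
    rw [← Complex.exp_add, ← Complex.exp_add]
    congr 1
    push_cast
    ring
  simp_rw [e]
  rw [intervalIntegral.integral_const_mul]
  split_ifs with h
  · subst h
    simp
    field_simp
  · have h1 : (Complex.I * ((m - n : ℤ) : ℂ)) ≠ 0 := by
      refine mul_ne_zero Complex.I_ne_zero ?_
      exact_mod_cast sub_ne_zero.2 h
    rw [integral_exp_mul_complex h1]
    have h2 : Complex.exp (Complex.I * ((m - n : ℤ) : ℂ) * ((2 * Real.pi : ℝ) : ℂ)) = 1 := by
      rw [Complex.exp_eq_one_iff]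
      exact ⟨m - n, by push_cast; ring⟩
    rw [h2]
    simp

lemma blk_cont (g : ℝ → ℂ) (t : ℝ) (σ : ℤ) (k : ℕ) : Continuous (blk g t σ k) := by
  unfold blk phs
  fun_prop

lemma phs_per (t x : ℝ) (n : ℤ) : phs t (x + 2 * Real.pi) n = phs t x n := by
  unfold phs
  rw [Complex.exp_eq_exp_iff_exists_int]
  exact ⟨n, by push_cast; ring⟩

lemma blk_per (g : ℝ → ℂ) (t : ℝ) (σ : ℤ) (k : ℕ) (x : ℝ) : blk g t σ k (x + 2 * Real.pi) = blk g t σ k x := by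
  unfold blk
  simp_rw [phs_per]

lemma fc_blk (g : ℝ → ℂ) (t : ℝ) (σ : ℤ) (k : ℕ) (n : ℤ) :
    fourierCoef (blk g t σ k) n = ∑ j ∈ Finset.range (2 ^ k), if σ * (2 ^ k + j) = n then
      Complex.exp (-Complex.I * (t : ℂ) * (n : ℂ) ^ 2) * fourierCoef g n else 0 := by
  have e : ∀ x : ℝ, Complex.exp (-Complex.I * (n : ℂ) * (x : ℂ)) * blk g t σ k x =
      ∑ j ∈ Finset.range (2 ^ k), (Complex.exp (-Complex.I * (n : ℂ) * (x : ℂ)) * phs t x ((σ * (2 ^ k + j) : ℤ) : ℝ)) * fourierCoef g (σ * (2 ^ k + j)) := by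
    intro x
    unfold blk
    rw [Finset.mul_sum]
    exact Finset.sum_congr rfl fun j _ => by ring
  conv_lhs => unfold fourierCoef
  simp_rw [e]
  rw [intervalIntegral.integral_finsetSum]
  · rw [Finset.mul_sum]
    refine Finset.sum_congr rfl fun j _ => ?_
    rw [intervalIntegral.integral_mul_const, ← mul_assoc, fc_exp]
    split_ifs with h
    · rw [h]
    · simp
  · intro j _
    apply Continuous.intervalIntegrable
    unfold phs
    fun_prop

lemma fc_blk2 (g : ℝ → ℂ) (t : ℝ) (k : ℕ) (n : ℤ) :
    fourierCoef (blk g t 1 k) n + fourierCoef (blk g t (-1) k) n = if n ≠ 0 ∧ Nat.log 2 n.natAbs = k then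
      Complex.exp (-Complex.I * (t : ℂ) * (n : ℂ) ^ 2) * fourierCoef g n else 0 := by
  rw [fc_blk, fc_blk]
  set c := Complex.exp (-Complex.I * (t : ℂ) * (n : ℂ) ^ 2) * fourierCoef g n
  have hp : (0:ℤ) < 2 ^ k := by positivity
  have hsum : ∀ σ : ℤ, (σ = 1 ∨ σ = -1) → ∑ j ∈ Finset.range (2 ^ k), (if σ * (2 ^ k + j) = n then c else 0) =
      if (2:ℤ) ^ k ≤ σ * n ∧ σ * n < 2 ^ (k+1) then c else 0 := by
    intro σ hσ
    have hiff : ∀ j : ℕ, σ * (2 ^ k + j) = n ↔ (2:ℤ) ^ k + j = σ * n := by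
      intro j; rcases hσ with rfl | rfl <;> constructor <;> intro h <;> linarith
    simp_rw [hiff]
    split_ifs with h
    · obtain ⟨h1, h2⟩ := h
      rw [pow_succ] at h2
      rw [Finset.sum_eq_single (σ * n - 2 ^ k).toNat]
      · rw [if_pos]
        rw [Int.toNat_of_nonneg (by linarith)]; ring
      · intro b _ hb
        rw [if_neg]
        intro h
        apply hb
        rw [← h]; simp
      · intro hn
        exfalso; apply hn
        rw [Finset.mem_range]
        zify
        rw [Int.toNat_of_nonneg (by linarith)]
        linarith
    · apply Finset.sum_eq_zero
      intro j hj
      rw [if_neg]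
      intro h3
      apply h
      rw [← h3, pow_succ]
      have : (j:ℤ) < 2 ^ k := by exact_mod_cast Finset.mem_range.1 hj
      constructor <;> linarith [(Int.natCast_nonneg j)]
  rw [hsum 1 (Or.inl rfl), hsum (-1) (Or.inr rfl)]
  have hlog : (n ≠ 0 ∧ Nat.log 2 n.natAbs = k) ↔ (2:ℤ) ^ k ≤ |n| ∧ |n| < 2 ^ (k+1) := by
    constructor
    · rintro ⟨h0, h⟩
      rw [Nat.log_eq_iff (Or.inr ⟨by norm_num, by simpa using h0⟩)] at h
      rw [Int.abs_eq_natAbs]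
      exact_mod_cast h
    · intro h
      have h0 : n ≠ 0 := by rintro rfl; rw [abs_zero] at h; linarith [h.1]
      refine ⟨h0, ?_⟩
      rw [Nat.log_eq_iff (Or.inr ⟨by norm_num, by simpa using h0⟩)]
      rw [Int.abs_eq_natAbs] at h
      exact_mod_cast h
  simp only [hlog]
  rcases le_total 0 n with h | h
  · rw [abs_of_nonneg h]
    have : ¬ ((2:ℤ) ^ k ≤ -1 * n ∧ -1 * n < 2 ^ (k+1)) := by intro h'; linarith [h'.1]
    simp only [if_neg this, one_mul, add_zero]
  · rw [abs_of_nonpos h]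
    have : ¬ ((2:ℤ) ^ k ≤ 1 * n ∧ 1 * n < 2 ^ (k+1)) := by intro h'; linarith [h'.1]
    simp only [if_neg this, neg_one_mul, zero_add]

lemma fc_add (u v : ℝ → ℂ) (hu : Continuous u) (hv : Continuous v) (n : ℤ) :
    fourierCoef (fun x => u x + v x) n = fourierCoef u n + fourierCoef v n := by
  unfold fourierCoef
  simp_rw [mul_add]
  rw [intervalIntegral.integral_add, mul_add]
  · exact Continuous.intervalIntegrable (by fun_prop) _ _
  · exact Continuous.intervalIntegrable (by fun_prop) _ _

lemma fc_const (c : ℂ) (n : ℤ) : fourierCoef (fun _ => c) n = if n = 0 then c else 0 := by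
  have := fc_exp 0 n 0
  unfold fourierCoef
  rw [intervalIntegral.integral_mul_const, ← mul_assoc]
  simp only [phs] at this
  simp only [Int.cast_zero, zero_mul, sub_self, Complex.ofReal_zero, mul_zero, Complex.exp_zero, mul_one] at this
  rw [this]
  by_cases h : n = 0
  · simp [h]
  · simp [h, Ne.symm h]

/-- If `g : 𝕋 → ℂ` has bounded variation, then for almost every `t` the solution
`e^{it∂ₓₓ}g` of the linear Schrödinger equation (the function with Fourier coefficients
`e^{-itn²} ĝ(n)`) has a representative which is `α`-Hölder continuous for every `0 < α < 1/2`. -/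
theorem linear_schrodinger_holder (g : ℝ → ℂ)
    (hper : Function.Periodic g (2 * Real.pi))
    (hbv : BoundedVariationOn g (Set.Icc 0 (2 * Real.pi))) :
    ∀ᵐ t : ℝ, ∃ u : ℝ → ℂ, Function.Periodic u (2 * Real.pi) ∧
      (∀ n : ℤ, fourierCoef u n =
        Complex.exp (-Complex.I * (t : ℂ) * (n : ℂ) ^ 2) * fourierCoef g n) ∧
      ∀ α : ℝ, 0 < α → α < 1 / 2 →
        ∃ C : ℝ, ∀ x y : ℝ, ‖u x - u y‖ ≤ C * |x - y| ^ α := by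
  obtain ⟨K, hK, hblk⟩ := blk_bounds g hbv
  filter_upwards [ae_weyl] with t ht
  obtain ⟨C, hC, hW⟩ := ht
  set q := Real.sqrt 2 with hq
  have hq0 : 0 < q := Real.sqrt_pos.2 (by norm_num)
  have hqq : q * q = 2 := Real.mul_self_sqrt (by norm_num)
  have hq1 : 1 < q := by nlinarith
  have hR : ∀ k : ℕ, weylW (2 ^ k) t ≤ (C * (q ^ k * ((k:ℝ) + 1) ^ 2)) ^ 2 := by
    intro k
    refine (hW k).trans (le_of_eq ?_)
    rw [← hqq, mul_pow q q k]; ring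
  have hR0 : ∀ k : ℕ, 0 ≤ C * (q ^ k * ((k:ℝ) + 1) ^ 2) := fun k => by positivity
  have hhalf : ∀ k : ℕ, (1 / 2 ^ k : ℝ) * q ^ k = q⁻¹ ^ k := by
    intro k
    rw [← hqq, mul_pow q q k, inv_pow]; field_simp
  set w : ℕ → ℝ → ℂ := fun k x => blk g t 1 k x + blk g t (-1) k x with hw
  set A : ℕ → ℝ := fun k => 2 * K * C * (((k:ℝ) + 1) ^ 2 * q⁻¹ ^ k) with hA
  have hA0 : ∀ k, 0 ≤ A k := fun k => by positivity
  have hb1 : ∀ k x, ‖w k x‖ ≤ A k := by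
    intro k x
    have h1 := (hblk t 1 k _ (Or.inl rfl) (hR0 k) (hR k)).1 x
    have h2 := (hblk t (-1) k _ (Or.inr rfl) (hR0 k) (hR k)).1 x
    refine (norm_add_le _ _).trans ((add_le_add h1 h2).trans (le_of_eq ?_))
    simp only [hA]
    rw [← hhalf]; ring
  have hb2 : ∀ k x y, ‖w k x - w k y‖ ≤ A k * (2 ^ k * |x - y|) := by
    intro k x y
    have h1 := (hblk t 1 k _ (Or.inl rfl) (hR0 k) (hR k)).2 x y
    have h2 := (hblk t (-1) k _ (Or.inr rfl) (hR0 k) (hR k)).2 x y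
    have e : w k x - w k y = (blk g t 1 k x - blk g t 1 k y) + (blk g t (-1) k x - blk g t (-1) k y) := by
      simp only [hw]; ring
    rw [e]
    refine (norm_add_le _ _).trans ((add_le_add h1 h2).trans (le_of_eq ?_))
    simp only [hA]
    rw [← hhalf]; field_simp; ring
  have hsA : Summable A := (summ_geo q⁻¹ (by positivity) (inv_lt_one_of_one_lt₀ hq1)).mul_left _
  have hsw : ∀ x, Summable (fun k => w k x) := fun x => Summable.of_norm_bounded hsA (fun k => hb1 k x)
  have hwc : ∀ k, Continuous (w k) := fun k => (blk_cont _ _ _ _).add (blk_cont _ _ _ _)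
  have hUc : Continuous (fun x => ∑' k, w k x) := continuous_tsum hwc hsA hb1
  refine ⟨fun x => fourierCoef g 0 + ∑' k, w k x, ?_, ?_, ?_⟩
  · intro x
    simp only [hw, blk_per]
  · intro n
    rw [fc_add _ _ continuous_const hUc, fc_const]
    have hs : HasSum (fun k => fourierCoef (w k) n) (fourierCoef (fun x => ∑' k, w k x) n) := by
      unfold fourierCoef
      apply HasSum.mul_left
      refine intervalIntegral.hasSum_integral_of_dominated_convergence (fun k _ => A k) ?_ ?_ ?_ ?_ ?_
      · intro k
        apply Continuous.aestronglyMeasurable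
        have := hwc k
        fun_prop
      · intro k
        refine Filter.Eventually.of_forall fun x _ => ?_
        rw [norm_mul]
        have : ‖Complex.exp (-Complex.I * (n:ℂ) * (x:ℂ))‖ = 1 := by
          have e : -Complex.I * (n:ℂ) * (x:ℂ) = ((-(n * x) : ℝ) : ℂ) * Complex.I := by push_cast; ring
          rw [e]; exact Complex.norm_exp_ofReal_mul_I _
        rw [this, one_mul]
        exact hb1 k x
      · exact Filter.Eventually.of_forall fun x _ => hsA
      · exact intervalIntegrable_const
      · exact Filter.Eventually.of_forall fun x _ => (hsw x).hasSum.mul_left _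
    have e : ∀ k, fourierCoef (w k) n = if n ≠ 0 ∧ Nat.log 2 n.natAbs = k then
      Complex.exp (-Complex.I * (t : ℂ) * (n : ℂ) ^ 2) * fourierCoef g n else 0 := by
      intro k
      rw [← fc_blk2, ← fc_add _ _ (blk_cont _ _ _ _) (blk_cont _ _ _ _)]
    simp_rw [e] at hs
    by_cases hn : n = 0
    · subst hn
      simp only [ne_eq, not_true_eq_false, false_and, if_false] at hs
      rw [hs.unique hasSum_zero]
      simp
    · simp only [ne_eq, hn, not_false_eq_true, true_and] at hs
      have h2 := hasSum_ite_eq (Nat.log 2 n.natAbs) (Complex.exp (-Complex.I * (t : ℂ) * (n : ℂ) ^ 2) * fourierCoef g n)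
      simp only [eq_comm] at hs h2
      rw [hs.unique h2]
      simp [hn]
  · intro α hα hα2
    set ρ : ℝ := q⁻¹ * 2 ^ α with hρ
    have hρ0 : 0 < ρ := by positivity
    have hρ1 : ρ < 1 := by
      rw [hρ, inv_mul_lt_one₀ hq0, hq, Real.sqrt_eq_rpow]
      exact Real.rpow_lt_rpow_of_exponent_lt (by norm_num) hα2
    set D : ℕ → ℝ := fun k => 4 * K * C * (((k:ℝ) + 1) ^ 2 * ρ ^ k) with hD
    have hsD : Summable D := (summ_geo ρ hρ0 hρ1).mul_left _
    refine ⟨∑' k, D k, fun x y => ?_⟩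
    have hk : ∀ k, ‖w k x - w k y‖ ≤ D k * |x - y| ^ α := by
      intro k
      have h := min_interp ‖w k x - w k y‖ (2 * A k) (2 ^ k * |x - y|) α (by linarith [hA0 k]) (by positivity) ?_ ?_ hα (by linarith)
      · refine h.trans (le_of_eq ?_)
        rw [Real.mul_rpow (by positivity) (abs_nonneg _)]
        have : ((2:ℝ) ^ k) ^ α = (2 ^ α) ^ k := by
          rw [← Real.rpow_natCast, ← Real.rpow_mul (by norm_num), mul_comm, Real.rpow_mul (by norm_num), Real.rpow_natCast]
        rw [this]
        simp only [hA, hD, hρ]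
        rw [mul_pow]; ring
      · exact (norm_sub_le _ _).trans (by linarith [hb1 k x, hb1 k y])
      · have := hb2 k x y
        nlinarith [(norm_nonneg _).trans this]
    have e : fourierCoef g 0 + ∑' k, w k x - (fourierCoef g 0 + ∑' k, w k y) = ∑' k, (w k x - w k y) := by
      rw [(hsw x).tsum_sub (hsw y)]; ring
    rw [e, ← tsum_mul_right]
    exact tsum_of_norm_bounded (hsD.mul_right _).hasSum hk
end
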